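/- Let $(\Omega,\mathcal F,P)$ be a complete probability space with a filtration $(\mathcal F_t)_{t=0}^T$ of complete sub-$\sigma$-algebras of $\mathcal F$, and let $d\ge 0$. Write $E_t=E[\,\cdot\,|\mathcal F_t]$, let $\mathcal N$ be the set of $x=(x_t)_{t=0}^T$ with $x_t\in L^0(\Omega,\mathcal F_t,P;\mathbb R^d)$, and let $\mathcal N^\infty\subset\mathcal N$ be the essentially bounded ones. The expectation of an extended-real-valued measurable function is defined as $+\infty$ unless its positive part is integrable. For $t=0,\dots,T$ let $K_t:\mathbb R^d\times\mathbb R^d\times\Omega\to(-\infty,+\infty]$ be an $\mathcal F_t$-measurable convex normal integrand, i.e. $\omega\mapsto\operatorname{epi}K_t(\cdot,\cdot,\omega)$ is closed convex-valued and $\{\omega: \operatorname{epi}K_t(\cdot,\cdot,\omega)\cap O\neq\emptyset\}\in\mathcal F_t$ for every open $O\subset\mathbb R^d\times\mathbb R^d\times\mathbb R$ (since $\mathcal F_t$ is complete, equivalently: $K_t$ is $\mathcal B(\mathbb R^d\times\mathbb R^d)\otimes\mathcal F_t$-measurable and $K_t(\cdot,\cdot,\omega)$ is convex and lower semicontinuous).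 Put $$Ef(x,u)=E\sum_{t=0}^T K_t(x_t,\Delta x_t+u_t),\qquad \Delta x_t=x_t-x_{t-1},\quad x_{-1}:=0,$$ $$K_t^*(v,y,\omega)=\sup_{x,u\in\mathbb R^d}\{x\cdot v+u\cdot y-K_t(x,u,\omega)\},\qquad \operatorname{dom}_1K_t(\omega)=\{x\in\mathbb R^d:\ K_t(x,u,\omega)<\infty\text{ for some }u\}.$$ Let $\mathcal U,\mathcal Y\subset L^0(\Omega,\mathcal F,P;\mathbb R^{(T+1)d})$ be decomposable linear subspaces (for $A\in\mathcal F$, $u\in\mathcal U$ and $u'\in L^\infty$ one has $1_Au+1_{\Omega\setminus A}u'\in\mathcal U$, and likewise for $\mathcal Y$) such that $u\cdot y$ is integrable for all $u\in\mathcal U$, $y\in\mathcal Y$ and $\langle u,y\rangle=E(u\cdot y)$ puts $\mathcal U$ and $\mathcal Y$ in separating duality. Let $\operatorname{dom}_1Ef=\{x\in\mathcal N:\ Ef(x,u)<+\infty\text{ for some }u\in\mathcal U\}$ and $$\varphi(u)=\inf_{x\in\mathcal N}Ef(x,u),\quad u\in\mathcal U.$$ Assume: (i) there is at least one $x\in\mathcal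 N^\infty$ with $x_t\in\operatorname{cl}\operatorname{dom}_1K_t$ a.s. for all $t$, and for every such $x$ there exists $\bar x\in\mathcal N^\infty$ with $\bar x_t\in\operatorname{ri}\operatorname{dom}_1K_t$ a.s. for all $t$ and $(1-\lambda)x+\lambda\bar x\in\operatorname{dom}_1Ef$ for all $\lambda\in(0,1)$; (ii) for every $u\in\mathcal U$ and $y\in\mathcal Y$ the adapted projections $({}^au)_t=E_tu_t$ and $({}^ay)_t=E_ty_t$ satisfy ${}^au\in\mathcal U$ and ${}^ay\in\mathcal Y$. Then for every adapted $u\in\mathcal U\cap\mathcal N$ $$(\operatorname{cl}\varphi)(u)=\sup_{y\in\mathcal Y\cap\mathcal N}E\sum_{t=0}^T\bigl[u_t\cdot y_t-K_t^*(E_t\Delta y_{t+1},y_t)\bigr],\qquad \Delta y_{t+1}=y_{t+1}-y_t,\quad y_{T+1}:=0,$$ where $\operatorname{cl}\varphi$ is the closure of $\varphi$, i.e. its greatest convex minorant that is $\sigma(\mathcal U,\mathcal Y)$-lower semicontinuous and either proper or constant. Moreover $(\operatorname{cl}\varphi)(u)=\sup_{y\in\mathcal Y}\{\langle u,y\rangle-\varphi^*(y)\}$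 with $\varphi^*(y)=\sup_{u'\in\mathcal U}\{\langle u',y\rangle-\varphi(u')\}$. -/

import Mathlib

open MeasureTheory
open scoped ENNReal

noncomputable section

namespace Bolza

/-- Paths `(z_0,…,z_T)` with `z_t ∈ ℝ^d`. -/
abbrev Traj (T d : ℕ) : Type := Fin (T + 1) → Fin d → ℝ

/-- Expectation of an extended-real-valued function: `+∞` unless the positive part is
integrable. -/
def EE {Ω : Type*} {mΩ : MeasurableSpace Ω} (P : Measure Ω) (g : Ω → EReal) : EReal :=
  if ∫⁻ ω, (g ω).toENNReal ∂P = ⊤ then ⊤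
  else ((∫⁻ ω, (g ω).toENNReal ∂P : ℝ≥0∞) : EReal)
    - ((∫⁻ ω, (-(g ω)).toENNReal ∂P : ℝ≥0∞) : EReal)

/-- The epigraph of an extended-real-valued function. -/
def epi {E : Type*} (g : E → EReal) : Set (E × ℝ) := {p | g p.1 ≤ (p.2 : EReal)}

/-- `k` is a convex normal integrand with respect to the σ-algebra `m`: its epigraphical
mapping `ω ↦ epi k(·,ω)` is closed convex-valued and `m`-measurable, i.e. the set of `ω` whose
epigraph meets a given open set belongs to `m`. When `m` is complete this says that `k` is jointly
measurable with respect to the product of the Borel σ-algebra and `m`, and that `k(·,ω)` is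
lower semicontinuous and convex. -/
structure IsConvexNormalIntegrand {Ω E : Type*} [AddCommGroup E] [Module ℝ E]
    [TopologicalSpace E] (m : MeasurableSpace Ω) (k : E → Ω → EReal) : Prop where
  isClosed_epi : ∀ ω, IsClosed (epi fun z => k z ω)
  convex_epi : ∀ ω, Convex ℝ (epi fun z => k z ω)
  measurable_epi : ∀ O : Set (E × ℝ), IsOpen O →
    MeasurableSet[m] {ω | ((epi fun z => k z ω) ∩ O).Nonempty}

/-- The scalar product on `ℝ^{(T+1)d}`. -/
def dotB {T d : ℕ} (a b : Traj T d) : ℝ := ∑ t, a t ⬝ᵥ b t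

/-- `Δx_t = x_t − x_{t-1}` with the convention `x_{-1} := 0`. -/
def deltaX {T d : ℕ} (x : Traj T d) (t : Fin (T + 1)) : Fin d → ℝ :=
  x t - (if (t : ℕ) = 0 then 0 else
    x ⟨(t : ℕ) - 1, Nat.lt_of_le_of_lt (Nat.sub_le _ _) t.isLt⟩)

/-- `Δy_{t+1} = y_{t+1} − y_t` with the convention `y_{T+1} := 0`. -/
def deltaNext {T d : ℕ} (y : Traj T d) (t : Fin (T + 1)) : Fin d → ℝ :=
  (if h : (t : ℕ) = T then 0 else
    y ⟨(t : ℕ) + 1, Nat.succ_lt_succ (Nat.lt_of_le_of_ne (Nat.lt_succ_iff.mp t.isLt) h)⟩) - y t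

section

variable {Ω : Type*} {mΩ : MeasurableSpace Ω} {T d : ℕ}

/-- The space `𝓝` of adapted processes. -/
def Adap (d : ℕ) (ℱ : Filtration (Fin (T + 1)) mΩ) : Set (Ω → Traj T d) :=
  {x | ∀ t, Measurable[ℱ t] (fun ω => x ω t)}

/-- The space `𝓝^∞` of essentially bounded adapted processes. -/
def AdapInf (d : ℕ) (P : Measure Ω) (ℱ : Filtration (Fin (T + 1)) mΩ) : Set (Ω → Traj T d) :=
  {x | x ∈ Adap d ℱ ∧ ∃ M : ℝ, ∀ᵐ ω ∂P, ‖x ω‖ ≤ M}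

/-- `dom₁ K_t(ω)`. -/
def dom1K (K : Fin (T + 1) → (Fin d → ℝ) × (Fin d → ℝ) → Ω → EReal) (t : Fin (T + 1)) (ω : Ω) :
    Set (Fin d → ℝ) :=
  {x | ∃ u, K t (x, u) ω < ⊤}

/-- `K_t*(v,y,ω) = sup_{x,u} {x·v + u·y − K_t(x,u,ω)}`. -/
def Kconj (K : Fin (T + 1) → (Fin d → ℝ) × (Fin d → ℝ) → Ω → EReal) (t : Fin (T + 1))
    (v y : Fin d → ℝ) (ω : Ω) : EReal :=
  ⨆ (x : Fin d → ℝ) (u : Fin d → ℝ), (((x ⬝ᵥ v + u ⬝ᵥ y : ℝ) : EReal) - K t (x, u) ω)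

/-- `f(x,u,ω) = Σ_{t=0}^T K_t(x_t, Δx_t + u_t, ω)`. -/
def fB (K : Fin (T + 1) → (Fin d → ℝ) × (Fin d → ℝ) → Ω → EReal) (x u : Traj T d) (ω : Ω) :
    EReal :=
  ∑ t, K t (x t, deltaX x t + u t) ω

/-- `Ef(x,u)`. -/
def Ef (P : Measure Ω) (K : Fin (T + 1) → (Fin d → ℝ) × (Fin d → ℝ) → Ω → EReal)
    (x u : Ω → Traj T d) : EReal :=
  EE P fun ω => fB K (x ω) (u ω) ω

/-- `dom₁ Ef`. -/
def dom1Ef (P : Measure Ω) (ℱ : Filtration (Fin (T + 1)) mΩ)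
    (K : Fin (T + 1) → (Fin d → ℝ) × (Fin d → ℝ) → Ω → EReal)
    (𝓤 : Submodule ℝ (Ω → Traj T d)) : Set (Ω → Traj T d) :=
  {x | x ∈ Adap d ℱ ∧ ∃ u ∈ 𝓤, Ef P K x u < ⊤}

/-- The value function `φ(u) = inf_{x∈𝓝} Ef(x,u)`. -/
def phi (P : Measure Ω) (ℱ : Filtration (Fin (T + 1)) mΩ)
    (K : Fin (T + 1) → (Fin d → ℝ) × (Fin d → ℝ) → Ω → EReal) (u : Ω → Traj T d) : EReal :=
  ⨅ x ∈ Adap d ℱ, Ef P K x u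

/-- The adapted projection `(ᵃu)_t = E_t u_t`. -/
def aProj (P : Measure Ω) (ℱ : Filtration (Fin (T + 1)) mΩ) (u : Ω → Traj T d) : Ω → Traj T d :=
  fun ω t => (P[fun ω' => u ω' t | ℱ t]) ω

/-- `E_t Δy_{t+1}`. -/
def condDelta (P : Measure Ω) (ℱ : Filtration (Fin (T + 1)) mΩ) (y : Ω → Traj T d)
    (t : Fin (T + 1)) : Ω → Fin d → ℝ :=
  P[fun ω => deltaNext (y ω) t | ℱ t]

/-- Decomposability: `1_A u + 1_{Ω∖A} u'` stays in the space for `u` in the space and `u'`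
essentially bounded. -/
def Decomposable (P : Measure Ω) (S : Submodule ℝ (Ω → Traj T d)) : Prop :=
  ∀ A : Set Ω, MeasurableSet A → ∀ u ∈ S, ∀ u' : Ω → Traj T d,
    Measurable u' → (∃ M : ℝ, ∀ᵐ ω ∂P, ‖u' ω‖ ≤ M) →
    A.indicator u + Aᶜ.indicator u' ∈ S

/-- The pairing `⟨u,y⟩ = E(u·y)`. -/
def pairB (P : Measure Ω) (u y : Ω → Traj T d) : ℝ := ∫ ω, dotB (u ω) (y ω) ∂P

/-- The pairing is well defined on `𝓤 × 𝓨` and separates points (elements being identified when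
they are equal almost surely). -/
structure SeparatingDuality (P : Measure Ω) (𝓤 𝓨 : Submodule ℝ (Ω → Traj T d)) : Prop where
  integrable : ∀ u ∈ 𝓤, ∀ y ∈ 𝓨, Integrable (fun ω => dotB (u ω) (y ω)) P
  separates_left : ∀ u ∈ 𝓤, (∀ y ∈ 𝓨, pairB P u y = 0) → u =ᵐ[P] 0
  separates_right : ∀ y ∈ 𝓨, (∀ u ∈ 𝓤, pairB P u y = 0) → y =ᵐ[P] 0

/-- The weak topology `σ(𝓤,𝓨)` on `𝓤`. -/
@[reducible]
def weakTop (P : Measure Ω) (𝓤 𝓨 : Submodule ℝ (Ω → Traj T d)) : TopologicalSpace 𝓤 :=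
  ⨅ y : 𝓨, TopologicalSpace.induced (fun u : 𝓤 => pairB P u.1 y.1) inferInstance

/-- Closed convex functions on `𝓤`: convex, `σ(𝓤,𝓨)`-lower semicontinuous, and either proper or
constant. -/
structure IsClosedConvex (P : Measure Ω) (𝓤 𝓨 : Submodule ℝ (Ω → Traj T d)) (g : 𝓤 → EReal) :
    Prop where
  convex : Convex ℝ (epi g)
  lsc : @LowerSemicontinuous 𝓤 EReal (weakTop P 𝓤 𝓨) _ g
  proper_or_const : ((∀ u, g u ≠ ⊥) ∧ ∃ u, g u ≠ ⊤) ∨ ∃ c, ∀ u, g u = c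

/-- The closure of a function on `𝓤`: its greatest `σ(𝓤,𝓨)`-closed convex minorant. -/
def cl (P : Measure Ω) (𝓤 𝓨 : Submodule ℝ (Ω → Traj T d)) (h : 𝓤 → EReal) (u : 𝓤) : EReal :=
  ⨆ g ∈ {g : 𝓤 → EReal | IsClosedConvex P 𝓤 𝓨 g ∧ g ≤ h}, g u

/-- The conjugate `h*(y) = sup_{u∈𝓤} {⟨u,y⟩ − h(u)}`. -/
def conj (P : Measure Ω) (𝓤 : Submodule ℝ (Ω → Traj T d)) (h : 𝓤 → EReal) (y : Ω → Traj T d) :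
    EReal :=
  ⨆ u : 𝓤, (((pairB P u.1 y : ℝ) : EReal) - h u)

/-- The biconjugate `u ↦ sup_{y∈𝓨} {⟨u,y⟩ − h*(y)}`. -/
def biconj (P : Measure Ω) (𝓤 𝓨 : Submodule ℝ (Ω → Traj T d)) (h : 𝓤 → EReal) (u : 𝓤) : EReal :=
  ⨆ y : 𝓨, (((pairB P u.1 y.1 : ℝ) : EReal) - conj P 𝓤 h y.1)

end

end Bolza

end

open Bolza

namespace Bolza

open Filter Topology Set Metric

section RandomSets

variable {Ω : Type*} {m : MeasurableSpace Ω}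

theorem measurableSet_inter_compact_nonempty {E : Type*} [PseudoMetricSpace E]
    {θ : ℕ → Ω → E → ℝ} (hc : ∀ i ω, Continuous (θ i ω)) (hm : ∀ i q, Measurable fun ω => θ i ω q)
    {A : Set E} (hA : IsCompact A) :
    MeasurableSet {ω | ({q | ∀ i, θ i ω q ≤ 0} ∩ A).Nonempty} := by
  obtain ⟨D, hDA, hDc, hAD⟩ := hA.isSeparable.exists_countable_dense_subset
  have key : {ω | ({q | ∀ i, θ i ω q ≤ 0} ∩ A).Nonempty} =
      ⋂ n : ℕ, ⋃ q ∈ D, ⋂ i ∈ Finset.range n, {ω | θ i ω q < 1 / ((n : ℝ) + 1)} := by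
    ext ω
    simp only [mem_ofPred_eq, mem_iInter, mem_iUnion, Finset.mem_range, exists_prop]
    constructor
    · rintro ⟨q, hq, hqA⟩ n
      have hop : IsOpen {p | ∀ i ∈ Finset.range n, θ i ω p < 1 / ((n : ℝ) + 1)} := by
        have : {p | ∀ i ∈ Finset.range n, θ i ω p < 1 / ((n : ℝ) + 1)} =
            ⋂ i ∈ Finset.range n, {p | θ i ω p < 1 / ((n : ℝ) + 1)} := by ext; simp
        rw [this]
        exact isOpen_biInter_finset fun i _ => isOpen_lt (hc i ω) continuous_const
      have hmem : q ∈ {p | ∀ i ∈ Finset.range n, θ i ω p < 1 / ((n : ℝ) + 1)} :=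
        fun i _ => (hq i).trans_lt (by positivity)
      obtain ⟨p, hp, hpD⟩ := mem_closure_iff.1 (hAD hqA) _ hop hmem
      exact ⟨p, hpD, fun i hi => hp i (Finset.mem_range.2 hi)⟩
    · intro h
      choose q hqD hq using h
      obtain ⟨a, haA, φ, hφ, hlim⟩ := hA.tendsto_subseq fun n => hDA (hqD n)
      refine ⟨a, fun i => ?_, haA⟩
      have h1 : Tendsto (fun k => θ i ω (q (φ k))) atTop (𝓝 (θ i ω a)) :=
        ((hc i ω).tendsto a).comp hlim
      have h2 : Tendsto (fun k => 1 / (((φ k : ℕ) : ℝ) + 1)) atTop (𝓝 0) :=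
        tendsto_one_div_add_atTop_nhds_zero_nat.comp hφ.tendsto_atTop
      refine le_of_tendsto_of_tendsto h1 h2 ?_
      filter_upwards [eventually_gt_atTop i] with k hk
      exact (hq (φ k) i (hk.trans_le hφ.le_apply)).le
  rw [key]
  refine MeasurableSet.iInter fun n => MeasurableSet.biUnion hDc fun q _ =>
    Finset.measurableSet_biInter _ fun i _ => ?_
  exact measurableSet_lt (hm i q) measurable_const

theorem measurableSet_inter_open_nonempty {E : Type*} [PseudoMetricSpace E] [ProperSpace E]
    {θ : ℕ → Ω → E → ℝ} (hc : ∀ i ω, Continuous (θ i ω)) (hm : ∀ i q, Measurable fun ω => θ i ω q)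
    {O : Set E} (hO : IsOpen O) :
    MeasurableSet {ω | ({q | ∀ i, θ i ω q ≤ 0} ∩ O).Nonempty} := by
  obtain ⟨F, hFc, -, hFO, -⟩ := hO.exists_iUnion_isClosed
  have key : {ω | ({q | ∀ i, θ i ω q ≤ 0} ∩ O).Nonempty} =
      ⋃ n, ⋃ k, {ω | ({q | ∀ i, θ i ω q ≤ 0} ∩ (compactCovering E k ∩ F n)).Nonempty} := by
    ext ω
    simp only [mem_ofPred_eq, mem_iUnion]
    constructor
    · rintro ⟨q, hq, hqO⟩
      rw [← hFO] at hqO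
      obtain ⟨n, hn⟩ := mem_iUnion.1 hqO
      obtain ⟨k, hk⟩ := exists_mem_compactCovering q
      exact ⟨n, k, q, hq, hk, hn⟩
    · rintro ⟨n, k, q, hq, -, hn⟩
      exact ⟨q, hq, hFO ▸ mem_iUnion.2 ⟨n, hn⟩⟩
  rw [key]
  exact MeasurableSet.iUnion fun n => MeasurableSet.iUnion fun k =>
    measurableSet_inter_compact_nonempty hc hm ((isCompact_compactCovering E k).inter_right (hFc n))

/-- Closed convex-valued measurable multifunctions. -/
structure IsRandomConvex {E : Type*} [AddCommGroup E] [Module ℝ E] [TopologicalSpace E]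
    (m : MeasurableSpace Ω) (C : Ω → Set E) : Prop where
  isClosed : ∀ ω, IsClosed (C ω)
  convex : ∀ ω, Convex ℝ (C ω)
  measurable : ∀ O : Set E, IsOpen O → MeasurableSet[m] {ω | (C ω ∩ O).Nonempty}

theorem IsRandomConvex.measurableSet_nonempty {E : Type*} [AddCommGroup E] [Module ℝ E]
    [TopologicalSpace E] {C : Ω → Set E} (hC : IsRandomConvex m C) :
    MeasurableSet {ω | (C ω).Nonempty} := by
  simpa using hC.measurable univ isOpen_univ

theorem IsRandomConvex.measurable_infDist {E : Type*} [NormedAddCommGroup E] [NormedSpace ℝ E]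
    {C : Ω → Set E} (hC : IsRandomConvex m C) (p : E) :
    Measurable fun ω => infDist p (C ω) := by
  refine measurable_of_Iio fun r => ?_
  have : (fun ω => infDist p (C ω)) ⁻¹' Iio r =
      {ω | (C ω ∩ ball p r).Nonempty} ∪ ({ω | (C ω).Nonempty}ᶜ ∩ {_ω | 0 < r}) := by
    ext ω
    by_cases h : (C ω).Nonempty
    · simp only [mem_preimage, mem_Iio, infDist_lt_iff h, mem_union, mem_ofPred_eq, mem_inter_iff,
        mem_compl_iff, h, not_true_eq_false, false_and, or_false]
      simp only [Set.Nonempty, mem_inter_iff, mem_ball, dist_comm p]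
    · have h' := not_nonempty_iff_eq_empty.1 h
      simp [h']
  rw [this]
  exact (hC.measurable _ isOpen_ball).union (hC.measurableSet_nonempty.compl.inter (.const _))

theorem IsRandomConvex.measurable_infDist_comp {E : Type*} [NormedAddCommGroup E]
    [NormedSpace ℝ E] [FiniteDimensional ℝ E] [MeasurableSpace E] [BorelSpace E]
    {C : Ω → Set E} (hC : IsRandomConvex m C) {p : Ω → E} (hp : Measurable p) :
    Measurable fun ω => infDist (p ω) (C ω) := by
  have : ProperSpace E := FiniteDimensional.proper ℝ E
  have h := measurable_uncurry_of_continuous_of_measurable (u := fun q ω => infDist q (C ω))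
    (fun ω => continuous_infDist_pt _) (fun q => hC.measurable_infDist q)
  have h2 : Measurable fun ω => (p ω, ω) := hp.prodMk measurable_id
  have h3 := h.comp h2
  simpa only [Function.comp_def, Function.uncurry] using h3

theorem IsRandomConvex.measurableSet_mem {E : Type*} [NormedAddCommGroup E]
    [NormedSpace ℝ E] [FiniteDimensional ℝ E] [MeasurableSpace E] [BorelSpace E]
    {C : Ω → Set E} (hC : IsRandomConvex m C) {p : Ω → E} (hp : Measurable p) :
    MeasurableSet {ω | p ω ∈ C ω} := by
  have : {ω | p ω ∈ C ω} = {ω | (C ω).Nonempty} ∩ {ω | infDist (p ω) (C ω) = 0} := by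
    ext ω
    simp only [mem_ofPred_eq, mem_inter_iff]
    constructor
    · exact fun h => ⟨⟨_, h⟩, infDist_zero_of_mem h⟩
    · rintro ⟨h1, h2⟩
      exact ((hC.isClosed ω).mem_iff_infDist_zero h1).2 h2
  rw [this]
  exact hC.measurableSet_nonempty.inter
    (hC.measurable_infDist_comp hp (measurableSet_singleton 0))

/-- A measurable random point has a measurable nearest point in a random closed convex set. -/
theorem IsRandomConvex.exists_measurable_proj {V : Type*} [NormedAddCommGroup V]
    [InnerProductSpace ℝ V] [FiniteDimensional ℝ V] [MeasurableSpace V] [BorelSpace V]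
    {C : Ω → Set V} (hC : IsRandomConvex m C) {p : Ω → V} (hp : Measurable p) :
    ∃ π : Ω → V, Measurable π ∧ ∀ ω, (C ω).Nonempty →
      π ω ∈ C ω ∧ dist (p ω) (π ω) = infDist (p ω) (C ω) ∧
        ∀ w ∈ C ω, inner ℝ (p ω - π ω) (w - π ω) ≤ 0 := by
  have : ProperSpace V := FiniteDimensional.proper ℝ V
  classical
  have hex : ∀ ω, (C ω).Nonempty → ∃ v ∈ C ω, infDist (p ω) (C ω) = dist (p ω) v :=
    fun ω h => (hC.isClosed ω).exists_infDist_eq_dist h _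
  have hinner : ∀ ω, ∀ v ∈ C ω, infDist (p ω) (C ω) = dist (p ω) v →
      ∀ w ∈ C ω, inner ℝ (p ω - v) (w - v) ≤ 0 := by
    intro ω v hv hd
    refine (norm_eq_iInf_iff_real_inner_le_zero (hC.convex ω) hv).1 ?_
    rw [← dist_eq_norm, ← hd, infDist_eq_iInf]
    simp [dist_eq_norm]
  have huniq : ∀ ω, ∀ v ∈ C ω, ∀ v' ∈ C ω, infDist (p ω) (C ω) = dist (p ω) v →
      dist (p ω) v' ≤ infDist (p ω) (C ω) → v' = v := by
    intro ω v hv v' hv' hd hd'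
    have h1 := hinner ω v hv hd v' hv'
    have h3 : dist (p ω) v' ≤ dist (p ω) v := hd ▸ hd'
    rw [dist_eq_norm, dist_eq_norm] at h3
    have h2 : ‖p ω - v'‖ ^ 2 = ‖p ω - v‖ ^ 2 - 2 * inner ℝ (p ω - v) (v' - v) + ‖v' - v‖ ^ 2 := by
      rw [← norm_sub_sq_real]; congr 2; abel
    have h4 : ‖p ω - v'‖ ^ 2 ≤ ‖p ω - v‖ ^ 2 := by gcongr
    have h5 : ‖v' - v‖ ^ 2 ≤ 0 := by linarith
    have h6 : ‖v' - v‖ = 0 := by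
      have := norm_nonneg (v' - v); nlinarith
    exact sub_eq_zero.1 (norm_eq_zero.1 h6)
  let π : Ω → V := fun ω => if h : (C ω).Nonempty then (hex ω h).choose else 0
  have hπ : ∀ ω, (h : (C ω).Nonempty) → π ω ∈ C ω ∧ infDist (p ω) (C ω) = dist (p ω) (π ω) := by
    intro ω h
    simp only [π, h, dif_pos]
    exact (hex ω h).choose_spec
  refine ⟨π, ?_, fun ω h => ⟨(hπ ω h).1, (hπ ω h).2.symm, hinner ω _ (hπ ω h).1 (hπ ω h).2⟩⟩
  refine measurable_of_isOpen fun O hO => ?_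
  let θ : ℕ → Ω → V → ℝ := fun i ω q =>
    if i = 0 then infDist q (C ω) else dist (p ω) q - infDist (p ω) (C ω)
  have hθ : ∀ ω, (C ω).Nonempty → ∀ q, (∀ i, θ i ω q ≤ 0) ↔ q = π ω := by
    intro ω h q
    constructor
    · intro hq
      have h0 : infDist q (C ω) ≤ 0 := by simpa [θ] using hq 0
      have h1 : dist (p ω) q - infDist (p ω) (C ω) ≤ 0 := by simpa [θ] using hq 1
      have hqC : q ∈ C ω :=
        ((hC.isClosed ω).mem_iff_infDist_zero h).2 (le_antisymm h0 infDist_nonneg)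
      exact huniq ω _ (hπ ω h).1 q hqC (hπ ω h).2 (by linarith)
    · rintro rfl i
      by_cases hi : i = 0
      · simp [θ, hi, infDist_zero_of_mem (hπ ω h).1]
      · simp [θ, hi, (hπ ω h).2]
  have hθc : ∀ i ω, Continuous (θ i ω) := by
    intro i ω
    by_cases hi : i = 0
    · simpa [θ, hi] using continuous_infDist_pt _
    · simp only [θ, hi, if_false]; fun_prop
  have hθm : ∀ i q, Measurable fun ω => θ i ω q := by
    intro i q
    by_cases hi : i = 0
    · simpa [θ, hi] using hC.measurable_infDist q
    · simp only [θ, hi, if_false]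
      exact (hp.dist measurable_const).sub (hC.measurable_infDist_comp hp)
  have hset : π ⁻¹' O = ({ω | (C ω).Nonempty} ∩ {ω | ({q | ∀ i, θ i ω q ≤ 0} ∩ O).Nonempty}) ∪
      ({ω | (C ω).Nonempty}ᶜ ∩ {_ω | (0 : V) ∈ O}) := by
    ext ω
    by_cases h : (C ω).Nonempty
    · simp only [mem_preimage, mem_union, mem_inter_iff, mem_ofPred_eq, mem_compl_iff, h, true_and,
        not_true_eq_false, false_and, or_false, hθ ω h]
      simp [Set.Nonempty]
    · simp [h, π]
  rw [hset]
  exact (hC.measurableSet_nonempty.inter (measurableSet_inter_open_nonempty hθc hθm hO)).union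
    (hC.measurableSet_nonempty.compl.inter (.const _))

theorem IsRandomConvex.preimage_equiv {E V : Type*} [AddCommGroup E] [Module ℝ E]
    [TopologicalSpace E] [AddCommGroup V] [Module ℝ V] [TopologicalSpace V] (L : V ≃L[ℝ] E)
    {C : Ω → Set E} (hC : IsRandomConvex m C) : IsRandomConvex m fun ω => L ⁻¹' C ω where
  isClosed ω := (hC.isClosed ω).preimage L.continuous
  convex ω := (hC.convex ω).linear_preimage L.toLinearMap
  measurable O hO := by
    have := hC.measurable (L '' O) (L.toHomeomorph.isOpenMap O hO)
    convert this using 3 with ω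
    constructor
    · rintro ⟨v, hv, hO⟩
      exact ⟨L v, hv, v, hO, rfl⟩
    · rintro ⟨_, hv, v, hO, rfl⟩
      exact ⟨v, hv, hO⟩

/-- Castaing representation. -/
theorem IsRandomConvex.exists_castaing {E : Type*} [NormedAddCommGroup E]
    [NormedSpace ℝ E] [FiniteDimensional ℝ E] [MeasurableSpace E] [BorelSpace E]
    {C : Ω → Set E} (hC : IsRandomConvex m C) :
    ∃ c : ℕ → Ω → E, (∀ n, Measurable (c n)) ∧ ∀ ω, (C ω).Nonempty →
      (∀ n, c n ω ∈ C ω) ∧ C ω ⊆ closure (range fun n => c n ω) := by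
  let L : EuclideanSpace ℝ (Fin (Module.finrank ℝ E)) ≃L[ℝ] E := (toEuclidean (E := E)).symm
  have hC' := hC.preimage_equiv L
  choose π hπm hπ using fun n : ℕ => hC'.exists_measurable_proj
    (p := fun _ => TopologicalSpace.denseSeq (EuclideanSpace ℝ (Fin (Module.finrank ℝ E))) n)
    measurable_const
  refine ⟨fun n ω => L (π n ω), fun n => L.continuous.measurable.comp (hπm n), fun ω hω => ?_⟩
  have hne : (L ⁻¹' C ω).Nonempty := by
    obtain ⟨e, he⟩ := hω
    exact ⟨L.symm e, by simpa using he⟩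
  refine ⟨fun n => (hπ n ω hne).1, fun e he => ?_⟩
  have h1 : L.symm e ∈ closure (range fun n => π n ω) := by
    rw [Metric.mem_closure_iff]
    intro ε hε
    obtain ⟨_, ⟨n, rfl⟩, hq⟩ := Metric.mem_closure_iff.1
      (TopologicalSpace.denseRange_denseSeq (EuclideanSpace ℝ (Fin (Module.finrank ℝ E)))
        (L.symm e)) (ε / 2) (half_pos hε)
    refine ⟨_, ⟨n, rfl⟩, ?_⟩
    have h2 := (hπ n ω hne).2.1
    have h3 : infDist (TopologicalSpace.denseSeq _ n) (L ⁻¹' C ω) ≤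
        dist (TopologicalSpace.denseSeq _ n) (L.symm e) :=
      infDist_le_dist_of_mem (by simpa using he)
    have h4 := dist_triangle (L.symm e) (TopologicalSpace.denseSeq _ n) (π n ω)
    rw [dist_comm] at h3
    linarith
  have h2 := image_closure_subset_closure_image L.continuous (mem_image_of_mem L h1)
  rw [L.apply_symm_apply, ← range_comp] at h2
  exact h2

end RandomSets

section CondExp

/-- The scalar product of `ℝ^d` as a continuous bilinear map. -/
noncomputable def dotCLM (d : ℕ) : (Fin d → ℝ) →L[ℝ] (Fin d → ℝ) →L[ℝ] ℝ :=
  ∑ i, (ContinuousLinearMap.mul ℝ ℝ).bilinearComp (ContinuousLinearMap.proj i)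
    (ContinuousLinearMap.proj i)

@[simp]
theorem dotCLM_apply {d : ℕ} (a b : Fin d → ℝ) : dotCLM d a b = a ⬝ᵥ b := by
  simp [dotCLM, dotProduct]

theorem abs_dot_le {d : ℕ} (a b : Fin d → ℝ) : |a ⬝ᵥ b| ≤ ‖dotCLM d‖ * ‖a‖ * ‖b‖ := by
  simpa using (dotCLM d).le_opNorm₂ a b

theorem measurable_dot {Ω : Type*} {m : MeasurableSpace Ω} {d : ℕ} {a b : Ω → Fin d → ℝ}
    (ha : Measurable a) (hb : Measurable b) : Measurable fun ω => a ω ⬝ᵥ b ω := by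
  unfold dotProduct
  fun_prop

theorem continuous_dot {X : Type*} [TopologicalSpace X] {d : ℕ} {a b : X → Fin d → ℝ}
    (ha : Continuous a) (hb : Continuous b) : Continuous fun ω => a ω ⬝ᵥ b ω := by
  unfold dotProduct
  fun_prop

variable {Ω : Type*} {mΩ : MeasurableSpace Ω} {P : Measure Ω} [IsProbabilityMeasure P]

theorem IsRandomConvex.condExp_mem_of_inner {m : MeasurableSpace Ω} (hm : m ≤ mΩ)
    {V : Type*} [NormedAddCommGroup V]
    [InnerProductSpace ℝ V] [FiniteDimensional ℝ V] [MeasurableSpace V] [BorelSpace V]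
    {C : Ω → Set V} (hC : IsRandomConvex m C) {ζ : Ω → V} (hζ : Integrable ζ P) {B : Set Ω}
    (hB : MeasurableSet[m] B) (hmem : ∀ᵐ ω ∂P, ω ∈ B → ζ ω ∈ C ω) :
    ∀ᵐ ω ∂P, ω ∈ B → (P[ζ|m]) ω ∈ C ω := by
  have : CompleteSpace V := FiniteDimensional.complete ℝ V
  have hZ : StronglyMeasurable[m] (P[ζ|m]) := stronglyMeasurable_condExp
  obtain ⟨π, hπm, hπ⟩ := hC.exists_measurable_proj hZ.measurable
  have hnm : Measurable[m] fun ω => (P[ζ|m]) ω - π ω := hZ.measurable.sub hπm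
  have key : ∀ k : ℕ, ∀ᵐ ω ∂P, ω ∈ B → ‖(P[ζ|m]) ω - π ω‖ ≤ k → ‖π ω‖ ≤ k →
      (P[ζ|m]) ω - π ω = 0 := by
    intro k
    let A : Set Ω := B ∩ ({ω | ‖(P[ζ|m]) ω - π ω‖ ≤ k} ∩ {ω | ‖π ω‖ ≤ k})
    have hA : MeasurableSet[m] A := hB.inter
      ((measurableSet_le hnm.norm measurable_const).inter
        (measurableSet_le hπm.norm measurable_const))
    let f : Ω → V := A.indicator fun ω => (P[ζ|m]) ω - π ω
    have hfm : StronglyMeasurable[m] f := (hnm.indicator hA).stronglyMeasurable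
    have hfb : ∀ ω, ‖f ω‖ ≤ k := by
      intro ω
      by_cases h : ω ∈ A
      · simpa [f, h] using h.2.1
      · simp [f, h]
    have h1 : ∫ ω, inner ℝ (f ω) (ζ ω) ∂P = ∫ ω, inner ℝ (f ω) ((P[ζ|m]) ω) ∂P := by
      have := condExp_stronglyMeasurable_bilin_of_bound (innerSL ℝ) hm hfm hζ k
        (ae_of_all _ hfb)
      rw [← integral_condExp hm]
      exact integral_congr_ae this
    have hInt : ∀ ξ : Ω → V, Integrable ξ P → Integrable (fun ω => inner ℝ (f ω) (ξ ω)) P := by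
      intro ξ hξ
      refine (hξ.norm.const_mul (k : ℝ)).mono
        ((hfm.mono hm).aestronglyMeasurable.inner hξ.aestronglyMeasurable) (ae_of_all _ fun ω => ?_)
      refine (norm_inner_le_norm _ _).trans ?_
      simp only [norm_mul, norm_norm, RCLike.norm_natCast]
      gcongr
      exact hfb ω
    let π' : Ω → V := A.indicator π
    have hπ'm : Measurable[m] π' := hπm.indicator hA
    have hπ' : Integrable π' P := by
      refine Integrable.of_bound (hπ'm.mono hm le_rfl).aestronglyMeasurable (k : ℝ)
        (ae_of_all _ fun ω => ?_)
      by_cases h : ω ∈ A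
      · simpa [π', h] using h.2.2
      · simp [π', h]
    have h2 : ∫ ω, inner ℝ (f ω) (ζ ω) ∂P ≤ ∫ ω, inner ℝ (f ω) (π' ω) ∂P := by
      refine integral_mono_ae (hInt _ hζ) (hInt _ hπ') ?_
      filter_upwards [hmem] with ω hω
      by_cases h : ω ∈ A
      · have h3 := (hπ ω ⟨_, hω h.1⟩).2.2 _ (hω h.1)
        rw [inner_sub_right] at h3
        simp only [f, π', h, indicator_of_mem]
        linarith
      · simp [f, h]
    have h3 : ∫ ω, ‖f ω‖ ^ 2 ∂P = 0 := by
      have h4 : ∀ ω, ‖f ω‖ ^ 2 = inner ℝ (f ω) ((P[ζ|m]) ω) - inner ℝ (f ω) (π' ω) := by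
        intro ω
        rw [← inner_sub_right, ← real_inner_self_eq_norm_sq]
        by_cases h : ω ∈ A
        · simp [f, π', h]
        · simp [f, h]
      refine le_antisymm ?_ (integral_nonneg fun ω => by positivity)
      simp_rw [h4]
      rw [integral_sub (hInt _ integrable_condExp) (hInt _ hπ'), ← h1]
      linarith
    have h5 : (fun ω => ‖f ω‖ ^ 2) =ᵐ[P] 0 := by
      refine (integral_eq_zero_iff_of_nonneg (fun ω => by positivity) ?_).1 h3
      refine Integrable.of_bound (((hfm.mono hm).norm.pow 2).aestronglyMeasurable) ((k : ℝ) ^ 2)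
        (ae_of_all _ fun ω => ?_)
      rw [Real.norm_of_nonneg (by positivity)]
      gcongr
      exact hfb ω
    filter_upwards [h5] with ω hω h6 h7 h8
    have h9 : f ω = 0 := by simpa using hω
    have h10 : ω ∈ A := ⟨h6, h7, h8⟩
    simpa [f, h10] using h9
  filter_upwards [ae_all_iff.2 key, hmem] with ω hω hmω hB
  obtain ⟨k, hk⟩ := exists_nat_ge (max ‖(P[ζ|m]) ω - π ω‖ ‖π ω‖)
  have := hω k hB ((le_max_left _ _).trans hk) ((le_max_right _ _).trans hk)
  rw [sub_eq_zero.1 this]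
  exact (hπ ω ⟨_, hmω hB⟩).1

/-- The conditional expectation of a selection of a random closed convex set is a selection. -/
theorem IsRandomConvex.condExp_mem {m : MeasurableSpace Ω} (hm : m ≤ mΩ)
    {E : Type*} [NormedAddCommGroup E] [NormedSpace ℝ E] [FiniteDimensional ℝ E]
    {C : Ω → Set E} (hC : IsRandomConvex m C) {ζ : Ω → E} (hζ : Integrable ζ P) {B : Set Ω}
    (hB : MeasurableSet[m] B) (hmem : ∀ᵐ ω ∂P, ω ∈ B → ζ ω ∈ C ω) :
    ∀ᵐ ω ∂P, ω ∈ B → (P[ζ|m]) ω ∈ C ω := by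
  let L : E ≃L[ℝ] EuclideanSpace ℝ (Fin (Module.finrank ℝ E)) := toEuclidean (E := E)
  have : CompleteSpace E := FiniteDimensional.complete ℝ E
  have h1 := (hC.preimage_equiv L.symm).condExp_mem_of_inner hm
    (L.toContinuousLinearMap.integrable_comp hζ) hB (by simpa using hmem)
  filter_upwards [h1, L.toContinuousLinearMap.comp_condExp_comm (m := m) hζ] with ω h2 h3 hB
  have h4 := h2 hB
  have h5 : (L ∘ ζ) = fun a => L.toContinuousLinearMap (ζ a) := rfl
  have h3' : L ((P[ζ|m]) ω) = (P[fun a => L.toContinuousLinearMap (ζ a)|m]) ω := h3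
  rw [← h3'] at h4
  simpa using h4

theorem integral_dot_condExp {m : MeasurableSpace Ω} (hm : m ≤ mΩ) {d : ℕ} {x q : Ω → Fin d → ℝ}
    (hx : Measurable[m] x) (hq : Integrable q P) {A : Set Ω} (hA : MeasurableSet[m] A) {c : ℝ}
    (hc : ∀ ω ∈ A, ‖x ω‖ ≤ c) :
    IntegrableOn (fun ω => x ω ⬝ᵥ q ω) A P ∧ IntegrableOn (fun ω => x ω ⬝ᵥ (P[q|m]) ω) A P ∧
      ∫ ω in A, x ω ⬝ᵥ q ω ∂P = ∫ ω in A, x ω ⬝ᵥ (P[q|m]) ω ∂P := by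
  let f : Ω → Fin d → ℝ := A.indicator x
  have hfm : StronglyMeasurable[m] f := (hx.indicator hA).stronglyMeasurable
  have hfb : ∀ ω, ‖f ω‖ ≤ max c 0 := by
    intro ω
    by_cases h : ω ∈ A
    · simpa [f, h] using Or.inl (hc ω h)
    · simp [f, h]
  have hf : ∀ ξ : Ω → Fin d → ℝ, A.indicator (fun ω => x ω ⬝ᵥ ξ ω) = fun ω => f ω ⬝ᵥ ξ ω := by
    intro ξ
    ext ω
    by_cases h : ω ∈ A <;> simp [f, h]
  have hInt : ∀ ξ : Ω → Fin d → ℝ, Integrable ξ P → Integrable (fun ω => f ω ⬝ᵥ ξ ω) P := by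
    intro ξ hξ
    refine (hξ.norm.const_mul (‖dotCLM d‖ * max c 0)).mono ?_ (ae_of_all _ fun ω => ?_)
    · simpa using (dotCLM d).aestronglyMeasurable_comp₂ (hfm.mono hm).aestronglyMeasurable
        hξ.aestronglyMeasurable
    · rw [Real.norm_eq_abs]
      refine (abs_dot_le _ _).trans ?_
      rw [Real.norm_of_nonneg (by positivity)]
      gcongr
      exact hfb ω
  have hA' := hm _ hA
  refine ⟨(integrable_indicator_iff hA').1 ?_, (integrable_indicator_iff hA').1 ?_, ?_⟩
  · rw [hf]; exact hInt _ hq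
  · rw [hf]; exact hInt _ integrable_condExp
  · rw [← integral_indicator hA', ← integral_indicator hA', hf, hf]
    have := condExp_stronglyMeasurable_bilin_of_bound (dotCLM d) hm hfm hq (max c 0)
      (ae_of_all _ hfb)
    simp only [dotCLM_apply] at this
    rw [← integral_condExp hm]
    exact integral_congr_ae this

theorem integrable_of_localized_condExp {Ω : Type*} {m mΩ : MeasurableSpace Ω} {P : Measure Ω}
    [IsProbabilityMeasure P] (hm : m ≤ mΩ) {S S' : Ω → ℝ}
    (hS' : Measurable[m] S') {A : ℕ → Set Ω} (hA : ∀ k, MeasurableSet[m] (A k))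
    (hmono : Monotone A) (hU : ⋃ k, A k = univ) (hSA : ∀ k, IntegrableOn S (A k) P)
    (hSA' : ∀ k, IntegrableOn S' (A k) P)
    (heq : ∀ k B, MeasurableSet[m] B → ∫ ω in B ∩ A k, S ω ∂P = ∫ ω in B ∩ A k, S' ω ∂P)
    (hpos : Integrable (fun ω => max (S ω) 0) P) :
    Integrable (fun ω => max (S' ω) 0) P ∧
      (Integrable S' P → Integrable S P ∧ ∫ ω, S ω ∂P = ∫ ω, S' ω ∂P) := by
  have hcov : AECover P atTop A :=
    { ae_eventually_mem := ae_of_all _ fun ω => by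
        obtain ⟨k, hk⟩ := mem_iUnion.1 (hU ▸ mem_univ ω)
        filter_upwards [eventually_ge_atTop k] with j hj using hmono hj hk
      measurableSet := fun k => hm _ (hA k) }
  constructor
  · refine hcov.integrable_of_integral_bounded_of_nonneg_ae (∫ ω, max (S ω) 0 ∂P)
      (fun k => (hSA' k).sup (integrableOn_zero)) (ae_of_all _ fun ω => le_max_right _ _)
      (Eventually.of_forall fun k => ?_)
    let B : Set Ω := {ω | 0 < S' ω}
    have hB : MeasurableSet[m] B := measurableSet_lt measurable_const hS'
    have h1 : ∫ ω in A k, max (S' ω) 0 ∂P = ∫ ω in B ∩ A k, S' ω ∂P := by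
      rw [inter_comm, ← setIntegral_indicator (hm _ hB)]
      refine integral_congr_ae (ae_of_all _ fun ω => ?_)
      by_cases h : 0 < S' ω
      · have : ω ∈ B := h
        simp [this, h.le]
      · have : ω ∉ B := h
        simp only [this, not_false_eq_true, indicator_of_notMem]
        exact max_eq_right (not_lt.1 h)
    rw [h1, ← heq k B hB]
    refine (setIntegral_mono ((hSA k).mono_set inter_subset_right) hpos.integrableOn
      fun ω => le_max_left _ _).trans ?_
    exact setIntegral_le_integral hpos (ae_of_all _ fun ω => le_max_right _ _)
  · intro hS'i
    have hSint : Integrable S P := by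
      have hneg : Integrable (fun ω => max (S ω) 0 - S ω) P := by
        refine hcov.integrable_of_integral_bounded_of_nonneg_ae
          (∫ ω, max (S ω) 0 ∂P + ∫ ω, |S' ω| ∂P)
          (fun k => hpos.integrableOn.sub (hSA k))
          (ae_of_all _ fun ω => sub_nonneg.2 (le_max_left _ _))
          (Eventually.of_forall fun k => ?_)
        rw [integral_sub hpos.integrableOn (hSA k)]
        have h1 := heq k univ MeasurableSet.univ
        rw [univ_inter] at h1
        rw [h1]
        have h2 : ∫ ω in A k, max (S ω) 0 ∂P ≤ ∫ ω, max (S ω) 0 ∂P :=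
          setIntegral_le_integral hpos (ae_of_all _ fun ω => le_max_right _ _)
        have h3 : -∫ ω in A k, S' ω ∂P ≤ ∫ ω, |S' ω| ∂P := by
          rw [← integral_neg]
          refine (setIntegral_mono hS'i.neg.integrableOn hS'i.abs.integrableOn
            fun ω => neg_le_abs _).trans ?_
          exact setIntegral_le_integral hS'i.abs (ae_of_all _ fun ω => abs_nonneg _)
        linarith
      refine (hpos.sub hneg).congr (ae_of_all _ fun ω => ?_)
      simp
    refine ⟨hSint, ?_⟩
    refine tendsto_nhds_unique (hcov.integral_tendsto_of_countably_generated hSint) ?_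
    have h1 : ∀ k, ∫ ω in A k, S ω ∂P = ∫ ω in A k, S' ω ∂P := by
      intro k
      simpa using heq k univ MeasurableSet.univ
    simp_rw [h1]
    exact hcov.integral_tendsto_of_countably_generated hS'i

/-- An adapted transform of conditionally centered integrable vectors has zero mean as soon as its
positive part is integrable. -/
theorem integral_sum_dot_eq_zero {d : ℕ} : ∀ (n : ℕ) (m : Fin n → MeasurableSpace Ω),
    (∀ i, m i ≤ mΩ) → Monotone m → ∀ x q : Fin n → Ω → Fin d → ℝ,
    (∀ i, Measurable[m i] (x i)) → (∀ i, Integrable (q i) P) → (∀ i, P[q i|m i] =ᵐ[P] 0) →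
    Integrable (fun ω => max (∑ i, x i ω ⬝ᵥ q i ω) 0) P →
    Integrable (fun ω => ∑ i, x i ω ⬝ᵥ q i ω) P ∧ ∫ ω, ∑ i, x i ω ⬝ᵥ q i ω ∂P = 0 := by
  intro n
  induction n with
  | zero => intro m hm hmono x q hx hq hq0 hpos; simp
  | succ n ih =>
    intro m hm hmono x q hx hq hq0 hpos
    let M := m (Fin.last n)
    have hM : M ≤ mΩ := hm _
    have hle : ∀ i, m i ≤ M := fun i => hmono (Fin.le_last i)
    have hxM : ∀ i, Measurable[M] (x i) := fun i => (hx i).mono (hle i) le_rfl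
    let q' : Fin n → Ω → Fin d → ℝ := fun i => P[q i.castSucc|M]
    have hq'm : ∀ i, Measurable[M] (q' i) := fun i => stronglyMeasurable_condExp.measurable
    let S' : Ω → ℝ := fun ω => ∑ i, x (Fin.castSucc i) ω ⬝ᵥ q' i ω
    have hS' : Measurable[M] S' :=
      Finset.measurable_sum _ fun i _ => measurable_dot (hxM _) (hq'm i)
    let A : ℕ → Set Ω := fun k => {ω | ∀ i, ‖x i ω‖ ≤ k}
    have hA : ∀ k, MeasurableSet[M] (A k) := by
      intro k
      have : A k = ⋂ i, {ω | ‖x i ω‖ ≤ k} := by ext; simp [A]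
      rw [this]
      exact MeasurableSet.iInter fun i => measurableSet_le (hxM i).norm measurable_const
    have hAmono : Monotone A := fun k l hkl ω hω i =>
      (hω i).trans (by exact_mod_cast hkl)
    have hU : ⋃ k, A k = univ := by
      refine eq_univ_of_forall fun ω => mem_iUnion.2 ?_
      obtain ⟨k, hk⟩ := exists_nat_ge (∑ i, ‖x i ω‖)
      exact ⟨k, fun i => (Finset.single_le_sum (f := fun i => ‖x i ω‖)
        (fun j _ => norm_nonneg _) (Finset.mem_univ i)).trans hk⟩
    have hloc : ∀ k B, MeasurableSet[M] B → ∀ i,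
        IntegrableOn (fun ω => x i ω ⬝ᵥ q i ω) (B ∩ A k) P ∧
        IntegrableOn (fun ω => x i ω ⬝ᵥ (P[q i|M]) ω) (B ∩ A k) P ∧
        ∫ ω in B ∩ A k, x i ω ⬝ᵥ q i ω ∂P = ∫ ω in B ∩ A k, x i ω ⬝ᵥ (P[q i|M]) ω ∂P :=
      fun k B hB i => integral_dot_condExp hM (hxM i) (hq i) (hB.inter (hA k))
        fun ω hω => hω.2 i
    have hSA : ∀ k B, MeasurableSet[M] B →
        IntegrableOn (fun ω => ∑ i, x i ω ⬝ᵥ q i ω) (B ∩ A k) P :=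
      fun k B hB => integrable_finsetSum _ fun i _ => (hloc k B hB i).1
    have hSA' : ∀ k B, MeasurableSet[M] B → IntegrableOn S' (B ∩ A k) P :=
      fun k B hB => integrable_finsetSum _ fun i _ => (hloc k B hB i.castSucc).2.1
    have heq : ∀ k B, MeasurableSet[M] B →
        ∫ ω in B ∩ A k, ∑ i, x i ω ⬝ᵥ q i ω ∂P = ∫ ω in B ∩ A k, S' ω ∂P := by
      intro k B hB
      rw [integral_finsetSum _ fun i _ => (hloc k B hB i).1,
        integral_finsetSum _ fun i _ => (hloc k B hB (Fin.castSucc i)).2.1, Fin.sum_univ_castSucc]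
      have h1 : ∫ ω in B ∩ A k, x (Fin.last n) ω ⬝ᵥ q (Fin.last n) ω ∂P = 0 := by
        rw [(hloc k B hB (Fin.last n)).2.2]
        refine integral_eq_zero_of_ae (ae_restrict_of_ae ?_)
        filter_upwards [hq0 (Fin.last n)] with ω hω
        simp [M, hω]
      rw [h1, add_zero]
      exact Finset.sum_congr rfl fun i _ => (hloc k B hB i.castSucc).2.2
    obtain ⟨h1, h2⟩ := integrable_of_localized_condExp hM hS' hA hAmono hU
      (fun k => by simpa using hSA k univ MeasurableSet.univ)
      (fun k => by simpa using hSA' k univ MeasurableSet.univ) heq hpos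
    obtain ⟨h3, h4⟩ := ih (fun i => m i.castSucc) (fun i => hm _)
      (fun i j hij => hmono (by simpa using hij)) (fun i => x i.castSucc) q' (fun i => hx _)
      (fun i => integrable_condExp)
      (fun i => (condExp_condExp_of_le (hle _) hM).trans (hq0 _)) h1
    obtain ⟨h5, h6⟩ := h2 h3
    exact ⟨h5, h6.trans h4⟩

theorem lintegral_sum_le_of_chain : ∀ (n : ℕ) (m : Fin n → MeasurableSpace Ω)
    (M : MeasurableSpace Ω), (∀ i, m i ≤ M) → M ≤ mΩ → Monotone m →
    ∀ (g ε : Fin n → Ω → ℝ≥0∞) (R ℓ : Ω → ℝ≥0∞), (∀ i, Measurable[mΩ] (g i)) →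
    (∀ i, Measurable[m i] (ε i)) → Measurable[mΩ] R →
    (∀ i ω, ε i ω ≠ ⊤) →
    (∀ i B, MeasurableSet[m i] B → 2 * ∫⁻ ω in B, ε i ω ∂P ≤ ∫⁻ ω in B, g i ω ∂P) →
    (∀ B, MeasurableSet[M] B →
      ∫⁻ ω in B, (∑ i, g i ω + R ω) ∂P ≤ ∫⁻ ω in B, (ℓ ω + ∑ i, ε i ω) ∂P) →
    ∫⁻ ω, (∑ i, ε i ω + R ω) ∂P ≤ ∫⁻ ω, ℓ ω ∂P := by
  intro n
  induction n with
  | zero =>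
    intro m M hmM hM hmono g ε R ℓ hg hε hR hfin hle H
    simpa using H univ MeasurableSet.univ
  | succ n ih =>
    intro m M hmM hM hmono g ε R ℓ hg hε hR hfin hle H
    have hl : m (Fin.last n) ≤ mΩ := (hmM _).trans hM
    have hεl : Measurable[mΩ] (ε (Fin.last n)) := (hε _).mono hl le_rfl
    have hgs : Measurable[mΩ] fun ω => ∑ i : Fin n, g i.castSucc ω :=
      Finset.measurable_sum _ fun i _ => hg _
    have hgR : Measurable[mΩ] fun ω => ∑ i : Fin n, g i.castSucc ω + R ω := hgs.add hR
    have h := ih (fun i => m i.castSucc) (m (Fin.last n)) (fun i => hmono (Fin.le_last _))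
      hl (fun i j hij => hmono (by simpa using hij)) (fun i => g i.castSucc)
      (fun i => ε i.castSucc) (fun ω => ε (Fin.last n) ω + R ω) ℓ (fun i => hg _) (fun i => hε _)
      (hεl.add hR) (fun i => hfin _) (fun i => hle _) ?_
    · convert h using 3 with ω
      rw [Fin.sum_univ_castSucc, add_assoc]
    · intro B hB
      let A : ℕ → Set Ω := fun k => B ∩ {ω | ε (Fin.last n) ω ≤ k}
      have hA : ∀ k, MeasurableSet[m (Fin.last n)] (A k) := fun k =>
        hB.inter (measurableSet_le (hε _) measurable_const)
      have hAmono : Monotone A := fun k l hkl ω hω =>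
        ⟨hω.1, le_trans (show ε (Fin.last n) ω ≤ k from hω.2) (by exact_mod_cast hkl)⟩
      have hU : ⋃ k, A k = B := by
        ext ω
        simp only [mem_iUnion, A, mem_inter_iff, mem_ofPred_eq]
        constructor
        · rintro ⟨k, hk, -⟩; exact hk
        · intro hω
          obtain ⟨k, hk⟩ := ENNReal.exists_nat_gt (hfin (Fin.last n) ω)
          exact ⟨k, hω, hk.le⟩
      rw [← hU, setLIntegral_iUnion_of_directed _ hAmono.directed_le]
      refine iSup_le fun k => ?_
      rw [hU]
      refine le_trans ?_ (lintegral_mono_set (show A k ⊆ B from inter_subset_left))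
      have h1 := H (A k) (hmM _ _ (hA k))
      have h2 := hle _ _ (hA k)
      have h3 : ∫⁻ ω in A k, ε (Fin.last n) ω ∂P ≠ ⊤ := by
        refine ne_top_of_le_ne_top (b := ∫⁻ ω in A k, (k : ℝ≥0∞) ∂P) ?_ ?_
        · simp [lintegral_const, ENNReal.mul_eq_top]
        · exact setLIntegral_mono' (hl _ (hA k)) fun ω hω => hω.2
      simp_rw [Fin.sum_univ_castSucc] at h1
      have e1 : ∫⁻ ω in A k, (∑ i : Fin n, g i.castSucc ω + g (Fin.last n) ω + R ω) ∂P =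
          ∫⁻ ω in A k, (∑ i : Fin n, g i.castSucc ω + R ω) ∂P +
            ∫⁻ ω in A k, g (Fin.last n) ω ∂P := by
        rw [← lintegral_add_left hgR]
        congr with ω
        ring
      have e2 : ∫⁻ ω in A k, (ℓ ω + (∑ i : Fin n, ε i.castSucc ω + ε (Fin.last n) ω)) ∂P =
          ∫⁻ ω in A k, (ℓ ω + ∑ i : Fin n, ε i.castSucc ω) ∂P +
            ∫⁻ ω in A k, ε (Fin.last n) ω ∂P := by
        rw [← lintegral_add_right _ hεl]
        congr with ω
        ring
      have e3 : ∫⁻ ω in A k, (∑ i : Fin n, g i.castSucc ω + (ε (Fin.last n) ω + R ω)) ∂P =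
          ∫⁻ ω in A k, (∑ i : Fin n, g i.castSucc ω + R ω) ∂P +
            ∫⁻ ω in A k, ε (Fin.last n) ω ∂P := by
        rw [← lintegral_add_left hgR]
        congr with ω
        ring
      rw [e1, e2] at h1
      rw [e3]
      refine (ENNReal.add_le_add_iff_right h3).1 (le_trans ?_ h1)
      rw [add_assoc, ← two_mul]
      gcongr

end CondExp

section NormalIntegrands

variable {Ω : Type*} {m : MeasurableSpace Ω}

theorem IsConvexNormalIntegrand.isRandomConvex_epi {E : Type*} [AddCommGroup E] [Module ℝ E]
    [TopologicalSpace E] {N : E → Ω → EReal} (hN : IsConvexNormalIntegrand m N) :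
    IsRandomConvex m fun ω => epi fun z => N z ω :=
  ⟨hN.isClosed_epi, hN.convex_epi, hN.measurable_epi⟩

theorem measurable_ereal_of_le_real {g : Ω → EReal}
    (h : ∀ r : ℝ, MeasurableSet {ω | g ω ≤ (r : EReal)}) : Measurable g := by
  refine measurable_of_Iic fun a => ?_
  induction a with
  | top => simp
  | coe r => exact h r
  | bot =>
    have : g ⁻¹' Iic ⊥ = ⋂ n : ℕ, {ω | g ω ≤ ((-(n : ℝ) : ℝ) : EReal)} := by
      ext ω
      simp only [mem_preimage, mem_Iic, mem_iInter, mem_ofPred_eq]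
      refine ⟨fun h n => h.trans bot_le, fun h => ?_⟩
      refine le_of_eq (EReal.eq_bot_iff_forall_lt _ |>.2 fun y => ?_)
      obtain ⟨n, hn⟩ := exists_nat_gt (-y)
      exact (h n).trans_lt (EReal.coe_lt_coe_iff.2 (by linarith))
    rw [this]
    exact MeasurableSet.iInter fun n => h _

theorem IsConvexNormalIntegrand.measurable_comp {E : Type*} [NormedAddCommGroup E]
    [NormedSpace ℝ E] [FiniteDimensional ℝ E] [MeasurableSpace E] [BorelSpace E]
    {N : E → Ω → EReal} (hN : IsConvexNormalIntegrand m N) {z : Ω → E} (hz : Measurable z) :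
    Measurable fun ω => N (z ω) ω :=
  measurable_ereal_of_le_real fun r =>
    hN.isRandomConvex_epi.measurableSet_mem (p := fun ω => (z ω, r)) (hz.prodMk measurable_const)

theorem IsConvexNormalIntegrand.slice {E F : Type*} [NormedAddCommGroup E]
    [NormedSpace ℝ E] [FiniteDimensional ℝ E] [MeasurableSpace E] [BorelSpace E]
    [NormedAddCommGroup F] [NormedSpace ℝ F] [FiniteDimensional ℝ F] [MeasurableSpace F]
    [BorelSpace F] {K : E × F → Ω → EReal} (hK : IsConvexNormalIntegrand m K) {x : Ω → E}
    (hx : Measurable x) : IsConvexNormalIntegrand m fun w ω => K (x ω, w) ω where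
  isClosed_epi ω := (hK.isClosed_epi ω).preimage
    (f := fun q : F × ℝ => ((x ω, q.1), q.2)) (by fun_prop)
  convex_epi ω := by
    intro p hp q hq a b ha hb hab
    have h := hK.convex_epi ω (x := ((x ω, p.1), p.2)) hp (y := ((x ω, q.1), q.2)) hq ha hb hab
    have h2 : a • x ω + b • x ω = x ω := by rw [← add_smul, hab, one_smul]
    simpa [epi, h2] using h
  measurable_epi O hO := by
    have : ProperSpace F := FiniteDimensional.proper ℝ F
    have : SecondCountableTopology F := inferInstance
    have key : {ω | ((epi fun w => K (x ω, w) ω) ∩ O).Nonempty} =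
        {ω | (epi fun z => K z ω).Nonempty} ∩ {ω | ({q : F × ℝ | ∀ _i : ℕ,
          infDist ((x ω, q.1), q.2) (epi fun z => K z ω) ≤ 0} ∩ O).Nonempty} := by
      ext ω
      simp only [mem_inter_iff, mem_ofPred_eq]
      constructor
      · rintro ⟨q, hq, hqO⟩
        have hq' : ((x ω, q.1), q.2) ∈ epi fun z => K z ω := hq
        exact ⟨⟨_, hq'⟩, q, fun _ => (infDist_zero_of_mem hq').le, hqO⟩
      · rintro ⟨hne, q, hq, hqO⟩
        exact ⟨q, ((hK.isClosed_epi ω).mem_iff_infDist_zero hne).2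
          (le_antisymm (hq 0) infDist_nonneg), hqO⟩
    rw [key]
    refine hK.isRandomConvex_epi.measurableSet_nonempty.inter
      (measurableSet_inter_open_nonempty (E := F × ℝ)
      (θ := fun _ ω q => infDist ((x ω, q.1), q.2) (epi fun z => K z ω)) (fun _ ω => ?_)
        (fun _ q => ?_) hO)
    · exact (continuous_infDist_pt _).comp (by fun_prop)
    · exact hK.isRandomConvex_epi.measurable_infDist_comp (p := fun ω => ((x ω, q.1), q.2))
        ((hx.prodMk measurable_const).prodMk measurable_const)

/-- The support-type function generated by a sequence of random points `(w_n, α_n)`. -/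
noncomputable def seqConj {d : ℕ} (c : ℕ → Ω → (Fin d → ℝ) × ℝ) (y : Fin d → ℝ) (ω : Ω) : EReal :=
  ⨆ n, (((c n ω).1 ⬝ᵥ y - (c n ω).2 : ℝ) : EReal)

theorem seqConj_le_iff {d : ℕ} {c : ℕ → Ω → (Fin d → ℝ) × ℝ} {y : Fin d → ℝ} {ω : Ω} {r : ℝ} :
    seqConj c y ω ≤ r ↔ ∀ n, (c n ω).1 ⬝ᵥ y - (c n ω).2 ≤ r := by
  simp only [seqConj, iSup_le_iff, EReal.coe_le_coe_iff]

theorem isConvexNormalIntegrand_seqConj {d : ℕ} {c : ℕ → Ω → (Fin d → ℝ) × ℝ}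
    (hc : ∀ n, Measurable (c n)) : IsConvexNormalIntegrand m (seqConj c) := by
  have hset : ∀ ω, (epi fun y => seqConj c y ω) =
      {q | ∀ n, (c n ω).1 ⬝ᵥ q.1 - (c n ω).2 - q.2 ≤ 0} := by
    intro ω
    ext q
    simp [epi, seqConj_le_iff]
  have hcont : ∀ n ω, Continuous fun q : (Fin d → ℝ) × ℝ =>
      (c n ω).1 ⬝ᵥ q.1 - (c n ω).2 - q.2 := by
    intro n ω
    exact ((continuous_dot continuous_const continuous_fst).sub continuous_const).sub continuous_snd
  refine ⟨fun ω => ?_, fun ω => ?_, fun O hO => ?_⟩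
  · rw [hset]
    simp only [ofPred_forall]
    exact isClosed_iInter fun n => isClosed_le (hcont n ω) continuous_const
  · rw [hset]
    intro p hp q hq a b ha hb hab n
    have h1 := hp n
    have h2 := hq n
    simp only [Prod.fst_add, Prod.smul_fst, Prod.snd_add, Prod.smul_snd, dotProduct_add,
      dotProduct_smul, smul_eq_mul]
    have h3 : (c n ω).2 = a * (c n ω).2 + b * (c n ω).2 := by rw [← add_mul, hab, one_mul]
    nlinarith [mul_le_mul_of_nonneg_left h1 ha, mul_le_mul_of_nonneg_left h2 hb]
  · simp_rw [hset]
    refine measurableSet_inter_open_nonempty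
      (θ := fun n ω (q : (Fin d → ℝ) × ℝ) => (c n ω).1 ⬝ᵥ q.1 - (c n ω).2 - q.2) hcont
        (fun n q => ?_) hO
    exact ((measurable_dot (hc n).fst measurable_const).sub (hc n).snd).sub measurable_const

theorem IsConvexNormalIntegrand.isRandomConvex_closure_dom {E : Type*} [NormedAddCommGroup E]
    [NormedSpace ℝ E] {N : E → Ω → EReal} (hN : IsConvexNormalIntegrand m N) :
    IsRandomConvex m fun ω => closure {z | N z ω < ⊤} := by
  have hmem : ∀ z ω, N z ω < ⊤ ↔ ∃ r : ℝ, N z ω ≤ r := by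
    intro z ω
    constructor
    · intro h
      obtain ⟨r, hr, -⟩ := EReal.lt_iff_exists_real_btwn.1 h
      exact ⟨r, hr.le⟩
    · rintro ⟨r, hr⟩
      exact hr.trans_lt (EReal.coe_lt_top r)
  refine ⟨fun ω => isClosed_closure, fun ω => Convex.closure ?_, fun O hO => ?_⟩
  · have : {z | N z ω < ⊤} = LinearMap.fst ℝ E ℝ '' epi fun z => N z ω := by
      ext z
      simp [hmem, epi]
    rw [this]
    exact (hN.convex_epi ω).linear_image _
  · have := hN.measurable_epi (O ×ˢ univ) (hO.prod isOpen_univ)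
    convert this using 3 with ω
    rw [closure_inter_open_nonempty_iff hO]
    constructor
    · rintro ⟨z, hz, hzO⟩
      obtain ⟨r, hr⟩ := (hmem z ω).1 hz
      exact ⟨(z, r), hr, hzO, mem_univ _⟩
    · rintro ⟨⟨z, r⟩, hr, hzO, -⟩
      exact ⟨z, (hmem z ω).2 ⟨r, hr⟩, hzO⟩

theorem IsConvexNormalIntegrand.exists_near_selection {E : Type*} [NormedAddCommGroup E]
    [NormedSpace ℝ E] [FiniteDimensional ℝ E] [MeasurableSpace E] [BorelSpace E]
    {N : E → Ω → EReal} (hN : IsConvexNormalIntegrand m N) {a : Ω → E} (ha : Measurable a) :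
    ∃ b : Ω → E, Measurable b ∧ (∀ ω, N (a ω) ω < ⊤ → b ω = a ω) ∧
      ∀ ω, a ω ∈ closure {z | N z ω < ⊤} → ‖b ω - a ω‖ ≤ 1 ∧ N (b ω) ω < ⊤ := by
  classical
  have : ProperSpace E := FiniteDimensional.proper ℝ E
  obtain ⟨c, hcm, hc⟩ := hN.isRandomConvex_epi.exists_castaing
  let p : ℕ → Ω → Prop := fun n ω => ‖(c n ω).1 - a ω‖ ≤ 1 ∨ ¬ ∃ k, ‖(c k ω).1 - a ω‖ ≤ 1
  have hp : ∀ ω, ∃ n, p n ω := by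
    intro ω
    by_cases h : ∃ k, ‖(c k ω).1 - a ω‖ ≤ 1
    · exact ⟨h.choose, Or.inl h.choose_spec⟩
    · exact ⟨0, Or.inr h⟩
  have hset : ∀ n, MeasurableSet {ω | ‖(c n ω).1 - a ω‖ ≤ 1} := fun n =>
    measurableSet_le ((hcm n).fst.sub ha).norm measurable_const
  have hpm : ∀ n, MeasurableSet {ω | p n ω} := by
    intro n
    have : {ω | ∃ k, ‖(c k ω).1 - a ω‖ ≤ 1} = ⋃ k, {ω | ‖(c k ω).1 - a ω‖ ≤ 1} := by
      ext; simp
    have h2 : MeasurableSet {ω | ∃ k, ‖(c k ω).1 - a ω‖ ≤ 1} := this ▸ MeasurableSet.iUnion hset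
    exact (hset n).union h2.compl
  have hfind := Measurable.find (f := fun n ω => (c n ω).1) (fun n => (hcm n).fst) hpm hp
  have hgood : MeasurableSet {ω | N (a ω) ω < ⊤} :=
    measurableSet_lt (hN.measurable_comp ha) measurable_const
  refine ⟨fun ω => if N (a ω) ω < ⊤ then a ω else (c (Nat.find (hp ω)) ω).1,
    Measurable.ite hgood ha hfind, fun ω h => by simp [h], fun ω h => ?_⟩
  by_cases hω : N (a ω) ω < ⊤
  · simp [hω]
  · simp only [hω, if_false]
    obtain ⟨z, hz, hza⟩ := Metric.mem_closure_iff.1 h (1 / 2) (by norm_num)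
    obtain ⟨r, hr, -⟩ := EReal.lt_iff_exists_real_btwn.1 (show N z ω < ⊤ from hz)
    have hzr : (z, r) ∈ epi fun z => N z ω := hr.le
    obtain ⟨_, ⟨n, rfl⟩, hn⟩ := Metric.mem_closure_iff.1 ((hc ω ⟨_, hzr⟩).2 hzr) (1 / 2)
      (by norm_num)
    have h1 : dist z (c n ω).1 < 1 / 2 := lt_of_le_of_lt (le_max_left _ _) hn
    have h2 : ∃ k, ‖(c k ω).1 - a ω‖ ≤ 1 := by
      refine ⟨n, ?_⟩
      rw [← dist_eq_norm, dist_comm]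
      have := dist_triangle (a ω) z (c n ω).1
      linarith
    have h3 := Nat.find_spec (hp ω)
    refine ⟨h3.resolve_right (not_not.2 h2), ?_⟩
    have h4 : N (c (Nat.find (hp ω)) ω).1 ω ≤ ((c (Nat.find (hp ω)) ω).2 : EReal) :=
      (hc ω ⟨_, hzr⟩).1 (Nat.find (hp ω))
    exact h4.trans_lt (EReal.coe_lt_top _)

/-- Patching: a base point can be modified towards countably many candidates, keeping the
modification bounded, so that the values increase to the supremum of the candidates' values. -/
theorem exists_patching {E : Type*} [NormedAddCommGroup E] [MeasurableSpace E] [BorelSpace E]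
    [SecondCountableTopology E] {b : Ω → E} (hb : Measurable b) {c : ℕ → Ω → E}
    (hc : ∀ n, Measurable (c n)) {val : Ω → E → ℝ}
    (hval : ∀ f : Ω → E, Measurable f → Measurable fun ω => val ω (f ω)) :
    ∃ s : ℕ → Ω → E, (∀ k, Measurable (s k)) ∧ (∀ k, ∃ M : ℝ, ∀ ω, ‖s k ω - b ω‖ ≤ M) ∧
      (∀ k ω, s k ω = b ω ∨ ∃ n, s k ω = c n ω) ∧ s 0 = b ∧
      (∀ ω, Monotone fun k => val ω (s k ω)) ∧
      ∀ ω n, ∃ k, val ω (c n ω) ≤ val ω (s k ω) := by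
  classical
  let s : ℕ → Ω → E := fun k => Nat.rec b (fun j f ω =>
    if ‖c j.unpair.1 ω - b ω‖ ≤ j ∧ val ω (f ω) < val ω (c j.unpair.1 ω)
    then c j.unpair.1 ω else f ω) k
  have hs : ∀ j ω, s (j + 1) ω =
      if ‖c j.unpair.1 ω - b ω‖ ≤ j ∧ val ω (s j ω) < val ω (c j.unpair.1 ω)
      then c j.unpair.1 ω else s j ω := fun j ω => rfl
  have hsm : ∀ k, Measurable (s k) := by
    intro k
    induction k with
    | zero => exact hb
    | succ k ih =>
      have : s (k + 1) = fun ω => if ‖c k.unpair.1 ω - b ω‖ ≤ k ∧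
          val ω (s k ω) < val ω (c k.unpair.1 ω) then c k.unpair.1 ω else s k ω := by
        ext1 ω; exact hs k ω
      rw [this]
      exact Measurable.ite ((measurableSet_le ((hc _).sub hb).norm measurable_const).inter
        (measurableSet_lt (hval _ ih) (hval _ (hc _)))) (hc _) ih
  refine ⟨s, hsm, fun k => ?_, fun k ω => ?_, rfl, fun ω => ?_, fun ω n => ?_⟩
  · induction k with
    | zero => exact ⟨0, fun ω => by simp [s]⟩
    | succ k ih =>
      obtain ⟨M, hM⟩ := ih
      refine ⟨max M k, fun ω => ?_⟩
      rw [hs]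
      split_ifs with h
      · exact h.1.trans (le_max_right _ _)
      · exact (hM ω).trans (le_max_left _ _)
  · induction k with
    | zero => exact Or.inl rfl
    | succ k ih =>
      rw [hs]
      split_ifs with h
      · exact Or.inr ⟨_, rfl⟩
      · exact ih
  · refine monotone_nat_of_le_succ fun k => ?_
    rw [hs]
    split_ifs with h
    · exact h.2.le
    · exact le_rfl
  · obtain ⟨M, hM⟩ := exists_nat_ge ‖c n ω - b ω‖
    refine ⟨Nat.pair n M + 1, ?_⟩
    rw [hs, Nat.unpair_pair]
    have h1 : ‖c n ω - b ω‖ ≤ (Nat.pair n M : ℕ) :=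
      hM.trans (by exact_mod_cast Nat.right_le_pair n M)
    by_cases h2 : val ω (s (Nat.pair n M) ω) < val ω (c n ω)
    · simp [h1, h2]
    · rw [if_neg fun h => h2 h.2]
      exact not_lt.1 h2

end NormalIntegrands

section Jensen

variable {Ω : Type*} {m mΩ : MeasurableSpace Ω} {P : Measure Ω} [IsProbabilityMeasure P]

/-- Conditional Jensen inequality for a convex normal integrand, up to a conditionally affine
term that makes it nonnegative. -/
theorem IsConvexNormalIntegrand.lintegral_condExp_le (hm : m ≤ mΩ) {d : ℕ}
    {N : (Fin d → ℝ) → Ω → EReal} (hN : IsConvexNormalIntegrand m N) {z : Ω → Fin d → ℝ}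
    (hz : Integrable z P) {κ : Ω → ℝ} (hκ : Measurable κ)
    (hle : ∀ᵐ ω ∂P, N (z ω) ω ≤ κ ω) {a : Ω → Fin d → ℝ} (ha : Measurable[m] a) {c : Ω → ℝ}
    (hc : Measurable[m] c) (hnn : ∀ᵐ ω ∂P, 0 ≤ κ ω + (c ω - z ω ⬝ᵥ a ω)) {B : Set Ω}
    (hB : MeasurableSet[m] B) :
    ∫⁻ ω in B, (N ((P[z|m]) ω) ω + ((c ω - (P[z|m]) ω ⬝ᵥ a ω : ℝ) : EReal)).toENNReal ∂P ≤
      ∫⁻ ω in B, ENNReal.ofReal (κ ω + (c ω - z ω ⬝ᵥ a ω)) ∂P := by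
  let A : ℕ → Set Ω := fun k => B ∩ ({ω | ‖a ω‖ ≤ k} ∩ {ω | |c ω| ≤ k})
  have hA : ∀ k, MeasurableSet[m] (A k) := fun k =>
    hB.inter (((measurable_norm.comp ha) measurableSet_Iic).inter
      ((measurable_norm.comp hc) measurableSet_Iic))
  have hAmono : Monotone A := fun k l hkl ω hω =>
    ⟨hω.1, le_trans (show ‖a ω‖ ≤ k from hω.2.1) (by exact_mod_cast hkl),
      le_trans (show |c ω| ≤ k from hω.2.2) (by exact_mod_cast hkl)⟩
  have hU : ⋃ k, A k = B := by
    ext ω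
    simp only [mem_iUnion, A, mem_inter_iff, mem_ofPred_eq]
    refine ⟨fun ⟨k, hk, _⟩ => hk, fun hω => ?_⟩
    obtain ⟨k, hk⟩ := exists_nat_ge (max ‖a ω‖ |c ω|)
    exact ⟨k, hω, (le_max_left _ _).trans hk, (le_max_right _ _).trans hk⟩
  rw [← hU, setLIntegral_iUnion_of_directed _ hAmono.directed_le]
  refine iSup_le fun k => ?_
  rw [hU]
  refine le_trans ?_ (lintegral_mono_set (show A k ⊆ B from inter_subset_left))
  have hAk : MeasurableSet (A k) := hm _ (hA k)
  by_cases htop : ∫⁻ ω in A k, ENNReal.ofReal (κ ω + (c ω - z ω ⬝ᵥ a ω)) ∂P = ⊤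
  · rw [htop]; exact le_top
  let f : Ω → Fin d → ℝ := (A k).indicator a
  have hfm : StronglyMeasurable[m] f := (ha.indicator (hA k)).stronglyMeasurable
  have hfb : ∀ ω, ‖f ω‖ ≤ k := by
    intro ω
    by_cases h : ω ∈ A k
    · simpa [f, h] using h.2.1
    · simp [f, h]
  let c' : Ω → ℝ := (A k).indicator c
  have hc'm : StronglyMeasurable[m] c' := (hc.indicator (hA k)).stronglyMeasurable
  have hc'i : Integrable c' P := by
    refine Integrable.of_bound (hc'm.mono hm).aestronglyMeasurable (k : ℝ) (ae_of_all _ fun ω => ?_)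
    by_cases h : ω ∈ A k
    · simpa [c', h] using h.2.2
    · simp [c', h]
  have hfz : Integrable (fun ω => f ω ⬝ᵥ z ω) P := by
    refine (hz.norm.const_mul (‖dotCLM d‖ * k)).mono ?_ (ae_of_all _ fun ω => ?_)
    · simpa using (dotCLM d).aestronglyMeasurable_comp₂ (hfm.mono hm).aestronglyMeasurable
        hz.aestronglyMeasurable
    · rw [Real.norm_eq_abs]
      refine (abs_dot_le _ _).trans ?_
      rw [Real.norm_of_nonneg (by positivity)]
      gcongr
      exact hfb ω
  let G : Ω → ℝ := (A k).indicator fun ω => κ ω + (c ω - z ω ⬝ᵥ a ω)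
  have hG0 : 0 ≤ᵐ[P] G := by
    filter_upwards [hnn] with ω hω
    by_cases h : ω ∈ A k <;> simp [G, h, hω]
  have hGm : AEStronglyMeasurable G P := by
    refine AEStronglyMeasurable.indicator ?_ hAk
    refine hκ.aestronglyMeasurable.add ((hc.mono hm le_rfl).aestronglyMeasurable.sub ?_)
    simpa using (dotCLM d).aestronglyMeasurable_comp₂ hz.aestronglyMeasurable
      (ha.mono hm le_rfl).aestronglyMeasurable
  have hGl : ∫⁻ ω, ENNReal.ofReal (G ω) ∂P =
      ∫⁻ ω in A k, ENNReal.ofReal (κ ω + (c ω - z ω ⬝ᵥ a ω)) ∂P := by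
    rw [← lintegral_indicator hAk]
    congr with ω
    by_cases h : ω ∈ A k <;> simp [G, h]
  have hGi : Integrable G P := by
    refine ⟨hGm, ?_⟩
    rw [hasFiniteIntegral_iff_ofReal hG0, hGl]
    exact lt_top_iff_ne_top.2 htop
  let κ' : Ω → ℝ := fun ω => G ω - c' ω + f ω ⬝ᵥ z ω
  have hκ' : Integrable κ' P := (hGi.sub hc'i).add hfz
  have hz' : Integrable ((A k).indicator z) P := hz.indicator hAk
  let ζ : Ω → (Fin d → ℝ) × ℝ := fun ω => ((A k).indicator z ω, κ' ω)
  have hζ : Integrable ζ P := hz'.prodMk hκ'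
  have hmem := hN.isRandomConvex_epi.condExp_mem hm hζ (hA k) (by
    filter_upwards [hle] with ω hω h
    have : ζ ω = (z ω, κ ω) := by
      simp only [ζ, κ', G, c', f, h, indicator_of_mem, dotProduct_comm (a ω)]
      congr 1
      ring
    rw [this]
    exact hω)
  have h1 := (ContinuousLinearMap.fst ℝ (Fin d → ℝ) ℝ).comp_condExp_comm (m := m) hζ
  have h2 := (ContinuousLinearMap.snd ℝ (Fin d → ℝ) ℝ).comp_condExp_comm (m := m) hζ
  have h3 : P[(A k).indicator z|m] =ᵐ[P] (A k).indicator (P[z|m]) := condExp_indicator hz (hA k)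
  have h4 : P[G|m] =ᵐ[P] fun ω => (P[κ'|m]) ω + c' ω - f ω ⬝ᵥ (P[z|m]) ω := by
    have e : G = fun ω => (κ' + c') ω - dotCLM d (f ω) (z ω) := by
      ext ω
      simp only [κ', Pi.add_apply, dotCLM_apply]
      ring
    have hfz' : Integrable (fun ω => dotCLM d (f ω) (z ω)) P := by simpa using hfz
    have e1 : P[G|m] =ᵐ[P] P[κ' + c'|m] - P[fun ω => dotCLM d (f ω) (z ω)|m] := by
      rw [e]; exact condExp_sub (hκ'.add hc'i) hfz' m
    have e2 : P[κ' + c'|m] =ᵐ[P] P[κ'|m] + P[c'|m] := condExp_add hκ' hc'i m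
    have e3 := condExp_stronglyMeasurable_bilin_of_bound (dotCLM d) hm hfm hz k (ae_of_all _ hfb)
    have e4 : P[c'|m] = c' := condExp_of_stronglyMeasurable hm hc'm hc'i
    filter_upwards [e1, e2, e3] with ω w1 w2 w3
    rw [w1, Pi.sub_apply, w2, Pi.add_apply, w3, e4, dotCLM_apply]
  have h5 : 0 ≤ᵐ[P] P[G|m] := condExp_nonneg hG0
  calc ∫⁻ ω in A k, (N ((P[z|m]) ω) ω + ((c ω - (P[z|m]) ω ⬝ᵥ a ω : ℝ) : EReal)).toENNReal ∂P
      ≤ ∫⁻ ω in A k, ENNReal.ofReal ((P[G|m]) ω) ∂P := by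
        refine setLIntegral_mono_ae' hAk ?_
        filter_upwards [hmem, h1, h2, h3, h4] with ω w0 w1 w2 w3 w4 h
        have w5 := w0 h
        have w6 : ((P[ζ|m]) ω).1 = (P[z|m]) ω := by
          have : ((P[ζ|m]) ω).1 = (P[(A k).indicator z|m]) ω := w1
          rw [this, w3, indicator_of_mem h]
        have w7 : ((P[ζ|m]) ω).2 = (P[κ'|m]) ω := w2
        have w8 : N ((P[z|m]) ω) ω ≤ ((P[κ'|m]) ω : EReal) := by
          have : N ((P[ζ|m]) ω).1 ω ≤ (((P[ζ|m]) ω).2 : EReal) := w5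
          rwa [w6, w7] at this
        have w9 : (P[G|m]) ω = (P[κ'|m]) ω + (c ω - (P[z|m]) ω ⬝ᵥ a ω) := by
          rw [w4]
          simp only [c', f, h, indicator_of_mem, dotProduct_comm (a ω)]
          ring
        rw [w9, ← EReal.real_coe_toENNReal, EReal.coe_add]
        exact EReal.toENNReal_le_toENNReal (add_le_add_left w8 _)
    _ ≤ ∫⁻ ω, ENNReal.ofReal ((P[G|m]) ω) ∂P := setLIntegral_le_lintegral _ _
    _ = ∫⁻ ω, ENNReal.ofReal (G ω) ∂P := by
        rw [← ofReal_integral_eq_lintegral_ofReal integrable_condExp h5,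
          ← ofReal_integral_eq_lintegral_ofReal hGi hG0, integral_condExp hm]
    _ = _ := hGl

end Jensen

section Biconjugate

variable {E F : Type*} [AddCommGroup E] [Module ℝ E] [AddCommGroup F] [Module ℝ F]

theorem exists_separation (B : E →ₗ[ℝ] F →ₗ[ℝ] ℝ) {g : WeakBilin B → EReal}
    (hconv : Convex ℝ (epi g)) (hlsc : LowerSemicontinuous g) {v₀ : E} {a₀ : ℝ}
    (hv₀ : g v₀ ≤ a₀) {u : E} {r : ℝ} (hr : (r : EReal) < g u) :
    ∃ (y : F) (τ s : ℝ), 0 ≤ τ ∧ B u y + τ * r < s ∧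
      ∀ (v : E) (a : ℝ), g v ≤ a → s < B v y + τ * a := by
  have hcl : IsClosed (epi g) := by
    have h := lowerSemicontinuous_iff_isClosed_epigraph.1 hlsc
    exact h.preimage (f := fun p : WeakBilin B × ℝ => (p.1, (p.2 : EReal)))
      (continuous_fst.prodMk (continuous_coe_real_ereal.comp continuous_snd))
  have hnot : ((u, r) : WeakBilin B × ℝ) ∉ epi g := not_le.2 hr
  obtain ⟨f, s, hs, hf⟩ := geometric_hahn_banach_point_closed hconv hcl hnot
  let f₁ : StrongDual ℝ (WeakBilin B) := f.comp (ContinuousLinearMap.inl ℝ (WeakBilin B) ℝ)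
  obtain ⟨y, hy⟩ := LinearMap.dualEmbedding_surjective B f₁
  let τ : ℝ := f (0, 1)
  have hfeq : ∀ (v : WeakBilin B) (a : ℝ), f (v, a) = B v y + τ * a := by
    intro v a
    have h1 : f₁ v = B v y := by rw [← hy]; rfl
    have h2 : ((v, a) : WeakBilin B × ℝ) = (v, 0) + a • ((0, 1) : WeakBilin B × ℝ) := by simp
    rw [h2, map_add, map_smul, ← h1, smul_eq_mul, mul_comm]
    rfl
  have hall : ∀ (v : E) (a : ℝ), g v ≤ a → s < B v y + τ * a := by
    intro v a h
    exact (hf (v, a) h).trans_eq (hfeq v a)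
  refine ⟨y, τ, s, ?_, ?_, hall⟩
  · by_contra hτ
    push Not at hτ
    have hp : 0 < -τ := by linarith
    let b : ℝ := max a₀ ((B v₀ y - s) / (-τ))
    have h1 := hall v₀ b (hv₀.trans (EReal.coe_le_coe_iff.2 (le_max_left _ _)))
    have h2 : (B v₀ y - s) / (-τ) ≤ b := le_max_right _ _
    rw [div_le_iff₀ hp] at h2
    linarith
  · exact (hfeq u r).symm.trans_lt hs

theorem exists_affine_minorant (B : E →ₗ[ℝ] F →ₗ[ℝ] ℝ) {g : WeakBilin B → EReal}
    (hconv : Convex ℝ (epi g)) (hlsc : LowerSemicontinuous g) (hbot : ∀ v, g v ≠ ⊥)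
    {v₀ : E} (hv₀ : g v₀ ≠ ⊤) {u : E} {r : ℝ} (hr : (r : EReal) < g u) :
    ∃ (y : F) (c : ℝ), (∀ v : E, ((B v y - c : ℝ) : EReal) ≤ g v) ∧ r < B u y - c := by
  have hreal : ∀ v : E, g v ≠ ⊤ → ∃ a : ℝ, g v = a := fun v hv =>
    ⟨(g v).toReal, (EReal.coe_toReal hv (hbot v)).symm⟩
  obtain ⟨a₀, ha₀⟩ := hreal v₀ hv₀
  have hpos : ∀ (y : F) (τ s : ℝ), 0 < τ → (∀ (v : E) (a : ℝ), g v ≤ a → s < B v y + τ * a) →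
      ∀ v : E, ((B v (-(τ⁻¹ • y)) - -(τ⁻¹ * s) : ℝ) : EReal) ≤ g v := by
    intro y τ s hτ h v
    by_cases hv : g v = ⊤
    · rw [hv]; exact le_top
    · obtain ⟨a, ha⟩ := hreal v hv
      rw [ha, EReal.coe_le_coe_iff]
      have h1 := h v a ha.le
      simp only [map_neg, map_smul, smul_eq_mul]
      have h2 : τ⁻¹ * s ≤ τ⁻¹ * (B v y + τ * a) := by gcongr
      rw [mul_add, inv_mul_cancel_left₀ hτ.ne'] at h2
      linarith
  obtain ⟨y, τ, s, hτ, h1, h2⟩ := exists_separation B hconv hlsc ha₀.le hr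
  rcases hτ.eq_or_lt with h0 | h0
  · subst h0
    obtain ⟨y', τ', s', hτ', h1', h2'⟩ := exists_separation B hconv hlsc ha₀.le
      (u := v₀) (r := a₀ - 1) (by rw [ha₀, EReal.coe_lt_coe_iff]; linarith)
    have hτ'pos : 0 < τ' := by
      rcases hτ'.eq_or_lt with h | h
      · subst h
        have := h2' v₀ a₀ ha₀.le
        linarith
      · exact h
    have h3 := hpos y' τ' s' hτ'pos h2'
    set y₁ : F := -(τ'⁻¹ • y')
    set c₁ : ℝ := -(τ'⁻¹ * s')
    have h4 : 0 < s - B u y := by linarith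
    obtain ⟨M, hM⟩ := exists_nat_gt ((r - (B u y₁ - c₁)) / (s - B u y))
    rw [div_lt_iff₀ h4] at hM
    refine ⟨y₁ - (M : ℝ) • y, c₁ - M * s, fun v => ?_, ?_⟩
    · by_cases hv : g v = ⊤
      · rw [hv]; exact le_top
      · obtain ⟨a, ha⟩ := hreal v hv
        have h5 := h2 v a ha.le
        have h6 := h3 v
        rw [ha, EReal.coe_le_coe_iff] at h6 ⊢
        simp only [map_sub, map_smul, smul_eq_mul]
        have h7 : (M : ℝ) * (s - B v y) ≤ 0 :=
          mul_nonpos_of_nonneg_of_nonpos (Nat.cast_nonneg M) (by linarith)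
        linarith
    · simp only [map_sub, map_smul, smul_eq_mul]
      linarith
  · refine ⟨_, _, hpos y τ s h0 h2, ?_⟩
    simp only [map_neg, map_smul, smul_eq_mul]
    have h3 : τ⁻¹ * (B u y + τ * r) < τ⁻¹ * s := by gcongr
    rw [mul_add, inv_mul_cancel_left₀ h0.ne'] at h3
    linarith

end Biconjugate

section Closure

variable {Ω : Type*} {mΩ : MeasurableSpace Ω} {T d : ℕ}

theorem dotB_add_left (a b c : Traj T d) : dotB (a + b) c = dotB a c + dotB b c := by
  simp [dotB, Finset.sum_add_distrib]

theorem dotB_smul_left (r : ℝ) (a b : Traj T d) : dotB (r • a) b = r * dotB a b := by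
  simp [dotB, Finset.mul_sum]

theorem dotB_add_right (a b c : Traj T d) : dotB a (b + c) = dotB a b + dotB a c := by
  simp [dotB, Finset.sum_add_distrib]

theorem dotB_smul_right (r : ℝ) (a b : Traj T d) : dotB a (r • b) = r * dotB a b := by
  simp [dotB, Finset.mul_sum]

/-- The pairing as a bilinear form. -/
noncomputable def pairLin {P : Measure Ω} {𝓤 𝓨 : Submodule ℝ (Ω → Traj T d)}
    (h : SeparatingDuality P 𝓤 𝓨) : 𝓤 →ₗ[ℝ] 𝓨 →ₗ[ℝ] ℝ :=
  LinearMap.mk₂ ℝ (fun u y => pairB P u.1 y.1)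
    (fun u u' y => by
      simp only [pairB, Submodule.coe_add, Pi.add_apply, dotB_add_left]
      exact integral_add (h.integrable _ u.2 _ y.2) (h.integrable _ u'.2 _ y.2))
    (fun r u y => by
      simp only [pairB, Submodule.coe_smul, Pi.smul_apply, dotB_smul_left, smul_eq_mul]
      exact integral_const_mul _ _)
    (fun u y y' => by
      simp only [pairB, Submodule.coe_add, Pi.add_apply, dotB_add_right]
      exact integral_add (h.integrable _ u.2 _ y.2) (h.integrable _ u.2 _ y'.2))
    (fun r u y => by
      simp only [pairB, Submodule.coe_smul, Pi.smul_apply, dotB_smul_right, smul_eq_mul]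
      exact integral_const_mul _ _)

theorem isClosedConvex_affine {P : Measure Ω} {𝓤 𝓨 : Submodule ℝ (Ω → Traj T d)}
    (h : SeparatingDuality P 𝓤 𝓨) (y : 𝓨) (c : ℝ) :
    IsClosedConvex P 𝓤 𝓨 fun u => ((pairB P u.1 y.1 : ℝ) : EReal) - (c : EReal) where
  convex := by
    intro p hp q hq a b ha hb hab
    have h1 : pairB P p.1.1 y.1 - c ≤ p.2 := by
      rw [← EReal.coe_le_coe_iff, EReal.coe_sub]; exact hp
    have h2 : pairB P q.1.1 y.1 - c ≤ q.2 := by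
      rw [← EReal.coe_le_coe_iff, EReal.coe_sub]; exact hq
    have h3 : pairB P (a • p.1 + b • q.1).1 y.1 = a * pairB P p.1.1 y.1 + b * pairB P q.1.1 y.1 := by
      have : pairLin h (a • p.1 + b • q.1) y = a * pairLin h p.1 y + b * pairLin h q.1 y := by
        simp
      exact this
    have h4 : c = a * c + b * c := by rw [← add_mul, hab, one_mul]
    have h5 : pairB P (a • p.1 + b • q.1).1 y.1 - c ≤ a * p.2 + b * q.2 := by
      rw [h3]
      nlinarith [mul_le_mul_of_nonneg_left h1 ha, mul_le_mul_of_nonneg_left h2 hb]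
    have h6 := EReal.coe_le_coe_iff.2 h5
    rw [EReal.coe_sub] at h6
    exact h6
  lsc := by
    let _ := weakTop P 𝓤 𝓨
    have hc : Continuous fun u : 𝓤 => pairB P u.1 y.1 :=
      continuous_iff_le_induced.2 (iInf_le _ y)
    have : Continuous fun u : 𝓤 => (((pairB P u.1 y.1 - c : ℝ)) : EReal) :=
      continuous_coe_real_ereal.comp (hc.sub continuous_const)
    exact this.lowerSemicontinuous
  proper_or_const := by
    refine Or.inl ⟨fun u => ?_, 0, ?_⟩
    · rw [← EReal.coe_sub]; exact EReal.coe_ne_bot _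
    · rw [← EReal.coe_sub]; exact EReal.coe_ne_top _

theorem isClosedConvex_top {P : Measure Ω} {𝓤 𝓨 : Submodule ℝ (Ω → Traj T d)} :
    IsClosedConvex P 𝓤 𝓨 fun _ => ⊤ where
  convex := by
    intro p hp
    exact absurd hp (by simp [epi])
  lsc := by
    let _ := weakTop P 𝓤 𝓨
    exact lowerSemicontinuous_const
  proper_or_const := Or.inr ⟨⊤, fun _ => rfl⟩

theorem conj_anti {P : Measure Ω} {𝓤 : Submodule ℝ (Ω → Traj T d)} {g h : 𝓤 → EReal} (hgh : g ≤ h)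
    (y : Ω → Traj T d) : conj P 𝓤 h y ≤ conj P 𝓤 g y :=
  iSup_mono fun u => EReal.sub_le_sub le_rfl (hgh u)

theorem biconj_mono {P : Measure Ω} {𝓤 𝓨 : Submodule ℝ (Ω → Traj T d)} {g h : 𝓤 → EReal}
    (hgh : g ≤ h) (u : 𝓤) : biconj P 𝓤 𝓨 g u ≤ biconj P 𝓤 𝓨 h u :=
  iSup_mono fun y => EReal.sub_le_sub le_rfl (conj_anti hgh y.1)

theorem le_biconj_of_affine_le {P : Measure Ω} {𝓤 𝓨 : Submodule ℝ (Ω → Traj T d)} {g : 𝓤 → EReal}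
    (y : 𝓨) (c : ℝ) (hle : ∀ v : 𝓤, ((pairB P v.1 y.1 - c : ℝ) : EReal) ≤ g v) (u : 𝓤) :
    ((pairB P u.1 y.1 - c : ℝ) : EReal) ≤ biconj P 𝓤 𝓨 g u := by
  have hconj : conj P 𝓤 g y.1 ≤ c := by
    refine iSup_le fun v => ?_
    refine EReal.sub_le_of_le_add ?_
    have h1 := add_le_add_right (hle v) (c : EReal)
    rw [← EReal.coe_add] at h1
    simpa [add_comm] using h1
  refine le_trans ?_ (le_iSup _ y)
  rw [EReal.coe_sub]
  exact EReal.sub_le_sub le_rfl hconj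

theorem IsClosedConvex.le_biconj {P : Measure Ω} {𝓤 𝓨 : Submodule ℝ (Ω → Traj T d)}
    (h : SeparatingDuality P 𝓤 𝓨) {g : 𝓤 → EReal} (hg : IsClosedConvex P 𝓤 𝓨 g) (u : 𝓤) :
    g u ≤ biconj P 𝓤 𝓨 g u := by
  have hzero : ∀ v : 𝓤, pairB P v.1 (0 : 𝓨).1 = 0 := fun v => map_zero (pairLin h v)
  rcases hg.proper_or_const with ⟨hbot, v₀, hv₀⟩ | ⟨c, hc⟩
  · refine EReal.ge_of_forall_gt_iff_ge.1 fun r hr => ?_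
    have htop : weakTop P 𝓤 𝓨 = WeakBilin.instTopologicalSpace (pairLin h) := by
      have := induced_to_pi (fun (u : 𝓤) (y : 𝓨) => pairB P u.1 y.1)
      exact this.symm
    have hlsc := hg.lsc
    rw [htop] at hlsc
    obtain ⟨y, c, h1, h2⟩ := exists_affine_minorant (pairLin h) hg.convex hlsc hbot hv₀ hr
    refine le_trans ?_ (le_biconj_of_affine_le y c h1 u)
    exact EReal.coe_le_coe_iff.2 h2.le
  · rw [hc u]
    induction c with
    | bot => exact bot_le
    | coe c =>
      refine le_trans ?_ (le_biconj_of_affine_le (g := g) 0 (-c) (fun v => ?_) u)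
      · rw [hzero]; simp
      · rw [hzero, hc v]; simp
    | top =>
      have h1 : conj P 𝓤 g (0 : 𝓨).1 = ⊥ := by
        simp [conj, hc]
      refine le_trans ?_ (le_iSup _ (0 : 𝓨))
      rw [h1]; simp

theorem cl_eq_biconj {P : Measure Ω} {𝓤 𝓨 : Submodule ℝ (Ω → Traj T d)}
    (h : SeparatingDuality P 𝓤 𝓨) (f : 𝓤 → EReal) (u : 𝓤) :
    cl P 𝓤 𝓨 f u = biconj P 𝓤 𝓨 f u := by
  refine le_antisymm (iSup₂_le fun g hg => (hg.1.le_biconj h u).trans (biconj_mono hg.2 u))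
    (iSup_le fun y => ?_)
  have hle : ∀ v : 𝓤, ((pairB P v.1 y.1 : ℝ) : EReal) - f v ≤ conj P 𝓤 f y.1 := fun v =>
    le_iSup (fun v : 𝓤 => ((pairB P v.1 y.1 : ℝ) : EReal) - f v) v
  generalize conj P 𝓤 f y.1 = c at hle
  induction c with
  | bot =>
    have : (fun _ : 𝓤 => (⊤ : EReal)) ≤ f := by
      intro v
      have h1 := hle v
      induction hf : f v with
      | bot => rw [hf] at h1; simp at h1
      | coe a => rw [hf, ← EReal.coe_sub] at h1; exact absurd h1 (not_le.2 (EReal.bot_lt_coe _))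
      | top => exact le_rfl
    exact le_trans le_top (le_iSup₂ (f := fun (g : 𝓤 → EReal)
      (_ : g ∈ {g : 𝓤 → EReal | IsClosedConvex P 𝓤 𝓨 g ∧ g ≤ f}) => g u)
      (fun _ : 𝓤 => (⊤ : EReal)) ⟨isClosedConvex_top, this⟩)
  | top => simp
  | coe c =>
    refine le_iSup₂ (f := fun (g : 𝓤 → EReal)
      (_ : g ∈ {g : 𝓤 → EReal | IsClosedConvex P 𝓤 𝓨 g ∧ g ≤ f}) => g u) _
      ⟨isClosedConvex_affine h y c, fun v => ?_⟩
    have h1 := hle v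
    induction hf : f v with
    | bot => rw [hf] at h1; simp at h1
    | coe a =>
      rw [hf, ← EReal.coe_sub, EReal.coe_le_coe_iff] at h1
      simp only [← EReal.coe_sub, EReal.coe_le_coe_iff]
      linarith
    | top => exact le_top

end Closure

section Expectation

variable {Ω : Type*} {mΩ : MeasurableSpace Ω} {P : Measure Ω}

theorem EE_mono {g h : Ω → EReal} (hgh : g ≤ᵐ[P] h) : EE P g ≤ EE P h := by
  have h1 : ∫⁻ ω, (g ω).toENNReal ∂P ≤ ∫⁻ ω, (h ω).toENNReal ∂P :=
    lintegral_mono_ae (hgh.mono fun ω hω => EReal.toENNReal_le_toENNReal hω)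
  have h2 : ∫⁻ ω, (-(h ω)).toENNReal ∂P ≤ ∫⁻ ω, (-(g ω)).toENNReal ∂P :=
    lintegral_mono_ae (hgh.mono fun ω hω =>
      EReal.toENNReal_le_toENNReal (EReal.neg_le_neg_iff.2 hω))
  unfold EE
  split_ifs with h3 h4 h4
  · exact le_rfl
  · exact absurd (top_le_iff.1 (h3 ▸ h1)) h4
  · exact le_top
  · exact EReal.sub_le_sub (EReal.coe_ennreal_le_coe_ennreal_iff.2 h1)
      (EReal.coe_ennreal_le_coe_ennreal_iff.2 h2)

theorem lintegral_ne_top_of_EE_lt_top {g : Ω → EReal} (h : EE P g < ⊤) :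
    ∫⁻ ω, (g ω).toENNReal ∂P ≠ ⊤ := by
  intro h1
  simp [EE, h1] at h

theorem EE_coe {r : Ω → ℝ} (h : ∫⁻ ω, ENNReal.ofReal (r ω) ∂P ≠ ⊤) :
    EE P (fun ω => (r ω : EReal)) = ((∫⁻ ω, ENNReal.ofReal (r ω) ∂P : ℝ≥0∞) : EReal) -
      ((∫⁻ ω, ENNReal.ofReal (-(r ω)) ∂P : ℝ≥0∞) : EReal) := if_neg h

theorem EE_coe_of_integrable {r : Ω → ℝ} (hr : Integrable r P) :
    EE P (fun ω => (r ω : EReal)) = ((∫ ω, r ω ∂P : ℝ) : EReal) := by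
  have h1 : ∫⁻ ω, ENNReal.ofReal (r ω) ∂P ≠ ⊤ := hr.lintegral_lt_top.ne
  have h2 : ∫⁻ ω, ENNReal.ofReal (-(r ω)) ∂P ≠ ⊤ := hr.neg.lintegral_lt_top.ne
  rw [EE_coe h1, integral_eq_lintegral_pos_part_sub_lintegral_neg_part hr, EReal.coe_sub,
    ← EReal.coe_ennreal_toReal h1, ← EReal.coe_ennreal_toReal h2]

theorem integrable_of_EE_ne_bot {r : Ω → ℝ} (hr : Measurable r)
    (hpos : Integrable (fun ω => max (r ω) 0) P) (hbot : EE P (fun ω => (r ω : EReal)) ≠ ⊥) :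
    Integrable r P := by
  have h1 : ∫⁻ ω, ENNReal.ofReal (r ω) ∂P ≠ ⊤ := by
    have h := hpos.lintegral_lt_top.ne
    convert h using 3 with ω
    simp [ENNReal.ofReal_max]
  have h2 : ∫⁻ ω, ENNReal.ofReal (-(r ω)) ∂P ≠ ⊤ := by
    intro h2
    apply hbot
    rw [EE_coe h1, h2, ← EReal.coe_ennreal_toReal h1, EReal.coe_ennreal_top]
    simp
  have h3 : Integrable (fun ω => max (-(r ω)) 0) P := by
    refine ⟨(hr.neg.max measurable_const).aestronglyMeasurable, ?_⟩
    have h0 : 0 ≤ᵐ[P] fun ω => max (-(r ω)) 0 := ae_of_all _ fun ω => le_max_right _ _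
    rw [hasFiniteIntegral_iff_ofReal h0]
    refine lt_top_iff_ne_top.2 ?_
    convert h2 using 3 with ω
    simp [ENNReal.ofReal_max]
  refine (hpos.sub h3).congr (ae_of_all _ fun ω => ?_)
  rcases le_total (r ω) 0 with h | h
  · simp [h]
  · simp [h]

theorem integrable_max_of_le {f g : Ω → ℝ} (hf : AEStronglyMeasurable f P) (hg : Integrable g P)
    (hfg : ∀ᵐ ω ∂P, f ω ≤ g ω) : Integrable (fun ω => max (f ω) 0) P := by
  refine hg.abs.mono' (hf.sup aestronglyMeasurable_const) ?_
  filter_upwards [hfg] with ω hω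
  rw [Real.norm_of_nonneg (le_max_right _ _)]
  exact max_le (hω.trans (le_abs_self _)) (abs_nonneg _)

theorem integrable_max_add {f g : Ω → ℝ} (hf : Integrable (fun ω => max (f ω) 0) P)
    (hfm : AEStronglyMeasurable f P) (hg : Integrable g P) :
    Integrable (fun ω => max (f ω + g ω) 0) P :=
  integrable_max_of_le (hfm.add hg.aestronglyMeasurable) (hf.add hg)
    (ae_of_all _ fun _ => by simp)

/-- Monotone convergence for finite sums of increasing sequences with bounded integrals. -/
theorem exists_limit_of_monotone {ι : Type*} [Fintype ι] {v : ι → ℕ → Ω → ℝ}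
    (hv : ∀ i k, Measurable (v i k)) (hmono : ∀ i ω, Monotone fun k => v i k ω) {C : ℝ}
    (hInt : ∀ k, Integrable (fun ω => ∑ i, v i k ω) P)
    (hC : ∀ k, ∫ ω, ∑ i, v i k ω ∂P ≤ C) :
    ∃ η : ι → Ω → ℝ, (∀ i, Measurable (η i)) ∧
      (∀ᵐ ω ∂P, ∀ i, IsLUB (range fun k => v i k ω) (η i ω)) ∧
      Integrable (fun ω => ∑ i, η i ω) P ∧ ∫ ω, ∑ i, η i ω ∂P ≤ C := by
  let f : ℕ → Ω → ℝ := fun k ω => ∑ i, v i k ω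
  have hfmono : ∀ ω, Monotone fun k => f k ω := fun ω k l hkl =>
    Finset.sum_le_sum fun i _ => hmono i ω hkl
  have hfm : ∀ k, Measurable (f k) := fun k => Finset.measurable_sum _ fun i _ => hv i k
  have hf0 : ∀ k ω, 0 ≤ f k ω - f 0 ω := fun k ω => sub_nonneg.2 (hfmono ω (Nat.zero_le k))
  have hS : ∫⁻ ω, ⨆ k, ENNReal.ofReal (f k ω - f 0 ω) ∂P ≤
      ENNReal.ofReal (C - ∫ ω, f 0 ω ∂P) := by
    have hm' : ∀ k, Measurable fun ω => ENNReal.ofReal (f k ω - f 0 ω) := fun k =>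
      ((hfm k).sub (hfm 0)).ennreal_ofReal
    rw [lintegral_iSup hm']
    · refine iSup_le fun k => ?_
      have hk : Integrable (fun ω => f k ω - f 0 ω) P := (hInt k).sub (hInt 0)
      rw [← ofReal_integral_eq_lintegral_ofReal hk (ae_of_all _ (hf0 k))]
      refine ENNReal.ofReal_le_ofReal ?_
      rw [integral_sub (hInt k) (hInt 0)]
      have := hC k
      linarith
    · intro k l hkl ω
      exact ENNReal.ofReal_le_ofReal (sub_le_sub_right (hfmono ω hkl) _)
  have hSfin : ∀ᵐ ω ∂P, ⨆ k, ENNReal.ofReal (f k ω - f 0 ω) < ⊤ :=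
    ae_lt_top (Measurable.iSup fun k => ((hfm k).sub (hfm 0)).ennreal_ofReal)
      (ne_top_of_le_ne_top ENNReal.ofReal_ne_top hS)
  have hbdd : ∀ᵐ ω ∂P, ∀ i, BddAbove (range fun k => v i k ω) := by
    filter_upwards [hSfin] with ω hω i
    refine ⟨(⨆ k, ENNReal.ofReal (f k ω - f 0 ω)).toReal + v i 0 ω, ?_⟩
    rintro _ ⟨k, rfl⟩
    have h1 : f k ω - f 0 ω ≤ (⨆ k, ENNReal.ofReal (f k ω - f 0 ω)).toReal := by
      rw [← ENNReal.ofReal_le_iff_le_toReal hω.ne]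
      exact le_iSup (fun k => ENNReal.ofReal (f k ω - f 0 ω)) k
    have h2 : v i k ω - v i 0 ω ≤ f k ω - f 0 ω := by
      simp only [f]
      rw [← Finset.sum_sub_distrib]
      exact Finset.single_le_sum (f := fun i => v i k ω - v i 0 ω)
        (fun j _ => sub_nonneg.2 (hmono j ω (Nat.zero_le k))) (Finset.mem_univ i)
    simp only
    linarith
  let η : ι → Ω → ℝ := fun i ω => ⨆ k, v i k ω
  have hη : ∀ i, Measurable (η i) := fun i => Measurable.iSup fun k => hv i k
  have hlub : ∀ᵐ ω ∂P, ∀ i, IsLUB (range fun k => v i k ω) (η i ω) := by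
    filter_upwards [hbdd] with ω hω i
    exact isLUB_ciSup (hω i)
  have hlim : ∀ᵐ ω ∂P, Tendsto (fun k => f k ω - f 0 ω) atTop (𝓝 (∑ i, η i ω - f 0 ω)) := by
    filter_upwards [hbdd] with ω hω
    exact (tendsto_finsetSum _ fun i _ => tendsto_atTop_ciSup (hmono i ω) (hω i)).sub_const _
  have hg0 : ∀ᵐ ω ∂P, 0 ≤ ∑ i, η i ω - f 0 ω := by
    filter_upwards [hlim] with ω hω
    exact ge_of_tendsto' hω fun k => hf0 k ω
  have hgle : ∫⁻ ω, ENNReal.ofReal (∑ i, η i ω - f 0 ω) ∂P ≤ ENNReal.ofReal (C - ∫ ω, f 0 ω ∂P) := by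
    refine le_trans (lintegral_mono_ae ?_) hS
    filter_upwards [hlim] with ω hω
    exact le_of_tendsto' ((ENNReal.continuous_ofReal.tendsto _).comp hω) fun k =>
      le_iSup (fun k => ENNReal.ofReal (f k ω - f 0 ω)) k
  have hgm : Measurable fun ω => ∑ i, η i ω - f 0 ω :=
    (Finset.measurable_sum _ fun i _ => hη i).sub (hfm 0)
  have hgi : Integrable (fun ω => ∑ i, η i ω - f 0 ω) P := by
    refine ⟨hgm.aestronglyMeasurable, ?_⟩
    rw [hasFiniteIntegral_iff_ofReal hg0]
    exact hgle.trans_lt ENNReal.ofReal_lt_top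
  have hηi : Integrable (fun ω => ∑ i, η i ω) P :=
    (hgi.add (hInt 0)).congr (ae_of_all _ fun ω => by simp [f])
  refine ⟨η, hη, hlub, hηi, ?_⟩
  have h1 : ENNReal.ofReal (∫ ω, (∑ i, η i ω - f 0 ω) ∂P) ≤ ENNReal.ofReal (C - ∫ ω, f 0 ω ∂P) := by
    rw [ofReal_integral_eq_lintegral_ofReal hgi hg0]
    exact hgle
  have h2 : 0 ≤ C - ∫ ω, f 0 ω ∂P := sub_nonneg.2 (hC 0)
  rw [ENNReal.ofReal_le_ofReal_iff h2, integral_sub hηi (hInt 0)] at h1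
  linarith

end Expectation

section Paths

variable {T d : ℕ}

theorem deltaX_zero (x : Traj T d) : deltaX x 0 = x 0 := by simp [deltaX]

theorem deltaX_succ (x : Traj (T + 1) d) (i : Fin (T + 1)) :
    deltaX x i.succ = x i.succ - x i.castSucc := by
  simp only [deltaX, Fin.val_succ, Nat.add_eq_zero_iff, one_ne_zero, and_false, if_false]
  congr 2

theorem deltaNext_last (y : Traj T d) : deltaNext y (Fin.last T) = -y (Fin.last T) := by
  simp [deltaNext]

theorem deltaNext_castSucc (y : Traj (T + 1) d) (i : Fin (T + 1)) :
    deltaNext y i.castSucc = y i.succ - y i.castSucc := by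
  have : (i : ℕ) ≠ T + 1 := i.isLt.ne
  simp only [deltaNext, Fin.val_castSucc, this, dif_neg, not_false_eq_true]
  congr 2

theorem sum_deltaX_dot (x y : Traj T d) :
    ∑ t, deltaX x t ⬝ᵥ y t = -∑ t, x t ⬝ᵥ deltaNext y t := by
  cases T with
  | zero =>
    have h : (0 : Fin 1) = Fin.last 0 := rfl
    simp only [Nat.reduceAdd, Finset.univ_unique, Fin.default_eq_zero, Fin.isValue,
      Finset.sum_singleton]
    rw [deltaX_zero, h, deltaNext_last, dotProduct_neg, neg_neg]
  | succ T =>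
    rw [Fin.sum_univ_succ, Fin.sum_univ_castSucc (f := fun t => x t ⬝ᵥ deltaNext y t)]
    simp only [deltaX_zero, deltaX_succ, deltaNext_last, deltaNext_castSucc, sub_dotProduct,
      dotProduct_sub, dotProduct_neg, Finset.sum_sub_distrib]
    have h1 := Fin.sum_univ_succ (f := fun t => x t ⬝ᵥ y t)
    have h2 := Fin.sum_univ_castSucc (f := fun t => x t ⬝ᵥ y t)
    linarith

theorem norm_deltaX_le (x : Traj T d) (t : Fin (T + 1)) : ‖deltaX x t‖ ≤ 2 * ‖x‖ := by
  unfold deltaX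
  split_ifs with h
  · rw [sub_zero]
    exact (norm_le_pi_norm x t).trans (by linarith [norm_nonneg x])
  · refine (norm_sub_le _ _).trans ?_
    linarith [norm_le_pi_norm x t, norm_le_pi_norm x ⟨(t : ℕ) - 1,
      Nat.lt_of_le_of_lt (Nat.sub_le _ _) t.isLt⟩]

theorem measurable_deltaX {Ω : Type*} {mΩ : MeasurableSpace Ω}
    {ℱ : Filtration (Fin (T + 1)) mΩ} {x : Ω → Traj T d} (hx : x ∈ Adap d ℱ) (t : Fin (T + 1)) :
    Measurable[ℱ t] fun ω => deltaX (x ω) t := by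
  unfold deltaX
  split_ifs with h
  · simpa using hx t
  · exact (hx t).sub ((hx _).mono (ℱ.mono (Fin.mk_le_of_le_val (Nat.sub_le _ _))) le_rfl)

theorem Adap.measurable {Ω : Type*} {mΩ : MeasurableSpace Ω}
    {ℱ : Filtration (Fin (T + 1)) mΩ} {x : Ω → Traj T d} (hx : x ∈ Adap d ℱ) : Measurable x :=
  measurable_pi_iff.2 fun t => (hx t).mono (ℱ.le t) le_rfl

end Paths

section Spaces

variable {Ω : Type*} {mΩ : MeasurableSpace Ω} {P : Measure Ω} {T d : ℕ}

theorem Decomposable.mem_of_bounded {S : Submodule ℝ (Ω → Traj T d)} (hS : Decomposable P S)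
    {z : Ω → Traj T d} (hz : Measurable z) {M : ℝ} (hM : ∀ᵐ ω ∂P, ‖z ω‖ ≤ M) : z ∈ S := by
  simpa using hS ∅ MeasurableSet.empty 0 S.zero_mem z hz ⟨M, hM⟩

theorem Decomposable.mem_of_sub_bounded {S : Submodule ℝ (Ω → Traj T d)} (hS : Decomposable P S)
    {u z : Ω → Traj T d} (hu : u ∈ S) (hum : Measurable u) (hz : Measurable z) {M : ℝ}
    (hM : ∀ᵐ ω ∂P, ‖z ω - u ω‖ ≤ M) : z ∈ S := by
  have := S.add_mem (hS.mem_of_bounded (hz.sub hum) hM) hu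
  simpa using this

theorem integrable_of_pairing {S : Submodule ℝ (Ω → Traj T d)} (hS : Decomposable P S)
    {y : Ω → Traj T d} (hy : Measurable y)
    (hInt : ∀ u ∈ S, Integrable (fun ω => dotB (u ω) (y ω)) P) (t : Fin (T + 1)) :
    Integrable (fun ω => y ω t) P := by
  classical
  have hyt : ∀ j, Measurable fun ω => y ω t j := fun j =>
    (measurable_pi_apply j).comp ((measurable_pi_apply t).comp hy)
  refine Integrable.of_eval fun j => ?_
  let z : Ω → Traj T d := fun ω => Pi.single t (Pi.single j (Real.sign (y ω t j)))
  have hsign : Measurable Real.sign := by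
    unfold Real.sign
    exact Measurable.ite measurableSet_Iio measurable_const
      (Measurable.ite measurableSet_Ioi measurable_const measurable_const)
  have hz : Measurable z := by
    refine measurable_pi_iff.2 fun s => measurable_pi_iff.2 fun i => ?_
    by_cases hs : s = t
    · subst hs
      by_cases hi : i = j
      · subst hi
        simpa [z, Function.comp_def] using hsign.comp (hyt i)
      · simp [z, hi]
    · simp [z, hs]
  have hb : ∀ ω, ‖z ω‖ ≤ 1 := by
    intro ω
    simp only [z, Pi.norm_single]
    rcases Real.sign_apply_eq (y ω t j) with h | h | h <;> simp [h]
  have h := hInt z (hS.mem_of_bounded hz (ae_of_all _ hb))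
  have h2 : ∀ ω, dotB (z ω) (y ω) = |y ω t j| := by
    intro ω
    have : dotB (z ω) (y ω) = Real.sign (y ω t j) * y ω t j := by
      unfold dotB
      rw [Finset.sum_eq_single t]
      · simp [z]
      · intro s _ hs
        simp [z, hs]
      · simp
    rw [this]
    rcases lt_trichotomy (y ω t j) 0 with h | h | h
    · rw [Real.sign_of_neg h, abs_of_neg h]; ring
    · simp [h]
    · rw [Real.sign_of_pos h, abs_of_pos h]; ring
  simp_rw [h2] at h
  exact (integrable_norm_iff (hyt j).aestronglyMeasurable).1 (by simpa using h)

theorem dotB_comm (a b : Traj T d) : dotB a b = dotB b a := by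
  simp [dotB, dotProduct_comm]

end Spaces

section AdaptedBase

variable {Ω : Type*} {mΩ : MeasurableSpace Ω} {P : Measure Ω} [IsProbabilityMeasure P]

/-- A measurable selection of the domain of a normal integrand close to the conditional expectation
of a random point of the domain, equal to it wherever possible. -/
theorem IsConvexNormalIntegrand.exists_condExp_selection {m : MeasurableSpace Ω} (hm : m ≤ mΩ)
    {d : ℕ} {N : (Fin d → ℝ) → Ω → EReal} (hN : IsConvexNormalIntegrand m N)
    (hbot : ∀ z ω, N z ω ≠ ⊥) {z : Ω → Fin d → ℝ} (hz : Integrable z P)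
    (hfin : ∀ᵐ ω ∂P, N (z ω) ω < ⊤) :
    ∃ (b : Ω → Fin d → ℝ) (β : Ω → ℝ), Measurable[m] b ∧ Measurable[m] β ∧
      (∀ ω, N ((P[z|m]) ω) ω < ⊤ → b ω = (P[z|m]) ω) ∧
      (∀ᵐ ω ∂P, ‖b ω - (P[z|m]) ω‖ ≤ 1) ∧ ∀ᵐ ω ∂P, N (b ω) ω = β ω := by
  obtain ⟨b, hbm, hb1, hb2⟩ := hN.exists_near_selection
    (a := P[z|m]) stronglyMeasurable_condExp.measurable
  have hcl := hN.isRandomConvex_closure_dom.condExp_mem hm hz MeasurableSet.univ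
    (hfin.mono fun ω hω _ => subset_closure hω)
  refine ⟨b, fun ω => (N (b ω) ω).toReal, hbm, (hN.measurable_comp hbm).ereal_toReal, hb1, ?_, ?_⟩
  · filter_upwards [hcl] with ω hω
    exact (hb2 ω (hω (mem_univ _))).1
  · filter_upwards [hcl] with ω hω
    exact (EReal.coe_toReal (hb2 ω (hω (mem_univ _))).2.ne (hbot _ _)).symm

theorem two_mul_lintegral_le_of_conjugate {m : MeasurableSpace Ω} (hm : m ≤ mΩ)
    {d : ℕ} {N H : (Fin d → ℝ) → Ω → EReal} (hN : IsConvexNormalIntegrand m N)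
    (hH : IsConvexNormalIntegrand m H)
    (hfen : ∀ᵐ ω ∂P, ∀ (w y : Fin d → ℝ) (α β : ℝ), N w ω ≤ α → H y ω ≤ β → w ⬝ᵥ y ≤ α + β)
    {w y : Ω → Fin d → ℝ} (hw : Integrable w P) (hy : Integrable y P) {k η : Ω → ℝ}
    (hk : Measurable[mΩ] k) (hη : Measurable[mΩ] η) (hNw : ∀ᵐ ω ∂P, N (w ω) ω ≤ k ω)
    (hHy : ∀ᵐ ω ∂P, H (y ω) ω ≤ η ω)
    {w' y' : Ω → Fin d → ℝ} {k' η' : Ω → ℝ} (hw'm : Measurable[m] w') (hy'm : Measurable[m] y')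
    (hk'm : Measurable[m] k') (hη'm : Measurable[m] η')
    (hw'1 : ∀ ω, N ((P[w|m]) ω) ω < ⊤ → w' ω = (P[w|m]) ω)
    (hy'1 : ∀ ω, H ((P[y|m]) ω) ω < ⊤ → y' ω = (P[y|m]) ω)
    (hw' : ∀ᵐ ω ∂P, N (w' ω) ω = k' ω) (hy' : ∀ᵐ ω ∂P, H (y' ω) ω = η' ω) {B : Set Ω}
    (hB : MeasurableSet[m] B) :
    2 * ∫⁻ ω in B, ENNReal.ofReal (k' ω + η' ω - w' ω ⬝ᵥ y' ω) ∂P ≤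
      ∫⁻ ω in B, (ENNReal.ofReal (k ω + (η' ω - w ω ⬝ᵥ y' ω)) +
        ENNReal.ofReal (η ω + (k' ω - y ω ⬝ᵥ w' ω))) ∂P := by
  have h1 := hN.lintegral_condExp_le hm hw hk hNw hy'm hη'm (by
    filter_upwards [hfen, hNw, hy'] with ω f1 f2 f3
    have := f1 _ _ _ _ f2 f3.le
    linarith) hB
  have h2 := hH.lintegral_condExp_le hm hy hη hHy hw'm hk'm (by
    filter_upwards [hfen, hHy, hw'] with ω f1 f2 f3
    have := f1 _ _ _ _ f3.le f2
    rw [dotProduct_comm] at this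
    linarith) hB
  have hwm : Measurable[m] (P[w|m]) := stronglyMeasurable_condExp.measurable
  have hF : Measurable[m] fun ω => (N ((P[w|m]) ω) ω +
      ((η' ω - (P[w|m]) ω ⬝ᵥ y' ω : ℝ) : EReal)).toENNReal :=
    ((hN.measurable_comp hwm).add
      (measurable_coe_real_ereal.comp (hη'm.sub (measurable_dot hwm hy'm)))).ereal_toENNReal
  refine le_trans ?_ (le_trans (add_le_add h1 h2) (le_lintegral_add _ _))
  rw [← lintegral_add_left (hF.mono hm le_rfl), ← lintegral_const_mul' _ _ (by simp)]
  refine lintegral_mono_ae (ae_restrict_of_ae ?_)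
  filter_upwards [hw', hy'] with ω e1 e2
  by_cases hN1 : N ((P[w|m]) ω) ω < ⊤
  · by_cases hH1 : H ((P[y|m]) ω) ω < ⊤
    · rw [← hw'1 ω hN1, ← hy'1 ω hH1, e1, e2, ← EReal.coe_add, ← EReal.coe_add,
        EReal.real_coe_toENNReal, EReal.real_coe_toENNReal, two_mul]
      refine le_of_eq ?_
      congr 2
      · ring
      · rw [dotProduct_comm (y' ω)]; ring
    · rw [not_lt_top_iff.1 hH1, EReal.top_add_coe]
      simp
  · rw [not_lt_top_iff.1 hN1, EReal.top_add_coe]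
    simp

/-- Passing from a feasible point to an adapted feasible point. -/
theorem exists_adapted_feasible {n d : ℕ} {m : Fin n → MeasurableSpace Ω} (hm : ∀ i, m i ≤ mΩ)
    (hmono : Monotone m) {N H : Fin n → (Fin d → ℝ) → Ω → EReal}
    (hN : ∀ i, IsConvexNormalIntegrand (m i) (N i))
    (hH : ∀ i, IsConvexNormalIntegrand (m i) (H i)) (hNbot : ∀ i z ω, N i z ω ≠ ⊥)
    (hHbot : ∀ i z ω, H i z ω ≠ ⊥)
    (hfen : ∀ i, ∀ᵐ ω ∂P, ∀ (w y : Fin d → ℝ) (α β : ℝ),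
      N i w ω ≤ α → H i y ω ≤ β → w ⬝ᵥ y ≤ α + β)
    {w y : Fin n → Ω → Fin d → ℝ} (hw : ∀ i, Integrable (w i) P) (hy : ∀ i, Integrable (y i) P)
    (hwm : ∀ i, Measurable[mΩ] (w i)) (hym : ∀ i, Measurable[mΩ] (y i))
    {k η : Fin n → Ω → ℝ} (hk : ∀ i, Measurable[mΩ] (k i)) (hη : ∀ i, Measurable[mΩ] (η i))
    (hNw : ∀ i, ∀ᵐ ω ∂P, N i (w i ω) ω ≤ k i ω) (hHy : ∀ i, ∀ᵐ ω ∂P, H i (y i ω) ω ≤ η i ω)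
    (hℓ : Integrable (fun ω => ∑ i, (k i ω + η i ω - w i ω ⬝ᵥ y i ω)) P)
    (hkpos : Integrable (fun ω => max (∑ i, k i ω) 0) P)
    (hpq : ∀ w' y' : Fin n → Ω → Fin d → ℝ, (∀ i, Measurable[m i] (w' i)) →
      (∀ i, Measurable[m i] (y' i)) → (∀ i, ∀ᵐ ω ∂P, ‖w' i ω - (P[w i|m i]) ω‖ ≤ 1) →
      (∀ i, ∀ᵐ ω ∂P, ‖y' i ω - (P[y i|m i]) ω‖ ≤ 1) →
      Integrable (fun ω => ∑ i, (w i ω - w' i ω) ⬝ᵥ (y i ω - y' i ω)) P ∧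
      Integrable (fun ω => ∑ i, (w i ω - w' i ω) ⬝ᵥ y' i ω) P) :
    ∃ (w' : Fin n → Ω → Fin d → ℝ) (k' : Fin n → Ω → ℝ), (∀ i, Measurable[m i] (w' i)) ∧
      (∀ i, Measurable[m i] (k' i)) ∧ (∀ i, ∀ᵐ ω ∂P, ‖w' i ω - (P[w i|m i]) ω‖ ≤ 1) ∧
      (∀ i, ∀ᵐ ω ∂P, N i (w' i ω) ω = k' i ω) ∧
      Integrable (fun ω => max (∑ i, k' i ω) 0) P := by
  choose w' k' hw'm hk'm hw'1 hw'2 hw' using fun i => (hN i).exists_condExp_selection (hm i)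
    (hNbot i) (hw i) ((hNw i).mono fun ω hω => hω.trans_lt (EReal.coe_lt_top _))
  choose y' η' hy'm hη'm hy'1 hy'2 hy' using fun i => (hH i).exists_condExp_selection (hm i)
    (hHbot i) (hy i) ((hHy i).mono fun ω hω => hω.trans_lt (EReal.coe_lt_top _))
  obtain ⟨hpq1, hpq2⟩ := hpq w' y' hw'm hy'm hw'2 hy'2
  refine ⟨w', k', hw'm, hk'm, hw'2, hw', ?_⟩
  have hw'M : ∀ i, Measurable[mΩ] (w' i) := fun i => (hw'm i).mono (hm i) le_rfl
  have hy'M : ∀ i, Measurable[mΩ] (y' i) := fun i => (hy'm i).mono (hm i) le_rfl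
  have hk'M : ∀ i, Measurable[mΩ] (k' i) := fun i => (hk'm i).mono (hm i) le_rfl
  have hη'M : ∀ i, Measurable[mΩ] (η' i) := fun i => (hη'm i).mono (hm i) le_rfl
  let r : Fin n → Ω → ℝ := fun i ω => k' i ω + η' i ω - w' i ω ⬝ᵥ y' i ω
  let g₁ : Fin n → Ω → ℝ := fun i ω => k i ω + (η' i ω - w i ω ⬝ᵥ y' i ω)
  let g₂ : Fin n → Ω → ℝ := fun i ω => η i ω + (k' i ω - y i ω ⬝ᵥ w' i ω)
  let ℓ : Ω → ℝ := fun ω => ∑ i, (k i ω + η i ω - w i ω ⬝ᵥ y i ω) +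
    ∑ i, (w i ω - w' i ω) ⬝ᵥ (y i ω - y' i ω)
  have hℓi : Integrable ℓ P := hℓ.add hpq1
  have hr0 : ∀ᵐ ω ∂P, ∀ i, 0 ≤ r i ω := ae_all_iff.2 fun i => by
    filter_upwards [hfen i, hw' i, hy' i] with ω f1 f2 f3
    have := f1 _ _ _ _ f2.le f3.le
    simp only [r]; linarith
  have hg₁0 : ∀ᵐ ω ∂P, ∀ i, 0 ≤ g₁ i ω := ae_all_iff.2 fun i => by
    filter_upwards [hfen i, hNw i, hy' i] with ω f1 f2 f3
    have := f1 _ _ _ _ f2 f3.le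
    simp only [g₁]; linarith
  have hg₂0 : ∀ᵐ ω ∂P, ∀ i, 0 ≤ g₂ i ω := ae_all_iff.2 fun i => by
    filter_upwards [hfen i, hw' i, hHy i] with ω f1 f2 f3
    have := f1 _ _ _ _ f2.le f3
    rw [dotProduct_comm] at this
    simp only [g₂]; linarith
  have hrm : ∀ i, Measurable[m i] (r i) := fun i =>
    ((hk'm i).add (hη'm i)).sub (measurable_dot (hw'm i) (hy'm i))
  have hg₁m : ∀ i, Measurable[mΩ] (g₁ i) := fun i =>
    (hk i).add ((hη'M i).sub (measurable_dot (hwm i) (hy'M i)))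
  have hg₂m : ∀ i, Measurable[mΩ] (g₂ i) := fun i =>
    (hη i).add ((hk'M i).sub (measurable_dot (hym i) (hw'M i)))
  have hsum : ∀ ω, ∑ i, (g₁ i ω + g₂ i ω) = ℓ ω + ∑ i, r i ω := by
    intro ω
    simp only [ℓ, g₁, g₂, r]
    rw [← Finset.sum_add_distrib, ← Finset.sum_add_distrib]
    refine Finset.sum_congr rfl fun i _ => ?_
    simp only [sub_dotProduct, dotProduct_sub, dotProduct_comm (y i ω)]
    ring
  have hchain := lintegral_sum_le_of_chain (P := P) n m mΩ hm le_rfl hmono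
    (fun i ω => ENNReal.ofReal (g₁ i ω) + ENNReal.ofReal (g₂ i ω))
    (fun i ω => ENNReal.ofReal (r i ω)) 0 (fun ω => ENNReal.ofReal (ℓ ω))
    (fun i => (hg₁m i).ennreal_ofReal.add (hg₂m i).ennreal_ofReal)
    (fun i => (hrm i).ennreal_ofReal) measurable_const (fun i ω => ENNReal.ofReal_ne_top)
    (fun i B hB => two_mul_lintegral_le_of_conjugate (hm i) (hN i) (hH i) (hfen i) (hw i) (hy i)
      (hk i) (hη i) (hNw i) (hHy i) (hw'm i) (hy'm i) (hk'm i) (hη'm i) (hw'1 i) (hy'1 i)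
      (hw' i) (hy' i) hB)
    (fun B _ => by
      refine lintegral_mono_ae (ae_restrict_of_ae ?_)
      filter_upwards [hr0, hg₁0, hg₂0] with ω e0 e1 e2
      have h1 : ∑ i, (ENNReal.ofReal (g₁ i ω) + ENNReal.ofReal (g₂ i ω)) =
          ENNReal.ofReal (∑ i, (g₁ i ω + g₂ i ω)) := by
        rw [ENNReal.ofReal_sum_of_nonneg fun i _ => add_nonneg (e1 i) (e2 i)]
        exact Finset.sum_congr rfl fun i _ => (ENNReal.ofReal_add (e1 i) (e2 i)).symm
      rw [h1, hsum, ← ENNReal.ofReal_sum_of_nonneg fun i _ => e0 i, Pi.zero_apply, add_zero]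
      exact ENNReal.ofReal_add_le)
  have hri : Integrable (fun ω => ∑ i, r i ω) P := by
    have hm' : Measurable[mΩ] fun ω => ∑ i, r i ω :=
      Finset.measurable_sum _ fun i _ => (hrm i).mono (hm i) le_rfl
    have h0 : 0 ≤ᵐ[P] fun ω => ∑ i, r i ω := by
      filter_upwards [hr0] with ω h
      exact Finset.sum_nonneg fun i _ => h i
    refine ⟨hm'.aestronglyMeasurable, ?_⟩
    rw [hasFiniteIntegral_iff_ofReal h0]
    refine lt_of_le_of_lt (le_trans (lintegral_mono_ae ?_) hchain) hℓi.lintegral_lt_top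
    filter_upwards [hr0] with ω h
    rw [ENNReal.ofReal_sum_of_nonneg fun i _ => h i, Pi.zero_apply, add_zero]
  refine integrable_max_of_le
    (Finset.measurable_sum _ fun i _ => hk'M i).aestronglyMeasurable
    ((hkpos.add hri).sub hpq2) ?_
  filter_upwards [hg₁0] with ω h1
  have h2 : ∑ i, k' i ω ≤ ∑ i, k i ω + ∑ i, r i ω - ∑ i, (w i ω - w' i ω) ⬝ᵥ y' i ω := by
    rw [← Finset.sum_add_distrib, ← Finset.sum_sub_distrib]
    refine Finset.sum_le_sum fun i _ => ?_
    have := h1 i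
    simp only [g₁] at this
    simp only [r, sub_dotProduct]
    linarith
  refine h2.trans ?_
  simp only [Pi.sub_apply, Pi.add_apply]
  gcongr
  exact le_max_left _ _

end AdaptedBase

section EReal

theorem coe_finset_sum {ι : Type*} (s : Finset ι) (f : ι → ℝ) :
    ((∑ i ∈ s, f i : ℝ) : EReal) = ∑ i ∈ s, (f i : EReal) := by
  classical
  induction s using Finset.induction_on with
  | empty => simp
  | insert a s ha ih => rw [Finset.sum_insert ha, Finset.sum_insert ha, EReal.coe_add, ih]

theorem sum_ne_bot {ι : Type*} (s : Finset ι) {f : ι → EReal} (h : ∀ i ∈ s, f i ≠ ⊥) :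
    ∑ i ∈ s, f i ≠ ⊥ := by
  classical
  induction s using Finset.induction_on with
  | empty => simp
  | insert a s ha ih =>
    rw [Finset.sum_insert ha]
    refine (EReal.bot_lt_add_iff.2 ⟨bot_lt_iff_ne_bot.2 (h a (Finset.mem_insert_self _ _)),
      bot_lt_iff_ne_bot.2 (ih fun i hi => h i (Finset.mem_insert_of_mem hi))⟩).ne'

theorem ne_top_of_sum_ne_top {ι : Type*} [Fintype ι] {f : ι → EReal} (h : ∀ i, f i ≠ ⊥)
    (hs : ∑ i, f i ≠ ⊤) (i : ι) : f i ≠ ⊤ := by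
  classical
  intro hi
  apply hs
  rw [← Finset.add_sum_erase _ _ (Finset.mem_univ i), hi]
  exact EReal.top_add_of_ne_bot (sum_ne_bot _ fun j _ => h j)

theorem ne_bot_of_sum_ne_bot {ι : Type*} [Fintype ι] {f : ι → EReal}
    (hs : ∑ i, f i ≠ ⊥) (i : ι) : f i ≠ ⊥ := by
  classical
  intro hi
  apply hs
  rw [← Finset.add_sum_erase _ _ (Finset.mem_univ i), hi, EReal.bot_add]

end EReal

section Problem

variable {Ω : Type*} {mΩ : MeasurableSpace Ω} {P : Measure Ω} {T d : ℕ}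
  {ℱ : Filtration (Fin (T + 1)) mΩ} {K : Fin (T + 1) → (Fin d → ℝ) × (Fin d → ℝ) → Ω → EReal}
  {𝓤 𝓨 : Submodule ℝ (Ω → Traj T d)}

theorem exists_bounded_feasible
    (hne : ∃ x ∈ AdapInf d P ℱ, ∀ t, ∀ᵐ ω ∂P, x ω t ∈ closure (dom1K K t ω))
    (hdom : ∀ x ∈ AdapInf d P ℱ, (∀ t, ∀ᵐ ω ∂P, x ω t ∈ closure (dom1K K t ω)) →
      ∃ xbar ∈ AdapInf d P ℱ,
        (∀ t, ∀ᵐ ω ∂P, xbar ω t ∈ intrinsicInterior ℝ (dom1K K t ω)) ∧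
        ∀ lam : ℝ, 0 < lam → lam < 1 → (1 - lam) • x + lam • xbar ∈ dom1Ef P ℱ K 𝓤) :
    ∃ x₀ ∈ AdapInf d P ℱ, ∃ u₀ ∈ 𝓤, Ef P K x₀ u₀ < ⊤ := by
  obtain ⟨x, hx, hxcl⟩ := hne
  obtain ⟨xb, hxb, -, h⟩ := hdom x hx hxcl
  obtain ⟨h1, u₀, hu₀, h2⟩ := h (1 / 2) (by norm_num) (by norm_num)
  refine ⟨_, ⟨h1, ?_⟩, u₀, hu₀, h2⟩
  obtain ⟨M, hM⟩ := hx.2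
  obtain ⟨M', hM'⟩ := hxb.2
  refine ⟨M + M', ?_⟩
  filter_upwards [hM, hM'] with ω e1 e2
  have h3 : ‖((1 - (1 / 2 : ℝ)) • x + (1 / 2 : ℝ) • xb) ω‖ ≤ 1 / 2 * ‖x ω‖ + 1 / 2 * ‖xb ω‖ := by
    refine (norm_add_le _ _).trans (le_of_eq ?_)
    simp only [Pi.smul_apply, norm_smul]
    norm_num
  linarith [norm_nonneg (x ω), norm_nonneg (xb ω)]

/-- Finite real-valued costs of a feasible point. -/
theorem exists_real_cost (hK_bot : ∀ t z ω, K t z ω ≠ ⊥)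
    (hK : ∀ t, IsConvexNormalIntegrand (ℱ t) (K t)) {x u : Ω → Traj T d} (hx : Measurable x)
    (hu : Measurable u) (h : Ef P K x u < ⊤) :
    ∃ k : Fin (T + 1) → Ω → ℝ, (∀ t, Measurable (k t)) ∧
      (∀ᵐ ω ∂P, ∀ t, K t (x ω t, deltaX (x ω) t + u ω t) ω = k t ω) ∧
      (∀ᵐ ω ∂P, fB K (x ω) (u ω) ω = ((∑ t, k t ω : ℝ) : EReal)) ∧
      Integrable (fun ω => max (∑ t, k t ω) 0) P := by
  have hdx : ∀ t, Measurable fun ω => deltaX (x ω) t := by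
    intro t
    unfold deltaX
    refine ((measurable_pi_apply t).comp hx).sub ?_
    split_ifs
    · exact measurable_const
    · exact (measurable_pi_apply _).comp hx
  have hKm : ∀ t, Measurable fun ω => K t (x ω t, deltaX (x ω) t + u ω t) ω := by
    intro t
    have hKt : IsConvexNormalIntegrand mΩ (K t) :=
      ⟨(hK t).isClosed_epi, (hK t).convex_epi, fun O hO => ℱ.le t _ ((hK t).measurable_epi O hO)⟩
    exact hKt.measurable_comp (((measurable_pi_apply t).comp hx).prodMk
      ((hdx t).add ((measurable_pi_apply t).comp hu)))
  have hfm : Measurable fun ω => fB K (x ω) (u ω) ω := by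
    unfold fB
    exact Finset.measurable_sum _ fun t _ => hKm t
  have hfin := lintegral_ne_top_of_EE_lt_top h
  have hae : ∀ᵐ ω ∂P, fB K (x ω) (u ω) ω ≠ ⊤ := by
    filter_upwards [ae_lt_top hfm.ereal_toENNReal hfin] with ω hω
    exact EReal.toENNReal_ne_top_iff.1 hω.ne
  have hk : ∀ᵐ ω ∂P, ∀ t, K t (x ω t, deltaX (x ω) t + u ω t) ω =
      (((K t (x ω t, deltaX (x ω) t + u ω t) ω).toReal : ℝ) : EReal) := by
    filter_upwards [hae] with ω hω t
    exact (EReal.coe_toReal (ne_top_of_sum_ne_top (fun t => hK_bot t _ _) hω t)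
      (hK_bot t _ _)).symm
  have hsum : ∀ᵐ ω ∂P, fB K (x ω) (u ω) ω =
      ((∑ t, (K t (x ω t, deltaX (x ω) t + u ω t) ω).toReal : ℝ) : EReal) := by
    filter_upwards [hk] with ω hω
    rw [coe_finset_sum]
    exact Finset.sum_congr rfl fun t _ => hω t
  have hmk : ∀ t, Measurable fun ω => (K t (x ω t, deltaX (x ω) t + u ω t) ω).toReal :=
    fun t => (hKm t).ereal_toReal
  refine ⟨fun t ω => (K t (x ω t, deltaX (x ω) t + u ω t) ω).toReal, hmk, hk, hsum, ?_⟩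
  refine ⟨((Finset.measurable_sum _ fun t _ => hmk t).max measurable_const).aestronglyMeasurable, ?_⟩
  have h0 : 0 ≤ᵐ[P] fun ω =>
      max (∑ t, (K t (x ω t, deltaX (x ω) t + u ω t) ω).toReal) 0 :=
    ae_of_all _ fun ω => le_max_right _ _
  rw [hasFiniteIntegral_iff_ofReal h0]
  refine lt_of_le_of_lt (lintegral_mono_ae ?_) (lt_top_iff_ne_top.2 hfin)
  filter_upwards [hsum] with ω hω
  simp only [hω, EReal.real_coe_toENNReal, ENNReal.ofReal_max, ENNReal.ofReal_zero, zero_le,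
    max_eq_left, le_refl]

theorem integral_le_of_conj_le {y : Ω → Traj T d} {C : ℝ}
    (hC : conj P 𝓤 (fun u' => phi P ℱ K u'.1) y ≤ C) {x u : Ω → Traj T d} (hx : x ∈ Adap d ℱ)
    (hu : u ∈ 𝓤) {κ : Ω → ℝ} (hκ : Measurable κ)
    (hle : ∀ᵐ ω ∂P, fB K (x ω) (u ω) ω ≤ κ ω) (hpos : Integrable (fun ω => max (κ ω) 0) P) :
    Integrable κ P ∧ pairB P u y - ∫ ω, κ ω ∂P ≤ C := by
  have h1 : phi P ℱ K u ≤ EE P fun ω => (κ ω : EReal) :=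
    (iInf₂_le x hx).trans (EE_mono hle)
  have h2 : ((pairB P u y : ℝ) : EReal) - EE P (fun ω => (κ ω : EReal)) ≤ C := by
    refine le_trans ?_ hC
    refine le_trans (EReal.sub_le_sub le_rfl h1) ?_
    exact le_iSup (fun u' : 𝓤 => ((pairB P u'.1 y : ℝ) : EReal) - phi P ℱ K u'.1) ⟨u, hu⟩
  have h3 : EE P (fun ω => (κ ω : EReal)) ≠ ⊥ := by
    intro h3
    rw [h3, EReal.coe_sub_bot] at h2
    exact absurd h2 (not_le.2 (EReal.coe_lt_top C))
  have h4 := integrable_of_EE_ne_bot hκ hpos h3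
  rw [EE_coe_of_integrable h4, ← EReal.coe_sub, EReal.coe_le_coe_iff] at h2
  exact ⟨h4, h2⟩

theorem aProj_mem_adap (u : Ω → Traj T d) : aProj P ℱ u ∈ Adap d ℱ := fun _ =>
  stronglyMeasurable_condExp.measurable

/-- Adapted elements do not distinguish a dual variable from its adapted projection. -/
theorem pairB_aProj [IsProbabilityMeasure P] (hdual : SeparatingDuality P 𝓤 𝓨)
    (hproj𝓨 : ∀ y ∈ 𝓨, aProj P ℱ y ∈ 𝓨) (hInt : ∀ y ∈ 𝓨, ∀ t, Integrable (fun ω => y ω t) P)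
    {u y : Ω → Traj T d} (hu : u ∈ 𝓤) (hua : u ∈ Adap d ℱ) (hy : y ∈ 𝓨) :
    pairB P u (aProj P ℱ y) = pairB P u y := by
  have h1 := hdual.integrable u hu y hy
  have h2 := hdual.integrable u hu _ (hproj𝓨 y hy)
  let q : Fin (T + 1) → Ω → Fin d → ℝ := fun t ω => y ω t - aProj P ℱ y ω t
  have hq : ∀ t, Integrable (q t) P := fun t => (hInt y hy t).sub integrable_condExp
  have hq0 : ∀ t, P[q t|ℱ t] =ᵐ[P] 0 := by
    intro t
    have e1 : P[q t|ℱ t] =ᵐ[P] P[fun ω => y ω t|ℱ t] - P[P[fun ω => y ω t|ℱ t]|ℱ t] :=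
      condExp_sub (hInt y hy t) integrable_condExp _
    have e2 : P[P[fun ω => y ω t|ℱ t]|ℱ t] = P[fun ω => y ω t|ℱ t] :=
      condExp_of_stronglyMeasurable (ℱ.le t) stronglyMeasurable_condExp integrable_condExp
    rw [e2, sub_self] at e1
    exact e1
  have hS : ∀ ω, ∑ t, u ω t ⬝ᵥ q t ω = dotB (u ω) (y ω) - dotB (u ω) (aProj P ℱ y ω) := by
    intro ω
    simp [dotB, q, dotProduct_sub, Finset.sum_sub_distrib]
  have hSi : Integrable (fun ω => ∑ t, u ω t ⬝ᵥ q t ω) P := by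
    simp_rw [hS]; exact h1.sub h2
  have h3 := (integral_sum_dot_eq_zero (P := P) (T + 1) (fun t => ℱ t) (fun t => ℱ.le t)
    (fun _ _ h => ℱ.mono h)
    (fun t ω => u ω t) q hua hq hq0 (hSi.sup (integrable_zero _ _ _))).2
  simp_rw [hS] at h3
  rw [integral_sub h1 h2] at h3
  unfold pairB
  linarith

theorem integrable_deltaNext {y : Ω → Traj T d} (hy : ∀ t, Integrable (fun ω => y ω t) P)
    (t : Fin (T + 1)) : Integrable (fun ω => deltaNext (y ω) t) P := by
  unfold deltaNext
  split_ifs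
  · exact (integrable_zero _ _ _).sub (hy t)
  · exact (hy _).sub (hy t)

theorem measurable_condDelta (y : Ω → Traj T d) (t : Fin (T + 1)) :
    Measurable[ℱ t] (condDelta P ℱ y t) := stronglyMeasurable_condExp.measurable

/-- The integration by parts residual of an adapted strategy has zero mean. -/
theorem integral_residual_eq_zero [IsProbabilityMeasure P] {x y : Ω → Traj T d} (hx : x ∈ Adap d ℱ)
    (hy : ∀ t, Integrable (fun ω => y ω t) P)
    (hpos : Integrable (fun ω =>
      max (∑ t, x ω t ⬝ᵥ (condDelta P ℱ y t ω - deltaNext (y ω) t)) 0) P) :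
    Integrable (fun ω => ∑ t, x ω t ⬝ᵥ (condDelta P ℱ y t ω - deltaNext (y ω) t)) P ∧
      ∫ ω, ∑ t, x ω t ⬝ᵥ (condDelta P ℱ y t ω - deltaNext (y ω) t) ∂P = 0 := by
  refine integral_sum_dot_eq_zero (P := P) (T + 1) (fun t => ℱ t) (fun t => ℱ.le t)
    (fun _ _ h => ℱ.mono h)
    (fun t ω => x ω t) (fun t ω => condDelta P ℱ y t ω - deltaNext (y ω) t) hx
    (fun t => integrable_condExp.sub (integrable_deltaNext hy t)) (fun t => ?_) hpos
  have e1 : P[fun ω => condDelta P ℱ y t ω - deltaNext (y ω) t|ℱ t] =ᵐ[P]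
      P[condDelta P ℱ y t|ℱ t] - P[fun ω => deltaNext (y ω) t|ℱ t] :=
    condExp_sub integrable_condExp (integrable_deltaNext hy t) _
  have e2 : P[condDelta P ℱ y t|ℱ t] = condDelta P ℱ y t :=
    condExp_of_stronglyMeasurable (ℱ.le t) stronglyMeasurable_condExp integrable_condExp
  rw [e2] at e1
  refine e1.trans (ae_of_all _ fun ω => ?_)
  simp [condDelta]

theorem integrable_dot_of_bounded {a b : Ω → Fin d → ℝ} (ha : Measurable a) {M : ℝ}
    (hM : ∀ᵐ ω ∂P, ‖a ω‖ ≤ M) (hb : Integrable b P) : Integrable (fun ω => a ω ⬝ᵥ b ω) P := by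
  refine (hb.norm.const_mul (‖dotCLM d‖ * M)).mono' ?_ ?_
  · simpa using (dotCLM d).aestronglyMeasurable_comp₂ ha.aestronglyMeasurable
      hb.aestronglyMeasurable
  · filter_upwards [hM] with ω hω
    rw [Real.norm_eq_abs]
    refine (abs_dot_le _ _).trans ?_
    gcongr

theorem dotB_sub_deltaX (x w y : Traj T d) (v : Fin (T + 1) → Fin d → ℝ) :
    dotB (fun t => w t - deltaX x t) y =
      ∑ t, (x t ⬝ᵥ v t + w t ⬝ᵥ y t) - ∑ t, x t ⬝ᵥ (v t - deltaNext y t) := by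
  have h := sum_deltaX_dot x y
  simp only [dotB, sub_dotProduct, dotProduct_sub, Finset.sum_sub_distrib, Finset.sum_add_distrib]
  rw [h]
  ring

/-- The conjugate is determined by a Castaing representation of the epigraph. -/
theorem Kconj_eq_iSup (hK_bot : ∀ t z ω, K t z ω ≠ ⊥) {t : Fin (T + 1)} {ω : Ω}
    {c : ℕ → ((Fin d → ℝ) × (Fin d → ℝ)) × ℝ} (hc : ∀ n, c n ∈ epi fun z => K t z ω)
    (hdense : (epi fun z => K t z ω) ⊆ closure (range c)) (v y : Fin d → ℝ) :
    Kconj K t v y ω = ⨆ n, (((c n).1.1 ⬝ᵥ v + (c n).1.2 ⬝ᵥ y - (c n).2 : ℝ) : EReal) := by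
  refine le_antisymm (iSup₂_le fun x u => ?_) (iSup_le fun n => ?_)
  · induction hKx : K t (x, u) ω with
    | bot => exact absurd hKx (hK_bot _ _ _)
    | top => simp
    | coe a =>
      have hmem : ((x, u), a) ∈ epi fun z => K t z ω := hKx.le
      have hcl : IsClosed {q : ((Fin d → ℝ) × (Fin d → ℝ)) × ℝ |
          ((q.1.1 ⬝ᵥ v + q.1.2 ⬝ᵥ y - q.2 : ℝ) : EReal) ≤
            ⨆ n, (((c n).1.1 ⬝ᵥ v + (c n).1.2 ⬝ᵥ y - (c n).2 : ℝ) : EReal)} := by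
        refine isClosed_le (continuous_coe_real_ereal.comp ?_) continuous_const
        exact ((continuous_dot (by fun_prop) continuous_const).add
          (continuous_dot (by fun_prop) continuous_const)).sub continuous_snd
      have := closure_minimal (range_subset_iff.2 fun n => ?_) hcl (hdense hmem)
      · rw [← EReal.coe_sub]
        exact this
      · exact le_iSup (fun n => (((c n).1.1 ⬝ᵥ v + (c n).1.2 ⬝ᵥ y - (c n).2 : ℝ) : EReal)) n
  · refine le_trans ?_ (le_iSup₂ (f := fun x u =>
      ((x ⬝ᵥ v + u ⬝ᵥ y : ℝ) : EReal) - K t (x, u) ω) (c n).1.1 (c n).1.2)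
    rw [EReal.coe_sub]
    exact EReal.sub_le_sub le_rfl (hc n)

theorem Kconj_ge {t : Fin (T + 1)} {ω : Ω} {x w : Fin d → ℝ} {k : ℝ} (h : K t (x, w) ω = k)
    (v y : Fin d → ℝ) : ((x ⬝ᵥ v + w ⬝ᵥ y - k : ℝ) : EReal) ≤ Kconj K t v y ω := by
  refine le_trans ?_ (le_iSup₂ (f := fun x u =>
      ((x ⬝ᵥ v + u ⬝ᵥ y : ℝ) : EReal) - K t (x, u) ω) x w)
  rw [h, EReal.coe_sub]

end Problem

section Expectation

variable {Ω : Type*} {mΩ : MeasurableSpace Ω} {P : Measure Ω}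

theorem EE_congr {g h : Ω → EReal} (hgh : g =ᵐ[P] h) : EE P g = EE P h :=
  le_antisymm (EE_mono hgh.le) (EE_mono hgh.symm.le)

theorem ae_ne_bot_of_EE_ne_bot {g : Ω → EReal} (hg : Measurable g)
    (hpos : ∫⁻ ω, (g ω).toENNReal ∂P ≠ ⊤) (h : EE P g ≠ ⊥) : ∀ᵐ ω ∂P, g ω ≠ ⊥ := by
  have h2 : ∫⁻ ω, (-(g ω)).toENNReal ∂P ≠ ⊤ := by
    intro h2
    apply h
    rw [EE, if_neg hpos, h2, ← EReal.coe_ennreal_toReal hpos, EReal.coe_ennreal_top]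
    rfl
  have hm : Measurable fun ω => (-(g ω)).toENNReal :=
    (continuous_neg.measurable.comp hg).ereal_toENNReal
  filter_upwards [ae_lt_top hm h2] with ω hω hbot
  simp [hbot] at hω

end Expectation

section WeakDuality

variable {Ω : Type*} {mΩ : MeasurableSpace Ω} {P : Measure Ω} {T d : ℕ}
  {ℱ : Filtration (Fin (T + 1)) mΩ} {K : Fin (T + 1) → (Fin d → ℝ) × (Fin d → ℝ) → Ω → EReal}
  {𝓤 𝓨 : Submodule ℝ (Ω → Traj T d)}

theorem measurable_residual {x y : Ω → Traj T d} (hx : Measurable x) (hy : Measurable y) :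
    Measurable fun ω => ∑ t, x ω t ⬝ᵥ (condDelta P ℱ y t ω - deltaNext (y ω) t) := by
  refine Finset.measurable_sum _ fun t _ => measurable_dot ((measurable_pi_apply t).comp hx) ?_
  refine ((measurable_condDelta y t).mono (ℱ.le t) le_rfl).sub ?_
  unfold deltaNext
  split_ifs
  · exact measurable_const.sub ((measurable_pi_apply _).comp hy)
  · exact ((measurable_pi_apply _).comp hy).sub ((measurable_pi_apply _).comp hy)

theorem integral_residual_of_bounded [IsProbabilityMeasure P] {x y : Ω → Traj T d} (hx : x ∈ AdapInf d P ℱ)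
    (hy : ∀ t, Integrable (fun ω => y ω t) P) :
    Integrable (fun ω => ∑ t, x ω t ⬝ᵥ (condDelta P ℱ y t ω - deltaNext (y ω) t)) P ∧
      ∫ ω, ∑ t, x ω t ⬝ᵥ (condDelta P ℱ y t ω - deltaNext (y ω) t) ∂P = 0 := by
  obtain ⟨hxa, M, hM⟩ := hx
  have h : Integrable (fun ω => ∑ t, x ω t ⬝ᵥ (condDelta P ℱ y t ω - deltaNext (y ω) t)) P := by
    refine integrable_finsetSum _ fun t _ => ?_
    refine integrable_dot_of_bounded (M := M) ((hxa t).mono (ℱ.le t) le_rfl) ?_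
      (integrable_condExp.sub (integrable_deltaNext hy t))
    filter_upwards [hM] with ω hω
    exact (norm_le_pi_norm _ t).trans hω
  exact integral_residual_eq_zero hxa hy (h.sup (integrable_zero _ _ _))

/-- The dual objective is dominated by the conjugate of the value function. -/
theorem EE_dual_le_sub_conj [IsProbabilityMeasure P] (hK_bot : ∀ t z ω, K t z ω ≠ ⊥)
    (hK : ∀ t, IsConvexNormalIntegrand (ℱ t) (K t)) (h𝓤meas : ∀ u ∈ 𝓤, Measurable u)
    (hdual : SeparatingDuality P 𝓤 𝓨) {x₀ u₀ : Ω → Traj T d} (hx₀ : x₀ ∈ AdapInf d P ℱ)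
    (hu₀ : u₀ ∈ 𝓤) (hf₀ : Ef P K x₀ u₀ < ⊤) {y : Ω → Traj T d} (hy : y ∈ 𝓨)
    (hya : y ∈ Adap d ℱ) (hyi : ∀ t, Integrable (fun ω => y ω t) P) {u : Ω → Traj T d}
    (hu : u ∈ 𝓤) :
    EE P (fun ω => ∑ t, (((u ω t ⬝ᵥ y ω t : ℝ) : EReal) -
        Kconj K t (condDelta P ℱ y t ω) (y ω t) ω)) ≤
      ((pairB P u y : ℝ) : EReal) - conj P 𝓤 (fun u' => phi P ℱ K u'.1) y := by
  have hym := Adap.measurable hya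
  have hyt : ∀ t, Measurable fun ω => y ω t := fun t => (measurable_pi_apply t).comp hym
  have hvt : ∀ t, Measurable (condDelta P ℱ y t) := fun t =>
    (measurable_condDelta y t).mono (ℱ.le t) le_rfl
  have hut : ∀ t, Measurable fun ω => u ω t := fun t =>
    (measurable_pi_apply t).comp (h𝓤meas u hu)
  obtain ⟨k₀, hk₀m, hk₀, -, hk₀pos⟩ :=
    exists_real_cost hK_bot hK (Adap.measurable hx₀.1) (h𝓤meas u₀ hu₀) hf₀
  choose c hcm hc using fun t => (hK t).isRandomConvex_epi.exists_castaing
  have hcm' : ∀ t n, Measurable (c t n) := fun t n => (hcm t n).mono (ℱ.le t) le_rfl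
  let Kc : Fin (T + 1) → Ω → EReal := fun t ω => ⨆ n, (((c t n ω).1.1 ⬝ᵥ condDelta P ℱ y t ω +
    (c t n ω).1.2 ⬝ᵥ y ω t - (c t n ω).2 : ℝ) : EReal)
  have hKcm : ∀ t, Measurable (Kc t) := fun t => Measurable.iSup fun n =>
    (((measurable_dot (hcm' t n).fst.fst (hvt t)).add
      (measurable_dot (hcm' t n).fst.snd (hyt t))).sub (hcm' t n).snd).coe_real_ereal
  have hKc : ∀ᵐ ω ∂P, ∀ t, Kconj K t (condDelta P ℱ y t ω) (y ω t) ω = Kc t ω := by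
    filter_upwards [hk₀] with ω hω t
    have hne : (epi fun z => K t z ω).Nonempty :=
      ⟨((x₀ ω t, deltaX (x₀ ω) t + u₀ ω t), k₀ t ω), (hω t).le⟩
    exact Kconj_eq_iSup hK_bot (hc t ω hne).1 (hc t ω hne).2 _ _
  let A : Ω → ℝ := fun ω => ∑ t, (x₀ ω t ⬝ᵥ condDelta P ℱ y t ω +
    (deltaX (x₀ ω) t + u₀ ω t) ⬝ᵥ y ω t)
  have hA : Integrable A P := by
    have h := (hdual.integrable u₀ hu₀ y hy).add (integral_residual_of_bounded hx₀ hyi).1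
    refine h.congr (ae_of_all _ fun ω => ?_)
    have h1 := dotB_sub_deltaX (x₀ ω) (fun t => deltaX (x₀ ω) t + u₀ ω t) (y ω)
      (fun t => condDelta P ℱ y t ω)
    simp only [add_sub_cancel_left] at h1
    have h2 : dotB (u₀ ω) (y ω) = A ω - _ := h1
    simp only [Pi.add_apply, h2]
    ring
  have huy := hdual.integrable u hu y hy
  have hbpos : Integrable (fun ω => max (∑ t, k₀ t ω + (dotB (u ω) (y ω) - A ω)) 0) P :=
    integrable_max_add hk₀pos (Finset.measurable_sum _ fun t _ => hk₀m t).aestronglyMeasurable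
      (huy.sub hA)
  let g : Ω → EReal := fun ω => ∑ t, (((u ω t ⬝ᵥ y ω t : ℝ) : EReal) - Kc t ω)
  have hg : Measurable g := by
    refine Finset.measurable_sum _ fun t _ => ?_
    simp only [sub_eq_add_neg]
    exact (measurable_dot (hut t) (hyt t)).coe_real_ereal.add
      (continuous_neg.measurable.comp (hKcm t))
  have hEEg : EE P (fun ω => ∑ t, (((u ω t ⬝ᵥ y ω t : ℝ) : EReal) -
      Kconj K t (condDelta P ℱ y t ω) (y ω t) ω)) = EE P g := by
    refine EE_congr ?_
    filter_upwards [hKc] with ω hω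
    simp only [g, hω]
  rw [hEEg]
  by_cases hbot : EE P g = ⊥
  · rw [hbot]; exact bot_le
  have hKge : ∀ᵐ ω ∂P, ∀ t, ((x₀ ω t ⬝ᵥ condDelta P ℱ y t ω +
      (deltaX (x₀ ω) t + u₀ ω t) ⬝ᵥ y ω t - k₀ t ω : ℝ) : EReal) ≤ Kc t ω := by
    filter_upwards [hKc, hk₀] with ω h1 h2 t
    rw [← h1 t]
    exact Kconj_ge (h2 t) _ _
  have hgle : ∀ᵐ ω ∂P, g ω ≤ ((∑ t, k₀ t ω + (dotB (u ω) (y ω) - A ω) : ℝ) : EReal) := by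
    filter_upwards [hKge] with ω hω
    have h1 : ∑ t, k₀ t ω + (dotB (u ω) (y ω) - A ω) = ∑ t, (u ω t ⬝ᵥ y ω t -
        (x₀ ω t ⬝ᵥ condDelta P ℱ y t ω + (deltaX (x₀ ω) t + u₀ ω t) ⬝ᵥ y ω t - k₀ t ω)) := by
      simp only [A, dotB, Finset.sum_sub_distrib]
      ring
    rw [h1, coe_finset_sum]
    refine Finset.sum_le_sum fun t _ => ?_
    rw [EReal.coe_sub]
    exact EReal.sub_le_sub le_rfl (hω t)
  have hgfin : ∫⁻ ω, (g ω).toENNReal ∂P ≠ ⊤ := by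
    refine ne_top_of_le_ne_top hbpos.lintegral_lt_top.ne (lintegral_mono_ae ?_)
    filter_upwards [hgle] with ω hω
    refine (EReal.toENNReal_le_toENNReal hω).trans ?_
    rw [EReal.real_coe_toENNReal]
    exact ENNReal.ofReal_le_ofReal (le_max_left _ _)
  have hgbot := ae_ne_bot_of_EE_ne_bot hg hgfin hbot
  have hreal : ∀ᵐ ω ∂P, ∀ t, Kc t ω = ((Kc t ω).toReal : EReal) := by
    filter_upwards [hgbot, hKge] with ω h1 h2 t
    refine (EReal.coe_toReal (fun htop => ne_bot_of_sum_ne_bot h1 t ?_) ?_).symm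
    · rw [htop, EReal.sub_top]
    · exact ne_bot_of_le_ne_bot (EReal.coe_ne_bot _) (h2 t)
  have hκm : Measurable fun ω => ∑ t, (Kc t ω).toReal :=
    Finset.measurable_sum _ fun t _ => (hKcm t).ereal_toReal
  have hgr : g =ᵐ[P] fun ω => ((dotB (u ω) (y ω) - ∑ t, (Kc t ω).toReal : ℝ) : EReal) := by
    filter_upwards [hreal] with ω hω
    simp only [g, dotB]
    rw [← Finset.sum_sub_distrib, coe_finset_sum]
    refine Finset.sum_congr rfl fun t _ => ?_
    rw [EReal.coe_sub, ← hω t]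
  have hdm : Measurable fun ω => dotB (u ω) (y ω) :=
    Finset.measurable_sum _ fun t _ => measurable_dot (hut t) (hyt t)
  rw [EE_congr hgr] at hbot ⊢
  have hrpos : Integrable (fun ω => max (dotB (u ω) (y ω) - ∑ t, (Kc t ω).toReal) 0) P := by
    refine integrable_max_of_le (hdm.sub hκm).aestronglyMeasurable hbpos ?_
    filter_upwards [hgle, hgr] with ω h1 h2
    rw [h2, EReal.coe_le_coe_iff] at h1
    exact h1.trans (le_max_left _ _)
  have hr : Integrable (fun ω => dotB (u ω) (y ω) - ∑ t, (Kc t ω).toReal) P :=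
    integrable_of_EE_ne_bot (hdm.sub hκm) hrpos hbot
  have hκ : Integrable (fun ω => ∑ t, (Kc t ω).toReal) P := by
    refine (huy.sub hr).congr (ae_of_all _ fun ω => ?_)
    simp
  rw [EE_coe_of_integrable hr, integral_sub huy hκ, EReal.coe_sub]
  refine EReal.sub_le_sub le_rfl (iSup_le fun u' => ?_)
  have hphi : ((pairB P u'.1 y - ∫ ω, ∑ t, (Kc t ω).toReal ∂P : ℝ) : EReal) ≤
      phi P ℱ K u'.1 := by
    refine le_iInf₂ fun x hx => ?_
    by_cases hfin : Ef P K x u'.1 < ⊤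
    swap
    · rw [not_lt_top_iff.1 hfin]; exact le_top
    have hxm := Adap.measurable hx
    have hu'y := hdual.integrable u'.1 u'.2 y hy
    obtain ⟨k, hkm, hk, hfk, hkpos⟩ :=
      exists_real_cost hK_bot hK hxm (h𝓤meas u'.1 u'.2) hfin
    have hle : ∀ᵐ ω ∂P, ∑ t, x ω t ⬝ᵥ (condDelta P ℱ y t ω - deltaNext (y ω) t) +
        dotB (u'.1 ω) (y ω) - ∑ t, (Kc t ω).toReal ≤ ∑ t, k t ω := by
      filter_upwards [hk, hKc, hreal] with ω h1 h2 h3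
      have e1 := dotB_sub_deltaX (x ω) (fun t => deltaX (x ω) t + u'.1 ω t) (y ω)
        (fun t => condDelta P ℱ y t ω)
      simp only [add_sub_cancel_left] at e1
      have e2 : ∑ t, (x ω t ⬝ᵥ condDelta P ℱ y t ω + (deltaX (x ω) t + u'.1 ω t) ⬝ᵥ y ω t) ≤
          ∑ t, (k t ω + (Kc t ω).toReal) := by
        refine Finset.sum_le_sum fun t _ => ?_
        have e3 := Kconj_ge (h1 t) (condDelta P ℱ y t ω) (y ω t)
        rw [h2 t, h3 t, EReal.coe_le_coe_iff] at e3
        linarith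
      rw [Finset.sum_add_distrib (f := fun t => k t ω)] at e2
      have e4 : dotB (u'.1 ω) (y ω) = _ := e1
      rw [e4]
      linarith
    obtain ⟨hS, hS0⟩ := integral_residual_eq_zero hx hyi (integrable_max_of_le
      (measurable_residual hxm hym).aestronglyMeasurable ((hkpos.add hκ).sub hu'y) (by
        filter_upwards [hle] with ω hω
        simp only [Pi.sub_apply, Pi.add_apply]
        linarith [le_max_left (∑ t, k t ω) 0]))
    have hSu : Integrable (fun ω => ∑ t, x ω t ⬝ᵥ (condDelta P ℱ y t ω - deltaNext (y ω) t) +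
        dotB (u'.1 ω) (y ω)) P := hS.add hu'y
    have hInt : Integrable (fun ω => ∑ t, x ω t ⬝ᵥ (condDelta P ℱ y t ω - deltaNext (y ω) t) +
        dotB (u'.1 ω) (y ω) - ∑ t, (Kc t ω).toReal) P := hSu.sub hκ
    have hval : ∫ ω, (∑ t, x ω t ⬝ᵥ (condDelta P ℱ y t ω - deltaNext (y ω) t) +
        dotB (u'.1 ω) (y ω) - ∑ t, (Kc t ω).toReal) ∂P =
        pairB P u'.1 y - ∫ ω, ∑ t, (Kc t ω).toReal ∂P := by
      rw [integral_sub hSu hκ, integral_add hS hu'y, hS0, zero_add, pairB]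
    rw [← hval, ← EE_coe_of_integrable hInt]
    refine EE_mono ?_
    filter_upwards [hle, hfk] with ω h1 h2
    rw [h2]
    exact EReal.coe_le_coe_iff.2 h1
  refine (EReal.sub_le_sub le_rfl hphi).trans ?_
  rw [← EReal.coe_sub, sub_sub_cancel]

end WeakDuality

section StrongDuality

variable {Ω : Type*} {mΩ : MeasurableSpace Ω} {P : Measure Ω} {T d : ℕ}
  {ℱ : Filtration (Fin (T + 1)) mΩ} {K : Fin (T + 1) → (Fin d → ℝ) × (Fin d → ℝ) → Ω → EReal}
  {𝓤 𝓨 : Submodule ℝ (Ω → Traj T d)}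

/-- If all improvements of a base point by patching candidates have bounded expected value, then
the pointwise suprema over the candidates have a bounded expectation as well. -/
theorem exists_integrable_sup {n : ℕ} {m : Fin n → MeasurableSpace Ω} (hm : ∀ i, m i ≤ mΩ)
    {E : Type*} [NormedAddCommGroup E] [MeasurableSpace E] [BorelSpace E]
    [SecondCountableTopology E] {b : Fin n → Ω → E} (hb : ∀ i, Measurable[m i] (b i))
    {c : Fin n → ℕ → Ω → E} (hc : ∀ i k, Measurable[m i] (c i k)) {val : Fin n → Ω → E → ℝ}
    (hval : ∀ i (f : Ω → E), Measurable[m i] f → Measurable[m i] fun ω => val i ω (f ω)) {C : ℝ}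
    (hsel : ∀ s : Fin n → Ω → E, (∀ i, Measurable[m i] (s i)) →
      (∀ i, ∃ M : ℝ, ∀ ω, ‖s i ω - b i ω‖ ≤ M) →
      (∀ i ω, s i ω = b i ω ∨ ∃ k, s i ω = c i k ω) →
      (∀ i ω, val i ω (b i ω) ≤ val i ω (s i ω)) →
      Integrable (fun ω => ∑ i, val i ω (s i ω)) P ∧ ∫ ω, ∑ i, val i ω (s i ω) ∂P ≤ C) :
    ∃ η : Fin n → Ω → ℝ, (∀ i, Measurable[mΩ] (η i)) ∧
      (∀ᵐ ω ∂P, ∀ i k, val i ω (c i k ω) ≤ η i ω) ∧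
      Integrable (fun ω => ∑ i, η i ω) P ∧ ∫ ω, ∑ i, η i ω ∂P ≤ C := by
  choose s hsm hsM hsel' hs0 hsmono hssup using
    fun i => exists_patching (m := m i) (hb i) (hc i) (hval i)
  have key := fun j => hsel (fun i => s i j) (fun i => hsm i j) (fun i => hsM i j)
    (fun i ω => hsel' i j ω) (fun i ω => by
      have := hsmono i ω (Nat.zero_le j)
      simpa only [hs0] using this)
  obtain ⟨η, hηm, hηlub, hηi, hηC⟩ := exists_limit_of_monotone (P := P)
    (v := fun i j ω => val i ω (s i j ω)) (fun i j => (hval i _ (hsm i j)).mono (hm i) le_rfl)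
    (fun i ω => hsmono i ω) (fun j => (key j).1) (fun j => (key j).2)
  refine ⟨η, hηm, ?_, hηi, hηC⟩
  filter_upwards [hηlub] with ω hω i k
  obtain ⟨j, hj⟩ := hssup i ω k
  exact hj.trans ((hω i).1 ⟨j, rfl⟩)

theorem exists_bound_of_forall {a : Ω → Traj T d} (h : ∀ t, ∃ M : ℝ, ∀ᵐ ω ∂P, ‖a ω t‖ ≤ M) :
    ∃ M : ℝ, ∀ᵐ ω ∂P, ‖a ω‖ ≤ M := by
  choose M hM using h
  refine ⟨∑ t, |M t|, ?_⟩
  filter_upwards [ae_all_iff.2 hM] with ω hω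
  refine (pi_norm_le_iff_of_nonneg (Finset.sum_nonneg fun t _ => abs_nonneg _)).2 fun t => ?_
  exact (hω t).trans ((le_abs_self _).trans
    (Finset.single_le_sum (f := fun t => |M t|) (fun t _ => abs_nonneg _) (Finset.mem_univ t)))

theorem integrable_dotB_deltaX {x y : Ω → Traj T d} (hx : x ∈ AdapInf d P ℱ)
    (hy : ∀ t, Integrable (fun ω => y ω t) P) :
    Integrable (fun ω => ∑ t, deltaX (x ω) t ⬝ᵥ y ω t) P := by
  obtain ⟨hxa, M, hM⟩ := hx
  refine integrable_finsetSum _ fun t _ => integrable_dot_of_bounded (M := 2 * M)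
    ((measurable_deltaX hxa t).mono (ℱ.le t) le_rfl) ?_ (hy t)
  filter_upwards [hM] with ω hω
  exact (norm_deltaX_le _ t).trans (by linarith)

/-- With a finite conjugate of the value function at `y`, the conjugates of the slices of the
integrands at a feasible strategy have a common integrable majorant at `y`. -/
theorem exists_integrable_slice_conj (h𝓤meas : ∀ u ∈ 𝓤, Measurable u)
    (h𝓤dec : Decomposable P 𝓤) (hdual : SeparatingDuality P 𝓤 𝓨) {x₀ u₀ : Ω → Traj T d}
    (hx₀ : x₀ ∈ AdapInf d P ℱ) (hu₀ : u₀ ∈ 𝓤) {k₀ : Fin (T + 1) → Ω → ℝ}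
    (hk₀m : ∀ t, Measurable (k₀ t))
    (hk₀ : ∀ᵐ ω ∂P, ∀ t, K t (x₀ ω t, deltaX (x₀ ω) t + u₀ ω t) ω = k₀ t ω)
    (hk₀pos : Integrable (fun ω => max (∑ t, k₀ t ω) 0) P)
    {y : Ω → Traj T d} (hy : y ∈ 𝓨) (hym : Measurable y)
    (hyi : ∀ t, Integrable (fun ω => y ω t) P) {C : ℝ}
    (hC : conj P 𝓤 (fun u' => phi P ℱ K u'.1) y ≤ C)
    {c : Fin (T + 1) → ℕ → Ω → (Fin d → ℝ) × ℝ} (hcm : ∀ t n, Measurable[ℱ t] (c t n))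
    (hc : ∀ᵐ ω ∂P, ∀ t n, c t n ω ∈ epi fun w => K t (x₀ ω t, w) ω) :
    ∃ η : Fin (T + 1) → Ω → ℝ, (∀ t, Measurable (η t)) ∧
      (∀ᵐ ω ∂P, ∀ t, seqConj (c t) (y ω t) ω ≤ η t ω) ∧
      Integrable (fun ω => ∑ t, η t ω) P := by
  have hyt : ∀ t, Measurable fun ω => y ω t := fun t => (measurable_pi_apply t).comp hym
  have hu₀m := h𝓤meas u₀ hu₀
  have hdx : ∀ t, Measurable fun ω => deltaX (x₀ ω) t := fun t =>
    (measurable_deltaX hx₀.1 t).mono (ℱ.le t) le_rfl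
  have hw₀ : ∀ t, Measurable fun ω => deltaX (x₀ ω) t + u₀ ω t := fun t =>
    (hdx t).add ((measurable_pi_apply t).comp hu₀m)
  have hD := integrable_dotB_deltaX hx₀ hyi
  obtain ⟨η, hηm, hη, hηi, -⟩ := exists_integrable_sup (P := P) (m := fun _ => mΩ)
    (fun _ => le_rfl) (b := fun t ω => (deltaX (x₀ ω) t + u₀ ω t, k₀ t ω))
    (fun t => (hw₀ t).prodMk (hk₀m t)) (c := c) (fun t n => (hcm t n).mono (ℱ.le t) le_rfl)
    (val := fun t ω p => p.1 ⬝ᵥ y ω t - p.2)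
    (fun t f hf => (measurable_dot hf.fst (hyt t)).sub hf.snd)
    (C := C + ∫ ω, ∑ t, deltaX (x₀ ω) t ⬝ᵥ y ω t ∂P) (by
      intro s hsm hsM hsel hsge
      let us : Ω → Traj T d := fun ω t => (s t ω).1 - deltaX (x₀ ω) t
      have husm : Measurable us := measurable_pi_iff.2 fun t => (hsm t).fst.sub (hdx t)
      have hus : us ∈ 𝓤 := by
        obtain ⟨M, hM⟩ := exists_bound_of_forall (P := P) (a := fun ω => us ω - u₀ ω) (by
          intro t
          obtain ⟨M, hM⟩ := hsM t
          refine ⟨M, ae_of_all _ fun ω => ?_⟩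
          have h1 := (norm_fst_le _).trans (hM ω)
          simp only [Prod.fst_sub] at h1
          rw [sub_add_eq_sub_sub] at h1
          exact h1)
        exact h𝓤dec.mem_of_sub_bounded hu₀ hu₀m husm hM
      have husy := hdual.integrable us hus y hy
      have hu₀y := hdual.integrable u₀ hu₀ y hy
      have hdot : ∀ ω, ∑ t, (s t ω).1 ⬝ᵥ y ω t =
          dotB (us ω) (y ω) + ∑ t, deltaX (x₀ ω) t ⬝ᵥ y ω t := by
        intro ω
        simp only [dotB, us, sub_dotProduct, Finset.sum_sub_distrib, sub_add_cancel]
      have hκm : Measurable fun ω => ∑ t, (s t ω).2 :=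
        Finset.measurable_sum _ fun t _ => (hsm t).snd
      have hle : ∀ᵐ ω ∂P, fB K (x₀ ω) (us ω) ω ≤ ((∑ t, (s t ω).2 : ℝ) : EReal) := by
        filter_upwards [hk₀, hc] with ω h1 h2
        rw [coe_finset_sum]
        refine Finset.sum_le_sum fun t _ => ?_
        simp only [us, add_sub_cancel]
        rcases hsel t ω with h | ⟨n, h⟩
        · rw [h]; exact (h1 t).le
        · rw [h]; exact h2 t n
      have hpos : Integrable (fun ω => max (∑ t, (s t ω).2) 0) P := by
        refine integrable_max_of_le hκm.aestronglyMeasurable ((husy.sub hu₀y).add hk₀pos)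
          (ae_of_all _ fun ω => ?_)
        have h1 : ∑ t, ((deltaX (x₀ ω) t + u₀ ω t) ⬝ᵥ y ω t - k₀ t ω) ≤
            ∑ t, ((s t ω).1 ⬝ᵥ y ω t - (s t ω).2) := Finset.sum_le_sum fun t _ => hsge t ω
        simp only [Finset.sum_sub_distrib, add_dotProduct, Finset.sum_add_distrib, hdot] at h1
        have h2 : dotB (u₀ ω) (y ω) = ∑ t, u₀ ω t ⬝ᵥ y ω t := rfl
        simp only [Pi.add_apply, Pi.sub_apply]
        linarith [le_max_left (∑ t, k₀ t ω) 0]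
      obtain ⟨hκi, hκC⟩ := integral_le_of_conj_le hC hx₀.1 hus hκm hle hpos
      have hsum : (fun ω => ∑ t, ((s t ω).1 ⬝ᵥ y ω t - (s t ω).2)) = fun ω =>
          (dotB (us ω) (y ω) + ∑ t, deltaX (x₀ ω) t ⬝ᵥ y ω t) - ∑ t, (s t ω).2 := by
        funext ω
        rw [Finset.sum_sub_distrib, hdot]
      have hadd : Integrable (fun ω => dotB (us ω) (y ω) +
          ∑ t, deltaX (x₀ ω) t ⬝ᵥ y ω t) P := husy.add hD
      rw [hsum]
      refine ⟨hadd.sub hκi, ?_⟩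
      rw [integral_sub hadd hκi, integral_add husy hD]
      unfold pairB at hκC
      linarith)
  refine ⟨η, hηm, ?_, hηi⟩
  filter_upwards [hη] with ω hω t
  exact seqConj_le_iff.2 (hω t)

/-- A feasible point whose controls `w_t = Δx_t + u_t` are adapted and close to the adapted
projection of the given ones. -/
theorem exists_adapted_control [IsProbabilityMeasure P] (hK_bot : ∀ t z ω, K t z ω ≠ ⊥)
    (hK : ∀ t, IsConvexNormalIntegrand (ℱ t) (K t)) (h𝓤meas : ∀ u ∈ 𝓤, Measurable u)
    (h𝓨meas : ∀ y ∈ 𝓨, Measurable y) (h𝓤dec : Decomposable P 𝓤) (h𝓨dec : Decomposable P 𝓨)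
    (hdual : SeparatingDuality P 𝓤 𝓨) (hproj𝓤 : ∀ u ∈ 𝓤, aProj P ℱ u ∈ 𝓤)
    (hproj𝓨 : ∀ y ∈ 𝓨, aProj P ℱ y ∈ 𝓨) (hui : ∀ u ∈ 𝓤, ∀ t, Integrable (fun ω => u ω t) P)
    (hyi : ∀ y ∈ 𝓨, ∀ t, Integrable (fun ω => y ω t) P)
    {x₀ u₀ : Ω → Traj T d} (hx₀ : x₀ ∈ AdapInf d P ℱ) (hu₀ : u₀ ∈ 𝓤) (hf₀ : Ef P K x₀ u₀ < ⊤)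
    {y : Ω → Traj T d} (hy : y ∈ 𝓨) {C : ℝ}
    (hC : conj P 𝓤 (fun u' => phi P ℱ K u'.1) y ≤ C) :
    ∃ (w : Fin (T + 1) → Ω → Fin d → ℝ) (k : Fin (T + 1) → Ω → ℝ),
      (∀ t, Measurable[ℱ t] (w t)) ∧ (∀ t, Measurable[ℱ t] (k t)) ∧
      (∀ t, ∀ᵐ ω ∂P, ‖w t ω - (deltaX (x₀ ω) t + aProj P ℱ u₀ ω t)‖ ≤ 1) ∧
      (∀ᵐ ω ∂P, ∀ t, K t (x₀ ω t, w t ω) ω = k t ω) ∧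
      Integrable (fun ω => max (∑ t, k t ω) 0) P := by
  have hym := h𝓨meas y hy
  have hyt : ∀ t, Measurable fun ω => y ω t := fun t => (measurable_pi_apply t).comp hym
  have hu₀m := h𝓤meas u₀ hu₀
  have hdx : ∀ t, Measurable fun ω => deltaX (x₀ ω) t := fun t =>
    (measurable_deltaX hx₀.1 t).mono (ℱ.le t) le_rfl
  have hw₀ : ∀ t, Measurable fun ω => deltaX (x₀ ω) t + u₀ ω t := fun t =>
    (hdx t).add ((measurable_pi_apply t).comp hu₀m)
  have hdxi : ∀ t, Integrable (fun ω => deltaX (x₀ ω) t) P := by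
    obtain ⟨M, hM⟩ := hx₀.2
    intro t
    refine Integrable.of_bound (hdx t).aestronglyMeasurable (2 * M) ?_
    filter_upwards [hM] with ω hω
    exact (norm_deltaX_le _ t).trans (by linarith)
  have hw₀i : ∀ t, Integrable (fun ω => deltaX (x₀ ω) t + u₀ ω t) P := fun t =>
    (hdxi t).add (hui u₀ hu₀ t)
  have hcond : ∀ t, P[fun ω => deltaX (x₀ ω) t + u₀ ω t|ℱ t] =ᵐ[P]
      fun ω => deltaX (x₀ ω) t + aProj P ℱ u₀ ω t := by
    intro t
    have h1 : P[fun ω => deltaX (x₀ ω) t + u₀ ω t|ℱ t] =ᵐ[P]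
        P[fun ω => deltaX (x₀ ω) t|ℱ t] + P[fun ω => u₀ ω t|ℱ t] :=
      condExp_add (hdxi t) (hui u₀ hu₀ t) _
    rw [condExp_of_stronglyMeasurable (ℱ.le t) (measurable_deltaX hx₀.1 t).stronglyMeasurable
      (hdxi t)] at h1
    exact h1
  obtain ⟨k₀, hk₀m, hk₀, hfk₀, hk₀pos⟩ :=
    exists_real_cost hK_bot hK (Adap.measurable hx₀.1) hu₀m hf₀
  have hN : ∀ t, IsConvexNormalIntegrand (ℱ t) fun w ω => K t (x₀ ω t, w) ω := fun t =>
    (hK t).slice (hx₀.1 t)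
  choose c hcm hc using fun t => (hN t).isRandomConvex_epi.exists_castaing
  have hcast : ∀ᵐ ω ∂P, ∀ t, (∀ n, c t n ω ∈ epi fun w => K t (x₀ ω t, w) ω) ∧
      (epi fun w => K t (x₀ ω t, w) ω) ⊆ closure (range fun n => c t n ω) := by
    filter_upwards [hk₀] with ω hω t
    exact hc t ω ⟨(deltaX (x₀ ω) t + u₀ ω t, k₀ t ω), (hω t).le⟩
  obtain ⟨η, hηm, hη, hηi⟩ := exists_integrable_slice_conj h𝓤meas h𝓤dec hdual hx₀ hu₀
    hk₀m hk₀ hk₀pos hy hym (hyi y hy) hC hcm (hcast.mono fun ω h t => (h t).1)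
  have hk₀i : Integrable (fun ω => ∑ t, k₀ t ω) P :=
    (integral_le_of_conj_le hC hx₀.1 hu₀ (Finset.measurable_sum _ fun t _ => hk₀m t)
      (hfk₀.mono fun ω h => h.le) hk₀pos).1
  have hu₀y := hdual.integrable u₀ hu₀ y hy
  have hD := integrable_dotB_deltaX hx₀ (hyi y hy)
  obtain ⟨w, k, hwm, hkm, hw1, hNw, hkpos⟩ := exists_adapted_feasible (P := P)
    (m := fun t => ℱ t) (fun t => ℱ.le t) (fun _ _ h => ℱ.mono h) hN
    (H := fun t => seqConj (c t)) (fun t => isConvexNormalIntegrand_seqConj (hcm t))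
    (fun t z ω => hK_bot _ _ _)
    (fun t z ω => ne_bot_of_le_ne_bot (EReal.coe_ne_bot _)
      (le_iSup (fun n => (((c t n ω).1 ⬝ᵥ z - (c t n ω).2 : ℝ) : EReal)) 0))
    (fun t => by
      filter_upwards [hcast] with ω hω w z α β h1 h2
      have hcl : IsClosed {q : (Fin d → ℝ) × ℝ | q.1 ⬝ᵥ z - q.2 ≤ β} :=
        isClosed_le ((continuous_dot continuous_fst continuous_const).sub continuous_snd)
          continuous_const
      have h3 := closure_minimal (range_subset_iff.2 fun n => seqConj_le_iff.1 h2 n) hcl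
        ((hω t).2 (show (w, α) ∈ epi fun w => K t (x₀ ω t, w) ω from h1))
      have h4 : w ⬝ᵥ z - α ≤ β := h3
      linarith)
    (w := fun t ω => deltaX (x₀ ω) t + u₀ ω t) (y := fun t ω => y ω t) hw₀i (hyi y hy) hw₀ hyt
    hk₀m hηm (fun t => hk₀.mono fun ω h => (h t).le) (fun t => hη.mono fun ω h => h t)
    (by
      refine ((hk₀i.add hηi).sub (hD.add hu₀y)).congr (ae_of_all _ fun ω => ?_)
      simp only [Pi.add_apply, Pi.sub_apply, dotB, add_dotProduct, Finset.sum_add_distrib,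
        Finset.sum_sub_distrib])
    hk₀pos (by
      intro w' y' hw'm hy'm hw' hy'
      have hp : (fun ω t => deltaX (x₀ ω) t + u₀ ω t - w' t ω) ∈ 𝓤 := by
        obtain ⟨M, hM⟩ := exists_bound_of_forall (P := P)
          (a := fun ω => (fun t => deltaX (x₀ ω) t + u₀ ω t - w' t ω) -
            (u₀ ω - aProj P ℱ u₀ ω)) (by
          intro t
          refine ⟨1, ?_⟩
          filter_upwards [hw' t, hcond t] with ω h1 h2
          rw [h2, norm_sub_rev] at h1
          refine le_trans (le_of_eq ?_) h1
          congr 1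
          simp only [Pi.sub_apply]
          abel)
        exact h𝓤dec.mem_of_sub_bounded (𝓤.sub_mem hu₀ (hproj𝓤 u₀ hu₀))
          (hu₀m.sub (h𝓤meas _ (hproj𝓤 u₀ hu₀)))
          (measurable_pi_iff.2 fun t => (hw₀ t).sub ((hw'm t).mono (ℱ.le t) le_rfl)) hM
      have hq : (fun ω t => y' t ω) ∈ 𝓨 := by
        obtain ⟨M, hM⟩ := exists_bound_of_forall (P := P)
          (a := fun ω => (fun t => y' t ω) - aProj P ℱ y ω) (fun t => ⟨1, hy' t⟩)
        exact h𝓨dec.mem_of_sub_bounded (hproj𝓨 y hy) (h𝓨meas _ (hproj𝓨 y hy))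
          (measurable_pi_iff.2 fun t => (hy'm t).mono (ℱ.le t) le_rfl) hM
      exact ⟨hdual.integrable _ hp _ (𝓨.sub_mem hy hq), hdual.integrable _ hp _ hq⟩)
  refine ⟨w, k, hwm, hkm, fun t => ?_, ae_all_iff.2 hNw, hkpos⟩
  filter_upwards [hw1 t, hcond t] with ω h1 h2
  rwa [h2] at h1

/-- The conjugate of the value function at `y` dominates the dual objective at the adapted
projection of `y`. -/
theorem sub_conj_le_EE_dual [IsProbabilityMeasure P] (hK_bot : ∀ t z ω, K t z ω ≠ ⊥)
    (hK : ∀ t, IsConvexNormalIntegrand (ℱ t) (K t)) (h𝓤meas : ∀ u ∈ 𝓤, Measurable u)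
    (h𝓨meas : ∀ y ∈ 𝓨, Measurable y) (h𝓤dec : Decomposable P 𝓤) (h𝓨dec : Decomposable P 𝓨)
    (hdual : SeparatingDuality P 𝓤 𝓨) (hproj𝓤 : ∀ u ∈ 𝓤, aProj P ℱ u ∈ 𝓤)
    (hproj𝓨 : ∀ y ∈ 𝓨, aProj P ℱ y ∈ 𝓨) (hui : ∀ u ∈ 𝓤, ∀ t, Integrable (fun ω => u ω t) P)
    (hyi : ∀ y ∈ 𝓨, ∀ t, Integrable (fun ω => y ω t) P)
    {x₀ u₀ : Ω → Traj T d} (hx₀ : x₀ ∈ AdapInf d P ℱ) (hu₀ : u₀ ∈ 𝓤) (hf₀ : Ef P K x₀ u₀ < ⊤)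
    {y : Ω → Traj T d} (hy : y ∈ 𝓨) {C : ℝ}
    (hC : conj P 𝓤 (fun u' => phi P ℱ K u'.1) y ≤ C) {u : Ω → Traj T d} (hu : u ∈ 𝓤)
    (hua : u ∈ Adap d ℱ) :
    ((pairB P u y - C : ℝ) : EReal) ≤
      EE P (fun ω => ∑ t, (((u ω t ⬝ᵥ aProj P ℱ y ω t : ℝ) : EReal) -
        Kconj K t (condDelta P ℱ (aProj P ℱ y) t ω) (aProj P ℱ y ω t) ω)) := by
  obtain ⟨w₀, k₀, hw₀m, hk₀m, hw₀, hk₀, hk₀pos⟩ := exists_adapted_control hK_bot hK h𝓤meas h𝓨meas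
    h𝓤dec h𝓨dec hdual hproj𝓤 hproj𝓨 hui hyi hx₀ hu₀ hf₀ hy hC
  have hz := hproj𝓨 y hy
  have hpz : ∀ u ∈ 𝓤, u ∈ Adap d ℱ → pairB P u (aProj P ℱ y) = pairB P u y :=
    fun u hu hua => pairB_aProj hdual hproj𝓨 hyi hu hua hy
  have hza : aProj P ℱ y ∈ Adap d ℱ := aProj_mem_adap y
  generalize aProj P ℱ y = z at hz hpz hza ⊢
  have hzi := hyi z hz
  choose c hcm hc using fun t => (hK t).isRandomConvex_epi.exists_castaing
  have hcast : ∀ᵐ ω ∂P, ∀ t, (∀ n, c t n ω ∈ epi fun p => K t p ω) ∧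
      (epi fun p => K t p ω) ⊆ closure (range fun n => c t n ω) := by
    filter_upwards [hk₀] with ω hω t
    exact hc t ω ⟨((x₀ ω t, w₀ t ω), k₀ t ω), (hω t).le⟩
  have hv := fun t => measurable_condDelta (P := P) (ℱ := ℱ) z t
  -- parameters `w - Δx` of bounded perturbations of the base point
  have hmem : ∀ (x : Ω → Traj T d) (w : Fin (T + 1) → Ω → Fin d → ℝ), x ∈ AdapInf d P ℱ →
      (∀ t, Measurable[ℱ t] (w t)) → (∀ t, ∃ M : ℝ, ∀ ω, ‖w t ω - w₀ t ω‖ ≤ M) →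
      (fun ω t => w t ω - deltaX (x ω) t) ∈ 𝓤 ∧
      (fun ω t => w t ω - deltaX (x ω) t) ∈ Adap d ℱ ∧
      Integrable (fun ω => ∑ t, (x ω t ⬝ᵥ condDelta P ℱ z t ω + w t ω ⬝ᵥ z ω t)) P ∧
      ∫ ω, ∑ t, (x ω t ⬝ᵥ condDelta P ℱ z t ω + w t ω ⬝ᵥ z ω t) ∂P =
        pairB P (fun ω t => w t ω - deltaX (x ω) t) y := by
    intro x w hx hw hM
    have ha : (fun ω t => w t ω - deltaX (x ω) t) ∈ Adap d ℱ := fun t =>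
      (hw t).sub (measurable_deltaX hx.1 t)
    have hus : (fun ω t => w t ω - deltaX (x ω) t) ∈ 𝓤 := by
      obtain ⟨Mx, hMx⟩ := hx.2
      obtain ⟨M₀, hM₀⟩ := hx₀.2
      obtain ⟨M, hM⟩ := exists_bound_of_forall (P := P)
        (a := fun ω => (fun t => w t ω - deltaX (x ω) t) - aProj P ℱ u₀ ω) (by
        intro t
        obtain ⟨M, hM⟩ := hM t
        refine ⟨M + 1 + (2 * M₀ + 2 * Mx), ?_⟩
        filter_upwards [hMx, hM₀, hw₀ t] with ω h1 h2 h3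
        have e : ((fun t => w t ω - deltaX (x ω) t) - aProj P ℱ u₀ ω) t = (w t ω - w₀ t ω) +
            (w₀ t ω - (deltaX (x₀ ω) t + aProj P ℱ u₀ ω t)) +
            (deltaX (x₀ ω) t - deltaX (x ω) t) := by
          simp only [Pi.sub_apply]
          abel
        rw [e]
        refine (norm_add_le _ _).trans (add_le_add ((norm_add_le _ _).trans
          (add_le_add (hM ω) h3)) ((norm_sub_le _ _).trans (add_le_add ?_ ?_)))
        · exact (norm_deltaX_le _ t).trans (by linarith)
        · exact (norm_deltaX_le _ t).trans (by linarith))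
      exact h𝓤dec.mem_of_sub_bounded (hproj𝓤 u₀ hu₀) (h𝓤meas _ (hproj𝓤 u₀ hu₀))
        (Adap.measurable ha) hM
    have h1 := hdual.integrable _ hus z hz
    obtain ⟨h2, h3⟩ := integral_residual_of_bounded hx hzi
    have h4 : (fun ω => ∑ t, (x ω t ⬝ᵥ condDelta P ℱ z t ω + w t ω ⬝ᵥ z ω t)) = fun ω =>
        dotB (fun t => w t ω - deltaX (x ω) t) (z ω) +
          ∑ t, x ω t ⬝ᵥ (condDelta P ℱ z t ω - deltaNext (z ω) t) := by
      funext ω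
      rw [dotB_sub_deltaX (x ω) (fun t => w t ω) (z ω) (fun t => condDelta P ℱ z t ω)]
      ring
    rw [h4]
    refine ⟨hus, ha, h1.add h2, ?_⟩
    rw [integral_add h1 h2, h3, add_zero, ← hpz _ hus ha, pairB]
  obtain ⟨η, hηm, hη, hηi, hηC⟩ := exists_integrable_sup (P := P) (m := fun t => ℱ t)
    (fun t => ℱ.le t) (b := fun t ω => ((x₀ ω t, w₀ t ω), k₀ t ω))
    (fun t => ((hx₀.1 t).prodMk (hw₀m t)).prodMk (hk₀m t)) (c := c) hcm
    (val := fun t ω p => p.1.1 ⬝ᵥ condDelta P ℱ z t ω + p.1.2 ⬝ᵥ z ω t - p.2)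
    (fun t f hf => ((measurable_dot hf.fst.fst (hv t)).add
      (measurable_dot hf.fst.snd (hza t))).sub hf.snd)
    (C := C) (by
      intro s hsm hsM hsel hsge
      have hx : (fun ω t => (s t ω).1.1) ∈ AdapInf d P ℱ := by
        refine ⟨fun t => (hsm t).fst.fst, ?_⟩
        obtain ⟨M₀, hM₀⟩ := hx₀.2
        refine exists_bound_of_forall fun t => ?_
        obtain ⟨M, hM⟩ := hsM t
        refine ⟨M + M₀, ?_⟩
        filter_upwards [hM₀] with ω hω
        have h1 : ‖(s t ω).1.1 - x₀ ω t‖ ≤ M :=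
          ((norm_fst_le (s t ω - ((x₀ ω t, w₀ t ω), k₀ t ω)).1).trans
            (norm_fst_le (s t ω - ((x₀ ω t, w₀ t ω), k₀ t ω)))).trans (hM ω)
        have h2 := norm_le_pi_norm (x₀ ω) t
        have h3 := norm_sub_norm_le (s t ω).1.1 (x₀ ω t)
        linarith
      have hwM : ∀ t, ∃ M : ℝ, ∀ ω, ‖(s t ω).1.2 - w₀ t ω‖ ≤ M := by
        intro t
        obtain ⟨M, hM⟩ := hsM t
        exact ⟨M, fun ω => ((norm_snd_le (s t ω - ((x₀ ω t, w₀ t ω), k₀ t ω)).1).trans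
          (norm_fst_le (s t ω - ((x₀ ω t, w₀ t ω), k₀ t ω)))).trans (hM ω)⟩
      obtain ⟨hus, -, hAi, hA⟩ := hmem _ (fun t ω => (s t ω).1.2) hx
        (fun t => (hsm t).fst.snd) hwM
      obtain ⟨-, -, hBi, -⟩ := hmem x₀ w₀ hx₀ hw₀m (fun t => ⟨0, fun ω => by simp⟩)
      have hκm : Measurable fun ω => ∑ t, (s t ω).2 :=
        Finset.measurable_sum _ fun t _ => (hsm t).snd.mono (ℱ.le t) le_rfl
      have hle : ∀ᵐ ω ∂P, fB K (fun t => (s t ω).1.1)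
          (fun t => (s t ω).1.2 - deltaX (fun t => (s t ω).1.1) t) ω ≤
            ((∑ t, (s t ω).2 : ℝ) : EReal) := by
        filter_upwards [hk₀, hcast] with ω h1 h2
        rw [coe_finset_sum]
        refine Finset.sum_le_sum fun t _ => ?_
        simp only [add_sub_cancel]
        rcases hsel t ω with h | ⟨n, h⟩
        · rw [h]; exact (h1 t).le
        · rw [h]; exact (h2 t).1 n
      have hpos : Integrable (fun ω => max (∑ t, (s t ω).2) 0) P := by
        refine integrable_max_of_le hκm.aestronglyMeasurable ((hAi.sub hBi).add hk₀pos)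
          (ae_of_all _ fun ω => ?_)
        have h1 : ∑ t, (x₀ ω t ⬝ᵥ condDelta P ℱ z t ω + w₀ t ω ⬝ᵥ z ω t - k₀ t ω) ≤
            ∑ t, ((s t ω).1.1 ⬝ᵥ condDelta P ℱ z t ω + (s t ω).1.2 ⬝ᵥ z ω t - (s t ω).2) :=
          Finset.sum_le_sum fun t _ => hsge t ω
        rw [Finset.sum_sub_distrib, Finset.sum_sub_distrib] at h1
        simp only [Pi.add_apply, Pi.sub_apply]
        linarith [le_max_left (∑ t, k₀ t ω) 0]
      obtain ⟨hκi, hκC⟩ := integral_le_of_conj_le hC hx.1 hus hκm hle hpos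
      simp only [Finset.sum_sub_distrib]
      refine ⟨hAi.sub hκi, ?_⟩
      rw [integral_sub hAi hκi, hA]
      exact hκC)
  have hKη : ∀ᵐ ω ∂P, ∀ t, Kconj K t (condDelta P ℱ z t ω) (z ω t) ω ≤ η t ω := by
    filter_upwards [hη, hcast] with ω h1 h2 t
    rw [Kconj_eq_iSup hK_bot (h2 t).1 (h2 t).2]
    exact iSup_le fun n => EReal.coe_le_coe_iff.2 (h1 t n)
  have huz := hdual.integrable u hu z hz
  have hInt : Integrable (fun ω => dotB (u ω) (z ω) - ∑ t, η t ω) P := huz.sub hηi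
  have h1 : ((pairB P u y - C : ℝ) : EReal) ≤
      EE P fun ω => ((dotB (u ω) (z ω) - ∑ t, η t ω : ℝ) : EReal) := by
    rw [EE_coe_of_integrable hInt, EReal.coe_le_coe_iff, integral_sub huz hηi, ← hpz u hu hua,
      pairB]
    linarith
  refine h1.trans (EE_mono ?_)
  filter_upwards [hKη] with ω hω
  simp only [dotB]
  rw [← Finset.sum_sub_distrib, coe_finset_sum]
  refine Finset.sum_le_sum fun t _ => ?_
  rw [EReal.coe_sub]
  exact EReal.sub_le_sub le_rfl (hω t)

end StrongDuality

end Bolza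

/-- Dual representation of the closure of the value function of the stochastic problem of Bolza
at adapted parameters. -/
theorem stmt_9
    {Ω : Type*} {mΩ : MeasurableSpace Ω} (P : Measure Ω) [IsProbabilityMeasure P]
    {T d : ℕ} (ℱ : Filtration (Fin (T + 1)) mΩ)
    -- the σ-algebras are complete
    (hℱ : ∀ t (s : Set Ω), P s = 0 → MeasurableSet[ℱ t] s)
    -- the `K_t` are `𝓕_t`-measurable convex normal integrands with values in `(-∞,+∞]`
    (K : Fin (T + 1) → (Fin d → ℝ) × (Fin d → ℝ) → Ω → EReal)
    (hK_bot : ∀ t z ω, K t z ω ≠ ⊥)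
    (hK : ∀ t, IsConvexNormalIntegrand (ℱ t) (K t))
    -- `𝓤` and `𝓨` are decomposable spaces of random vectors in separating duality
    (𝓤 𝓨 : Submodule ℝ (Ω → Traj T d))
    (h𝓤meas : ∀ u ∈ 𝓤, Measurable u) (h𝓨meas : ∀ y ∈ 𝓨, Measurable y)
    (h𝓤dec : Decomposable P 𝓤) (h𝓨dec : Decomposable P 𝓨)
    (hdual : SeparatingDuality P 𝓤 𝓨)
    -- assumption (i): there are `x ∈ 𝓝^∞` with `x_t ∈ cl dom₁ K_t`, and for each of them
    -- there is `x̄ ∈ 𝓝^∞` with `x̄_t ∈ ri dom₁ K_t` and the segment `(x̄,x)` lies in `dom₁ Ef`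
    (hne : ∃ x ∈ AdapInf d P ℱ, ∀ t, ∀ᵐ ω ∂P, x ω t ∈ closure (dom1K K t ω))
    (hdom : ∀ x ∈ AdapInf d P ℱ, (∀ t, ∀ᵐ ω ∂P, x ω t ∈ closure (dom1K K t ω)) →
      ∃ xbar ∈ AdapInf d P ℱ,
        (∀ t, ∀ᵐ ω ∂P, xbar ω t ∈ intrinsicInterior ℝ (dom1K K t ω)) ∧
        ∀ lam : ℝ, 0 < lam → lam < 1 → (1 - lam) • x + lam • xbar ∈ dom1Ef P ℱ K 𝓤)
    -- assumption (ii): adapted projections stay in `𝓤` and `𝓨`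
    (hproj𝓤 : ∀ u ∈ 𝓤, aProj P ℱ u ∈ 𝓤)
    (hproj𝓨 : ∀ y ∈ 𝓨, aProj P ℱ y ∈ 𝓨)
    (u : 𝓤) (hu : u.1 ∈ Adap d ℱ) :
    cl P 𝓤 𝓨 (fun u' => phi P ℱ K u'.1) u =
        (⨆ y ∈ {y : Ω → Traj T d | y ∈ 𝓨 ∧ y ∈ Adap d ℱ},
          EE P (fun ω => ∑ t, (((u.1 ω t ⬝ᵥ y ω t : ℝ) : EReal) -
            Kconj K t (condDelta P ℱ y t ω) (y ω t) ω))) ∧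
      cl P 𝓤 𝓨 (fun u' => phi P ℱ K u'.1) u =
        biconj P 𝓤 𝓨 (fun u' => phi P ℱ K u'.1) u := by
  refine ⟨?_, cl_eq_biconj hdual _ u⟩
  rw [cl_eq_biconj hdual]
  have hyi : ∀ y ∈ 𝓨, ∀ t, Integrable (fun ω => y ω t) P := fun y hy t =>
    integrable_of_pairing h𝓤dec (h𝓨meas y hy) (fun u hu => hdual.integrable u hu y hy) t
  have hui : ∀ u ∈ 𝓤, ∀ t, Integrable (fun ω => u ω t) P := fun u hu t =>
    integrable_of_pairing h𝓨dec (h𝓤meas u hu) (fun y hy => by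
      simpa only [dotB_comm] using hdual.integrable u hu y hy) t
  obtain ⟨x₀, hx₀, u₀, hu₀, hf₀⟩ := exists_bounded_feasible hne hdom
  refine le_antisymm (iSup_le fun y => ?_) (iSup₂_le fun y hy => ?_)
  · refine le_trans ?_ (le_iSup₂ (f := fun (y : Ω → Traj T d)
      (_ : y ∈ {y : Ω → Traj T d | y ∈ 𝓨 ∧ y ∈ Adap d ℱ}) =>
        EE P (fun ω => ∑ t, (((u.1 ω t ⬝ᵥ y ω t : ℝ) : EReal) -
          Kconj K t (condDelta P ℱ y t ω) (y ω t) ω))) (aProj P ℱ y.1)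
      ⟨hproj𝓨 y.1 y.2, aProj_mem_adap y.1⟩)
    induction hC : conj P 𝓤 (fun u' => phi P ℱ K u'.1) y.1 with
    | bot =>
      exfalso
      have h1 : ((pairB P u₀ y.1 : ℝ) : EReal) - phi P ℱ K u₀ ≤ ⊥ := by
        rw [← hC]
        exact le_iSup (fun u' : 𝓤 => ((pairB P u'.1 y.1 : ℝ) : EReal) - phi P ℱ K u'.1) ⟨u₀, hu₀⟩
      have h2 : phi P ℱ K u₀ < ⊤ := (iInf₂_le x₀ hx₀.1).trans_lt hf₀
      rw [le_bot_iff, sub_eq_add_neg, EReal.add_eq_bot_iff] at h1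
      rcases h1 with h1 | h1
      · exact EReal.coe_ne_bot _ h1
      · rw [EReal.neg_eq_bot_iff] at h1
        exact h2.ne h1
    | top => rw [EReal.sub_top]; exact bot_le
    | coe C =>
      rw [← EReal.coe_sub]
      exact sub_conj_le_EE_dual hK_bot hK h𝓤meas h𝓨meas h𝓤dec h𝓨dec hdual hproj𝓤 hproj𝓨 hui hyi
        hx₀ hu₀ hf₀ y.2 hC.le u.2 hu
  · refine (EE_dual_le_sub_conj hK_bot hK h𝓤meas hdual hx₀ hu₀ hf₀ hy.1 hy.2 (hyi y hy.1)
      u.2).trans ?_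
    exact le_iSup (fun y : 𝓨 => ((pairB P u.1 y.1 : ℝ) : EReal) -
      conj P 𝓤 (fun u' => phi P ℱ K u'.1) y.1) ⟨y, hy.1⟩
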